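/- Replica-Symmetric formula (rank one): For every λ > 0, the free energy F_n(λ) converges as n → ∞ to sup_{(q₁,q₂) ∈ Γ(λ)} 𝓕(λ,q₁,q₂), and this limit equals sup_{q₁ ≥ 0} inf_{q₂ ≥ 0} 𝓕(λ,q₁,q₂); moreover both extrema are achieved over the same couples (q₁,q₂) ∈ Γ(λ). -/

import Mathlib

open MeasureTheory ProbabilityTheory Filter Real
open scoped Topology

noncomputable section

/-- Standard Gaussian measure on `ℝ`. -/
def stdG : Measure ℝ := gaussianReal 0 1

/-- The weight `exp(√γ·x·z + γ·x·x₀ − γ·x²/2)` appearing in the scalar Gaussian channel. -/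
def scalarWeight (γ x₀ z x : ℝ) : ℝ :=
  Real.exp (Real.sqrt γ * x * z + γ * x * x₀ - γ * x ^ 2 / 2)

/-- Free energy `ψ_P(γ)` of the scalar Gaussian channel with prior `P`. -/
def psiF (P : Measure ℝ) [IsProbabilityMeasure P] (γ : ℝ) : ℝ :=
  ∫ p : ℝ × ℝ, Real.log (∫ x, scalarWeight γ p.1 p.2 x ∂P) ∂(P.prod stdG)

/-- Posterior mean `⟨x⟩_γ` in the scalar Gaussian channel (`x₀` is the signal, `z` the noise). -/
def postMean (P : Measure ℝ) (γ x₀ z : ℝ) : ℝ :=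
  (∫ x, x * scalarWeight γ x₀ z x ∂P) / (∫ x, scalarWeight γ x₀ z x ∂P)

/-- Overlap `F_P(γ) = E[X₀·⟨x⟩_γ]` of the scalar Gaussian channel. -/
def Fov (P : Measure ℝ) [IsProbabilityMeasure P] (γ : ℝ) : ℝ :=
  ∫ p : ℝ × ℝ, p.1 * postMean P γ p.1 p.2 ∂(P.prod stdG)

/-- The set `Γ(λ)` of fixed points of the state evolution equations. -/
def Gam (PU PV : Measure ℝ) [IsProbabilityMeasure PU] [IsProbabilityMeasure PV]
    (lam : ℝ) : Set (ℝ × ℝ) :=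
  {q | 0 ≤ q.1 ∧ 0 ≤ q.2 ∧ q.2 = Fov PU (lam * q.1) ∧ q.1 = Fov PV (lam * q.2)}

/-- The replica-symmetric potential `𝓕(λ,q₁,q₂)`. -/
def rsF (PU PV : Measure ℝ) [IsProbabilityMeasure PU] [IsProbabilityMeasure PV]
    (lam q₁ q₂ : ℝ) : ℝ :=
  psiF PU (lam * q₁) + psiF PV (lam * q₂) - lam / 2 * q₁ * q₂

/-- Prior distribution of the pair of vectors `(u,v)`. -/
def prior (PU PV : Measure ℝ) [IsProbabilityMeasure PU] [IsProbabilityMeasure PV]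
    (n : ℕ) : Measure ((Fin n → ℝ) × (Fin n → ℝ)) :=
  (Measure.pi fun _ => PU).prod (Measure.pi fun _ => PV)

/-- Law of the Gaussian noise matrix `Z`. -/
def noiseM (n : ℕ) : Measure (Fin n → Fin n → ℝ) :=
  Measure.pi fun _ => Measure.pi fun _ => stdG

/-- Joint law of `((U,V),Z)`. -/
def sampleM (PU PV : Measure ℝ) [IsProbabilityMeasure PU] [IsProbabilityMeasure PV]
    (n : ℕ) : Measure (((Fin n → ℝ) × (Fin n → ℝ)) × (Fin n → Fin n → ℝ)) :=
  (prior PU PV n).prod (noiseM n)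

/-- Hamiltonian `H_n(u,v)` of the planted bipartite model. -/
def Ham (lam : ℝ) (n : ℕ) (U V : Fin n → ℝ) (Z : Fin n → Fin n → ℝ)
    (u v : Fin n → ℝ) : ℝ :=
  ∑ i : Fin n, ∑ j : Fin n,
    (Real.sqrt (lam / n) * u i * v j * Z i j
      + lam / n * (u i * U i * v j * V j)
      - lam / (2 * n) * (u i ^ 2 * v j ^ 2))

/-- Partition function `Z_n = ∫ e^{H_n(u,v)} dP₀ⁿ(u,v)`. -/
def partFun (PU PV : Measure ℝ) [IsProbabilityMeasure PU] [IsProbabilityMeasure PV]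
    (lam : ℝ) (n : ℕ)
    (ω : ((Fin n → ℝ) × (Fin n → ℝ)) × (Fin n → Fin n → ℝ)) : ℝ :=
  ∫ uv, Real.exp (Ham lam n ω.1.1 ω.1.2 ω.2 uv.1 uv.2) ∂(prior PU PV n)

/-- Free energy `F_n(λ) = (1/n)·E[log Z_n]`. -/
def freeEnergy (PU PV : Measure ℝ) [IsProbabilityMeasure PU] [IsProbabilityMeasure PV]
    (n : ℕ) (lam : ℝ) : ℝ :=
  (1 / (n : ℝ)) * ∫ ω, Real.log (partFun PU PV lam n ω) ∂(sampleM PU PV n)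

/-- Gibbs (posterior) expectation `⟨f(u,v)⟩` given the realization `ω = ((U,V),Z)`. -/
def gibbs (PU PV : Measure ℝ) [IsProbabilityMeasure PU] [IsProbabilityMeasure PV]
    (lam : ℝ) (n : ℕ)
    (ω : ((Fin n → ℝ) × (Fin n → ℝ)) × (Fin n → Fin n → ℝ))
    (f : (Fin n → ℝ) × (Fin n → ℝ) → ℝ) : ℝ :=
  (∫ uv, f uv * Real.exp (Ham lam n ω.1.1 ω.1.2 ω.2 uv.1 uv.2) ∂(prior PU PV n))
    / partFun PU PV lam n ω

/-- Rescaled scalar product `x·y = (1/n)·Σᵢ xᵢyᵢ`. -/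
def ovDot (n : ℕ) (x y : Fin n → ℝ) : ℝ := (1 / (n : ℝ)) * ∑ i, x i * y i



/-! ### Gaussian tools -/

instance instProbStdG : IsProbabilityMeasure stdG := by unfold stdG; infer_instance

/-- standard Gaussian vector -/
def GK (K : Type*) [Fintype K] : Measure (K → ℝ) := Measure.pi fun _ => stdG

instance instProbGK (K : Type*) [Fintype K] : IsProbabilityMeasure (GK K) := by
  unfold GK; infer_instance

section gauss
variable {K : Type*} [Fintype K]

def rho (w : K → ℝ) : ℝ := ∏ k, gaussianPDFReal 0 1 (w k)

lemma rho_nonneg (w : K → ℝ) : 0 ≤ rho w :=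
  Finset.prod_nonneg fun _ _ => gaussianPDFReal_nonneg _ _ _

lemma gpdf_eq (x : ℝ) : gaussianPDFReal 0 1 x = (√(2 * π))⁻¹ * rexp (-x ^ 2 / 2) := by
  simp [gaussianPDFReal]

lemma rho_continuous : Continuous (rho : (K → ℝ) → ℝ) := by
  unfold rho
  simp only [gpdf_eq]
  fun_prop

lemma GK_eq : GK K = (volume : Measure (K → ℝ)).withDensity (fun w => ENNReal.ofReal (rho w)) := by
  unfold GK
  refine (Measure.pi_eq (μ := fun _ : K => stdG) ?_)
  intro s hs
  have hbox : MeasurableSet (Set.pi Set.univ s) := MeasurableSet.univ_pi hs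
  rw [withDensity_apply _ hbox]
  have h1 : ((volume : Measure (K → ℝ)).restrict (Set.pi Set.univ s))
      = Measure.pi fun k => (volume : Measure ℝ).restrict (s k) := by
    rw [volume_pi, Measure.restrict_pi_pi]
  have hInt0 : Integrable (rho : (K → ℝ) → ℝ)
      (Measure.pi fun k => (volume : Measure ℝ).restrict (s k)) := by
    unfold rho
    exact Integrable.fintype_prod_dep (fun k => (integrable_gaussianPDFReal 0 1).restrict)
  rw [h1, ← ofReal_integral_eq_lintegral_ofReal hInt0 (ae_of_all _ rho_nonneg)]
  unfold rho
  rw [integral_fintype_prod_eq_prod (f := fun _ x => gaussianPDFReal 0 1 x),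
    ENNReal.ofReal_prod_of_nonneg
      (fun k _ => integral_nonneg fun x => gaussianPDFReal_nonneg _ _ _)]
  refine Finset.prod_congr rfl fun k _ => ?_
  rw [stdG, gaussianReal_apply_eq_integral _ (by simp)]

lemma integral_GK (f : (K → ℝ) → ℝ) : ∫ w, f w ∂(GK K) = ∫ w, rho w * f w := by
  rw [GK_eq, integral_withDensity_eq_integral_toReal_smul
    (rho_continuous.measurable.ennreal_ofReal) (ae_of_all _ fun _ => ENNReal.ofReal_lt_top)]
  simp [ENNReal.toReal_ofReal (rho_nonneg _)]

lemma integrable_GK_iff (f : (K → ℝ) → ℝ) :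
    Integrable f (GK K) ↔ Integrable (fun w => rho w * f w) := by
  rw [GK_eq, integrable_withDensity_iff_integrable_smul'
    (rho_continuous.measurable.ennreal_ofReal) (ae_of_all _ fun _ => ENNReal.ofReal_lt_top)]
  simp [ENNReal.toReal_ofReal (rho_nonneg _)]

lemma rho_sub (w m : K → ℝ) : rho (w - m) = rho w * rexp (∑ k, (m k * w k - m k ^ 2 / 2)) := by
  unfold rho
  rw [Real.exp_sum, ← Finset.prod_mul_distrib]
  refine Finset.prod_congr rfl fun k _ => ?_
  rw [gpdf_eq, gpdf_eq, mul_assoc, ← Real.exp_add]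
  congr 2
  simp only [Pi.sub_apply]; ring

lemma shift_GK (m : K → ℝ) (f : (K → ℝ) → ℝ) :
    ∫ g, f (g + m) ∂(GK K) = ∫ w, rexp (∑ k, (m k * w k - m k ^ 2 / 2)) * f w ∂(GK K) := by
  rw [integral_GK, integral_GK]
  have := integral_add_right_eq_self (μ := (volume : Measure (K → ℝ)))
    (fun w => rho (w - m) * f w) m
  simp only [add_sub_cancel_right] at this
  rw [this]
  refine integral_congr_ae (ae_of_all _ fun w => ?_)
  simp only [rho_sub]; ring

lemma integrable_exp_abs (c : ℝ) : Integrable (fun x : ℝ => rexp (c * |x|)) stdG := by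
  have h1 : Integrable (fun x : ℝ => rexp (c * x)) stdG := integrable_exp_mul_gaussianReal c
  have h2 : Integrable (fun x : ℝ => rexp ((-c) * x)) stdG := integrable_exp_mul_gaussianReal (-c)
  refine (h1.add h2).mono' (by fun_prop) (ae_of_all _ fun x => ?_)
  simp only [Real.norm_eq_abs, Real.abs_exp, Pi.add_apply]
  rcases abs_cases x with ⟨h, _⟩ | ⟨h, _⟩ <;> rw [h]
  · linarith [Real.exp_pos (-c * x)]
  · have : c * -x = -c * x := by ring
    rw [this]; linarith [Real.exp_pos (c * x)]

/-- ℓ¹ norm -/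
def l1 (w : K → ℝ) : ℝ := ∑ k, |w k|

lemma l1_nonneg (w : K → ℝ) : 0 ≤ l1 w := Finset.sum_nonneg fun _ _ => abs_nonneg _

lemma abs_le_l1 (w : K → ℝ) (k : K) : |w k| ≤ l1 w :=
  Finset.single_le_sum (f := fun k => |w k|) (fun _ _ => abs_nonneg _) (Finset.mem_univ k)

lemma l1_continuous : Continuous (l1 : (K → ℝ) → ℝ) := by unfold l1; fun_prop

lemma integrable_exp_l1 (C c : ℝ) : Integrable (fun w : K → ℝ => C * rexp (c * l1 w)) (GK K) := by
  refine Integrable.const_mul ?_ C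
  have : (fun w : K → ℝ => rexp (c * l1 w)) = fun w => ∏ k, rexp (c * |w k|) := by
    funext w; rw [← Real.exp_sum, l1, Finset.mul_sum]
  rw [this]
  exact Integrable.fintype_prod_dep (f := fun _ x => rexp (c * |x|)) (fun k => integrable_exp_abs c)

/-- functions of at most exponential growth -/
def EB (f : (K → ℝ) → ℝ) : Prop := ∃ C c : ℝ, ∀ w, |f w| ≤ C * rexp (c * l1 w)

lemma EB.integrable {f : (K → ℝ) → ℝ} (h : EB f) (hf : Continuous f) : Integrable f (GK K) := by
  obtain ⟨C, c, h⟩ := h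
  exact (integrable_exp_l1 C c).mono' hf.aestronglyMeasurable (ae_of_all _ h)

lemma EB.nonneg_form {f : (K → ℝ) → ℝ} (h : EB f) :
    ∃ C c : ℝ, 0 ≤ C ∧ 0 ≤ c ∧ ∀ w, |f w| ≤ C * rexp (c * l1 w) := by
  obtain ⟨C, c, h⟩ := h
  refine ⟨|C|, |c|, abs_nonneg _, abs_nonneg _, fun w => (h w).trans ?_⟩
  have : rexp (c * l1 w) ≤ rexp (|c| * l1 w) :=
    Real.exp_le_exp.2 (mul_le_mul_of_nonneg_right (le_abs_self c) (l1_nonneg w))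
  calc C * rexp (c * l1 w) ≤ |C| * rexp (c * l1 w) :=
        mul_le_mul_of_nonneg_right (le_abs_self C) (Real.exp_pos _).le
    _ ≤ _ := mul_le_mul_of_nonneg_left this (abs_nonneg _)

lemma EB.mul {f g : (K → ℝ) → ℝ} (hf : EB f) (hg : EB g) : EB (fun w => f w * g w) := by
  obtain ⟨C, c, h⟩ := hf
  obtain ⟨D, d, h'⟩ := hg
  refine ⟨C * D, c + d, fun w => ?_⟩
  rw [abs_mul, add_mul, Real.exp_add]
  calc |f w| * |g w| ≤ (C * rexp (c * l1 w)) * (D * rexp (d * l1 w)) :=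
        mul_le_mul (h w) (h' w) (abs_nonneg _) ((abs_nonneg _).trans (h w))
    _ = _ := by ring

lemma EB.add {f g : (K → ℝ) → ℝ} (hf : EB f) (hg : EB g) : EB (fun w => f w + g w) := by
  obtain ⟨C, c, hC, hc, h⟩ := hf.nonneg_form
  obtain ⟨D, d, hD, hd, h'⟩ := hg.nonneg_form
  refine ⟨C + D, c + d, fun w => (abs_add_le _ _).trans ?_⟩
  have hl := l1_nonneg w
  have e1 : rexp (c * l1 w) ≤ rexp ((c + d) * l1 w) := Real.exp_le_exp.2 (by nlinarith)
  have e2 : rexp (d * l1 w) ≤ rexp ((c + d) * l1 w) := Real.exp_le_exp.2 (by nlinarith)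
  nlinarith [h w, h' w]

lemma EB.of_bdd {f : (K → ℝ) → ℝ} (C : ℝ) (h : ∀ w, |f w| ≤ C) : EB f :=
  ⟨C, 0, fun w => by simpa using h w⟩

lemma EB.const (C : ℝ) : EB (fun _ : K → ℝ => C) := EB.of_bdd |C| fun _ => le_rfl

lemma EB.of_linear {f : (K → ℝ) → ℝ} (C : ℝ) (hC : 0 ≤ C) (h : ∀ w, |f w| ≤ C * (1 + l1 w)) : EB f :=
  ⟨C, 1, fun w => (h w).trans (mul_le_mul_of_nonneg_left
    (by rw [one_mul, add_comm]; exact Real.add_one_le_exp _) hC)⟩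

lemma EB.coord (k : K) : EB (fun w : K → ℝ => w k) :=
  EB.of_linear 1 zero_le_one fun w => by linarith [abs_le_l1 w k]

lemma EB.sum {ι : Type*} (s : Finset ι) {f : ι → (K → ℝ) → ℝ} (h : ∀ i, EB (f i)) :
    EB (fun w => ∑ i ∈ s, f i w) := by
  classical
  induction s using Finset.induction_on with
  | empty => simpa using EB.const (K := K) 0
  | insert a s ha ih => simp only [Finset.sum_insert ha]; exact (h a).add ih

lemma EB.neg {f : (K → ℝ) → ℝ} (hf : EB f) : EB (fun w => -f w) := by
  obtain ⟨C, c, h⟩ := hf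
  exact ⟨C, c, fun w => by rw [abs_neg]; exact h w⟩

lemma EB.sub {f g : (K → ℝ) → ℝ} (hf : EB f) (hg : EB g) : EB (fun w => f w - g w) := by
  simpa only [sub_eq_add_neg] using hf.add hg.neg

lemma rho_hasLineDerivAt [DecidableEq K] (w : K → ℝ) (k : K) :
    HasLineDerivAt ℝ (rho : (K → ℝ) → ℝ) (-(w k) * rho w) w (Pi.single k 1) := by
  have h : ∀ t : ℝ, rho (w + t • Pi.single k (1 : ℝ)) = rho w * rexp (-(t * w k) - t ^ 2 / 2) := by
    intro t
    have := rho_sub w (-(t • Pi.single k (1 : ℝ)))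
    rw [sub_neg_eq_add] at this
    rw [this]
    congr 2
    rw [Finset.sum_eq_single k]
    · simp
    · intro j _ hj; simp [Pi.single_eq_of_ne hj]
    · simp
  unfold HasLineDerivAt
  have h2 : (fun t : ℝ => rho (w + t • Pi.single k (1 : ℝ)))
      = fun t => rho w * rexp (-(t * w k) - t ^ 2 / 2) := funext h
  rw [h2]
  have h3 : HasDerivAt (fun t : ℝ => -(t * w k) - t ^ 2 / 2) (-(w k)) 0 := by
    have := (((hasDerivAt_id (0:ℝ)).mul_const (w k)).neg).sub (((hasDerivAt_pow 2 (0:ℝ))).div_const 2)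
    have e : -(1 * w k) - ((2:ℕ):ℝ) * (0:ℝ) ^ (2 - 1) / 2 = -(w k) := by norm_num
    rw [e] at this
    exact this
  have := (h3.exp).const_mul (rho w)
  have e2 : rho w * (rexp (-(0 * w k) - 0 ^ 2 / 2) * -(w k)) = -(w k) * rho w := by
    norm_num
    ring
  rw [e2] at this
  exact this

/-- Gaussian integration by parts. -/
lemma ibp_GK [DecidableEq K] (k : K) (f f' : (K → ℝ) → ℝ) (hc : Continuous f) (hc' : Continuous f')
    (hb : EB f) (hb' : EB f')
    (hd : ∀ w, HasDerivAt (fun t : ℝ => f (w + t • Pi.single k (1 : ℝ))) (f' w) 0) :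
    ∫ w, w k * f w ∂(GK K) = ∫ w, f' w ∂(GK K) := by
  have hI1 := (integrable_GK_iff _).1 (((EB.coord k).mul hb).integrable (by fun_prop))
  have hI2 := (integrable_GK_iff _).1 (hb'.integrable hc')
  have hI3 := (integrable_GK_iff _).1 (hb.integrable hc)
  rw [integral_GK, integral_GK]
  have := integral_bilinear_hasLineDerivAt_right_eq_neg_left_of_integrable
    (μ := (volume : Measure (K → ℝ))) (f := rho) (f' := fun w => -(w k) * rho w) (g := f) (g' := f')
    (v := Pi.single k 1) (B := ContinuousLinearMap.mul ℝ ℝ)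
    (by
      refine hI1.neg.congr (ae_of_all _ fun w => ?_)
      simp only [Pi.neg_apply, ContinuousLinearMap.mul_apply']; ring)
    (by simpa using hI2) (by simpa using hI3) (fun w _ => rho_hasLineDerivAt w k)
    (fun w _ => hd w)
  simp only [ContinuousLinearMap.mul_apply'] at this
  rw [this, ← integral_neg]
  refine integral_congr_ae (ae_of_all _ fun w => ?_)
  simp only []; ring

end gauss


/-! ### Gibbs brackets on a finite space -/

/-- probability vector -/
structure IsPr {X : Type*} [Fintype X] (p : X → ℝ) : Prop where
  nonneg : ∀ x, 0 ≤ p x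
  sum : ∑ x, p x = 1

section gibbsb
variable {X : Type*} [Fintype X]

/-- unnormalized bracket -/
def NB (p θ a : X → ℝ) : ℝ := ∑ x, p x * a x * rexp (θ x)

/-- partition function -/
def MZ (p θ : X → ℝ) : ℝ := ∑ x, p x * rexp (θ x)

/-- Gibbs bracket -/
def Br (p θ a : X → ℝ) : ℝ := NB p θ a / MZ p θ

/-- Gibbs covariance -/
def Cv (p θ a b : X → ℝ) : ℝ := Br p θ (fun x => a x * b x) - Br p θ a * Br p θ b

variable {p : X → ℝ}

lemma MZ_ge (hp : IsPr p) (θ : X → ℝ) (B : ℝ) (h : ∀ x, -B ≤ θ x) : rexp (-B) ≤ MZ p θ := by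
  unfold MZ
  calc rexp (-B) = ∑ x, p x * rexp (-B) := by rw [← Finset.sum_mul, hp.sum, one_mul]
    _ ≤ _ := Finset.sum_le_sum fun x _ =>
      mul_le_mul_of_nonneg_left (Real.exp_le_exp.2 (h x)) (hp.nonneg x)

lemma MZ_le (hp : IsPr p) (θ : X → ℝ) (B : ℝ) (h : ∀ x, θ x ≤ B) : MZ p θ ≤ rexp B := by
  unfold MZ
  calc _ ≤ ∑ x, p x * rexp B := Finset.sum_le_sum fun x _ =>
      mul_le_mul_of_nonneg_left (Real.exp_le_exp.2 (h x)) (hp.nonneg x)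
    _ = _ := by rw [← Finset.sum_mul, hp.sum, one_mul]

lemma MZ_pos (hp : IsPr p) (θ : X → ℝ) : 0 < MZ p θ :=
  (Real.exp_pos _).trans_le (MZ_ge hp θ (∑ x, |θ x|) fun x => by
    have := Finset.single_le_sum (f := fun x => |θ x|) (fun _ _ => abs_nonneg _) (Finset.mem_univ x)
    have h2 := neg_abs_le (θ x)
    linarith)

lemma MZ_ne (hp : IsPr p) (θ : X → ℝ) : MZ p θ ≠ 0 := (MZ_pos hp θ).ne'

lemma MZ_mul_Br (hp : IsPr p) (θ : X → ℝ) (a : X → ℝ) : MZ p θ * Br p θ a = NB p θ a := by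
  unfold Br; rw [mul_div_cancel₀ _ (MZ_ne hp θ)]

lemma Br_const (hp : IsPr p) (θ : X → ℝ) (c : ℝ) : Br p θ (fun _ => c) = c := by
  unfold Br
  rw [div_eq_iff (MZ_ne hp θ)]
  unfold NB MZ
  rw [Finset.mul_sum]
  exact Finset.sum_congr rfl fun _ _ => by ring

lemma Br_mono (hp : IsPr p) (θ : X → ℝ) {a b : X → ℝ} (h : ∀ x, a x ≤ b x) : Br p θ a ≤ Br p θ b := by
  unfold Br
  refine div_le_div_of_nonneg_right ?_ (MZ_pos hp θ).le
  exact Finset.sum_le_sum fun x _ => mul_le_mul_of_nonneg_right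
    (mul_le_mul_of_nonneg_left (h x) (hp.nonneg x)) (Real.exp_pos _).le

lemma Br_abs_le (hp : IsPr p) (θ : X → ℝ) {a : X → ℝ} {C : ℝ} (h : ∀ x, |a x| ≤ C) : |Br p θ a| ≤ C := by
  rw [abs_le]
  constructor
  · rw [← Br_const hp θ (-C)]; exact Br_mono hp θ fun x => (abs_le.1 (h x)).1
  · conv_rhs => rw [← Br_const hp θ C]
    exact Br_mono hp θ fun x => (abs_le.1 (h x)).2

lemma Br_add (θ : X → ℝ) (a b : X → ℝ) : Br p θ (fun x => a x + b x) = Br p θ a + Br p θ b := by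
  unfold Br NB
  rw [← add_div, ← Finset.sum_add_distrib]
  congr 1
  exact Finset.sum_congr rfl fun _ _ => by ring

lemma Br_smul (θ : X → ℝ) (c : ℝ) (a : X → ℝ) : Br p θ (fun x => c * a x) = c * Br p θ a := by
  unfold Br NB
  rw [← mul_div_assoc, Finset.mul_sum]
  congr 1
  exact Finset.sum_congr rfl fun _ _ => by ring

lemma Br_sub (θ : X → ℝ) (a b : X → ℝ) : Br p θ (fun x => a x - b x) = Br p θ a - Br p θ b := by
  have h := Br_add (p := p) θ a (fun x => (-1) * b x)
  rw [Br_smul] at h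
  have e : (fun x => a x - b x) = fun x => a x + (-1) * b x := by funext x; ring
  rw [e, h]; ring

lemma Br_sum (θ : X → ℝ) {ι : Type*} (s : Finset ι) (a : ι → X → ℝ) :
    Br p θ (fun x => ∑ i ∈ s, a i x) = ∑ i ∈ s, Br p θ (a i) := by
  classical
  induction s using Finset.induction_on with
  | empty => simp [Br, NB]
  | insert i s hi ih =>
    simp only [Finset.sum_insert hi]
    rw [Br_add θ (a i) (fun x => ∑ i ∈ s, a i x), ih]

/-- Gibbs variational inequality -/
lemma gibbs_ineq (hp : IsPr p) (θ : X → ℝ) (θ' : X → ℝ) :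
    Br p θ (fun x => θ' x - θ x) ≤ Real.log (MZ p θ') - Real.log (MZ p θ) := by
  set m := Br p θ (fun x => θ' x - θ x) with hm
  have h1 : MZ p θ' / MZ p θ = Br p θ (fun x => rexp (θ' x - θ x)) := by
    unfold Br NB
    congr 1
    unfold MZ
    refine Finset.sum_congr rfl fun x _ => ?_
    rw [mul_assoc, ← Real.exp_add]; congr 2; ring
  have h2 : rexp m ≤ Br p θ (fun x => rexp (θ' x - θ x)) := by
    have : Br p θ (fun x => rexp m * (1 - m) + rexp m * (θ' x - θ x)) = rexp m := by
      rw [Br_add θ (fun _ => rexp m * (1 - m)) (fun x => rexp m * (θ' x - θ x)),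
        Br_smul θ (rexp m) (fun x => θ' x - θ x), Br_const hp, ← hm]; ring
    rw [← this]
    refine Br_mono hp θ fun x => ?_
    have h3 := Real.add_one_le_exp (θ' x - θ x - m)
    have h4 : rexp (θ' x - θ x) = rexp m * rexp (θ' x - θ x - m) := by
      rw [← Real.exp_add]; congr 1; ring
    rw [h4, ← mul_add]
    exact mul_le_mul_of_nonneg_left (by linarith) (Real.exp_pos _).le
  rw [← Real.log_div (MZ_ne hp θ') (MZ_ne hp θ), h1]
  rw [Real.le_log_iff_exp_le (lt_of_lt_of_le (Real.exp_pos _) h2)]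
  exact h2

lemma log_MZ_abs_le (hp : IsPr p) (θ : X → ℝ) {B : ℝ} (h : ∀ x, |θ x| ≤ B) : |Real.log (MZ p θ)| ≤ B := by
  have h1 := MZ_ge hp θ B fun x => (abs_le.1 (h x)).1
  have h2 := MZ_le hp θ B fun x => (abs_le.1 (h x)).2
  rw [abs_le]
  exact ⟨(Real.le_log_iff_exp_le (MZ_pos hp θ)).2 h1, (Real.log_le_iff_le_exp (MZ_pos hp θ)).2 h2⟩

/-- log partition function is 1-Lipschitz for the sup norm -/
lemma log_MZ_lip (hp : IsPr p) (θ : X → ℝ) (θ' : X → ℝ) {B : ℝ} (h : ∀ x, |θ' x - θ x| ≤ B) :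
    |Real.log (MZ p θ') - Real.log (MZ p θ)| ≤ B := by
  have h1 := gibbs_ineq hp θ θ'
  have h2 := gibbs_ineq hp θ' θ
  have h3 := Br_abs_le hp θ h
  have h4 := Br_abs_le hp θ' (a := fun x => θ x - θ' x) (C := B) fun x => by
    rw [abs_sub_comm]; exact h x
  rw [abs_le] at *
  constructor <;> linarith [h3.1, h3.2, h4.1, h4.2]

/-! derivatives -/
lemma hasDerivAt_MZ' {Θ : ℝ → X → ℝ} {θ' : X → ℝ} {s : ℝ}
    (h : ∀ x, HasDerivAt (fun t => Θ t x) (θ' x) s) :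
    HasDerivAt (fun t => MZ p (Θ t)) (NB p (Θ s) θ') s := by
  unfold MZ NB
  refine HasDerivAt.fun_sum fun x _ => ?_
  have := ((h x).exp).const_mul (p x)
  refine this.congr_deriv ?_
  ring

lemma hasDerivAt_NB {Θ : ℝ → X → ℝ} {θ' : X → ℝ} {s : ℝ}
    (h : ∀ x, HasDerivAt (fun t => Θ t x) (θ' x) s) (a : X → ℝ) :
    HasDerivAt (fun t => NB p (Θ t) a) (NB p (Θ s) (fun x => a x * θ' x)) s := by
  unfold NB
  refine HasDerivAt.fun_sum fun x _ => ?_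
  have := ((h x).exp).const_mul (p x * a x)
  refine this.congr_deriv ?_
  ring

lemma hasDerivAt_MZ (hp : IsPr p) {Θ : ℝ → X → ℝ} {θ' : X → ℝ} {s : ℝ}
    (h : ∀ x, HasDerivAt (fun t => Θ t x) (θ' x) s) :
    HasDerivAt (fun t => MZ p (Θ t)) (MZ p (Θ s) * Br p (Θ s) θ') s := by
  rw [MZ_mul_Br hp]; exact hasDerivAt_MZ' h

lemma hasDerivAt_Br (hp : IsPr p) {Θ : ℝ → X → ℝ} {θ' : X → ℝ} {s : ℝ}
    (h : ∀ x, HasDerivAt (fun t => Θ t x) (θ' x) s) (a : X → ℝ) :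
    HasDerivAt (fun t => Br p (Θ t) a) (Cv p (Θ s) a θ') s := by
  have := (hasDerivAt_NB (p := p) h a).div (hasDerivAt_MZ' (p := p) h) (MZ_ne hp (Θ s))
  refine this.congr_deriv ?_
  unfold Cv Br
  have := MZ_ne hp (Θ s)
  field_simp

lemma hasDerivAt_logMZ (hp : IsPr p) {Θ : ℝ → X → ℝ} {θ' : X → ℝ} {s : ℝ}
    (h : ∀ x, HasDerivAt (fun t => Θ t x) (θ' x) s) :
    HasDerivAt (fun t => Real.log (MZ p (Θ t))) (Br p (Θ s) θ') s :=
  (hasDerivAt_MZ' (p := p) h).log (MZ_ne hp (Θ s))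

lemma Cv_abs_le (hp : IsPr p) (θ : X → ℝ) {a b : X → ℝ} {A B : ℝ} (ha : ∀ x, |a x| ≤ A) (hb : ∀ x, |b x| ≤ B) :
    |Cv p θ a b| ≤ 2 * (A * B) := by
  have h1 := Br_abs_le hp θ (a := fun x => a x * b x) (C := A * B) fun x => by
    rw [abs_mul]
    exact mul_le_mul (ha x) (hb x) (abs_nonneg _) ((abs_nonneg _).trans (ha x))
  have h2 := Br_abs_le hp θ ha
  have h3 := Br_abs_le hp θ hb
  have h4 : |Br p θ a * Br p θ b| ≤ A * B := by
    rw [abs_mul]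
    exact mul_le_mul h2 h3 (abs_nonneg _) ((abs_nonneg _).trans h2)
  unfold Cv
  refine (abs_sub _ _).trans ?_
  linarith

lemma Cv_comm (θ : X → ℝ) (a b : X → ℝ) : Cv p θ a b = Cv p θ b a := by
  unfold Cv; rw [mul_comm (Br p θ a)]; congr 2; funext x; ring

lemma Cv_smul (θ : X → ℝ) (c : ℝ) (a b : X → ℝ) : Cv p θ a (fun x => c * b x) = c * Cv p θ a b := by
  unfold Cv
  have e : (fun x => a x * (c * b x)) = fun x => c * (a x * b x) := by funext x; ring
  rw [e, Br_smul, Br_smul]; ring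

lemma Cv_sum (θ : X → ℝ) {ι : Type*} (s : Finset ι) (a : X → ℝ) (b : ι → X → ℝ) :
    Cv p θ a (fun x => ∑ i ∈ s, b i x) = ∑ i ∈ s, Cv p θ a (b i) := by
  unfold Cv
  have e : (fun x => a x * ∑ i ∈ s, b i x) = fun x => ∑ i ∈ s, a x * b i x := by
    funext x; rw [Finset.mul_sum]
  rw [e, Br_sum θ s (fun i x => a x * b i x), Br_sum, Finset.mul_sum, Finset.sum_sub_distrib]

/-- covariance as a symmetrized sum over two replicas -/
lemma Cv_replica (hp : IsPr p) (θ : X → ℝ) (a b : X → ℝ) : Cv p θ a b =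
    2⁻¹ * ∑ x, ∑ y, (p x * rexp (θ x) / MZ p θ) * (p y * rexp (θ y) / MZ p θ) *
      ((a x - a y) * (b x - b y)) := by
  set π' : X → ℝ := fun x => p x * rexp (θ x) / MZ p θ with hπ
  have hsum : ∑ x, π' x = 1 := by
    simp only [hπ]
    rw [← Finset.sum_div]; exact div_self (MZ_ne hp θ)
  have hbr : ∀ c : X → ℝ, Br p θ c = ∑ x, π' x * c x := by
    intro c
    unfold Br NB
    rw [Finset.sum_div]
    refine Finset.sum_congr rfl fun x _ => ?_
    simp only [hπ]; ring
  have hprod : ∀ c d : X → ℝ, ∑ x, ∑ y, π' x * π' y * (c x * d y) = Br p θ c * Br p θ d := by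
    intro c d
    rw [hbr, hbr, Finset.sum_mul_sum]
    exact Finset.sum_congr rfl fun x _ => Finset.sum_congr rfl fun y _ => by ring
  have e : ∑ x, ∑ y, π' x * π' y * ((a x - a y) * (b x - b y))
      = ∑ x, ∑ y, π' x * π' y * ((a x * b x) * 1) + ∑ x, ∑ y, π' x * π' y * (1 * (a y * b y))
        - ∑ x, ∑ y, π' x * π' y * (a x * b y) - ∑ x, ∑ y, π' x * π' y * (b x * a y) := by
    simp only [← Finset.sum_add_distrib, ← Finset.sum_sub_distrib]
    exact Finset.sum_congr rfl fun x _ => Finset.sum_congr rfl fun y _ => by ring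
  have h1 := hprod (fun x => a x * b x) (fun _ => 1)
  have h2 := hprod (fun _ => 1) (fun x => a x * b x)
  rw [e, h1, h2, hprod, hprod, Br_const hp]
  unfold Cv; ring

lemma Cv_sq_psd (hp : IsPr p) (θ : X → ℝ) {K : Type*} [Fintype K] (φ : K → X → ℝ) (δ : K → ℝ) :
    0 ≤ ∑ k, ∑ l, δ k * δ l * Cv p θ (φ k) (φ l) ^ 2 := by
  set π' : X → ℝ := fun x => p x * rexp (θ x) / MZ p θ with hπ
  have hπ0 : ∀ x, 0 ≤ π' x := fun x =>
    div_nonneg (mul_nonneg (hp.nonneg x) (Real.exp_pos _).le) (MZ_pos hp θ).le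
  let W : (X × X) → ℝ := fun z => π' z.1 * π' z.2
  let D : K → (X × X) → ℝ := fun k z => φ k z.1 - φ k z.2
  have hC : ∀ k l, Cv p θ (φ k) (φ l) = 2⁻¹ * ∑ z, W z * (D k z * D l z) := by
    intro k l
    rw [Cv_replica hp, Fintype.sum_prod_type]
  have : ∑ k, ∑ l, δ k * δ l * Cv p θ (φ k) (φ l) ^ 2
      = 4⁻¹ * ∑ z, ∑ z', W z * W z' * (∑ k, δ k * D k z * D k z') ^ 2 := by
    calc _ = ∑ k, ∑ l, ∑ z, ∑ z', 4⁻¹ * (W z * W z' * ((δ k * D k z * D k z') * (δ l * D l z * D l z'))) := by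
          refine Finset.sum_congr rfl fun k _ => Finset.sum_congr rfl fun l _ => ?_
          rw [hC, mul_pow, sq (∑ z, W z * (D k z * D l z)), Finset.sum_mul_sum, Finset.mul_sum, Finset.mul_sum]
          refine Finset.sum_congr rfl fun z _ => ?_
          rw [Finset.mul_sum, Finset.mul_sum]
          refine Finset.sum_congr rfl fun z' _ => ?_
          ring
      _ = ∑ z, ∑ z', ∑ k, ∑ l, 4⁻¹ * (W z * W z' * ((δ k * D k z * D k z') * (δ l * D l z * D l z'))) := by
          rw [Finset.sum_congr rfl fun k _ => Finset.sum_comm, Finset.sum_comm]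
          refine Finset.sum_congr rfl fun z _ => ?_
          rw [Finset.sum_congr rfl fun k _ => Finset.sum_comm, Finset.sum_comm]
      _ = _ := by
          rw [Finset.mul_sum]
          refine Finset.sum_congr rfl fun z _ => ?_
          rw [Finset.mul_sum]
          refine Finset.sum_congr rfl fun z' _ => ?_
          rw [sq, Finset.sum_mul_sum]
          simp only [Finset.mul_sum]
  rw [this]
  refine mul_nonneg (by norm_num) (Finset.sum_nonneg fun z _ => Finset.sum_nonneg fun z' _ => ?_)
  exact mul_nonneg (mul_nonneg (mul_nonneg (hπ0 _) (hπ0 _)) (mul_nonneg (hπ0 _) (hπ0 _))) (sq_nonneg _)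

/-! regularity as functions of `θ` -/

lemma MZ_cont : Continuous (fun θ : X → ℝ => MZ p θ) := by unfold MZ; fun_prop
lemma NB_cont (a : X → ℝ) : Continuous (fun θ : X → ℝ => NB p θ a) := by unfold NB; fun_prop
lemma Br_cont (hp : IsPr p) (a : X → ℝ) : Continuous (fun θ : X → ℝ => Br p θ a) :=
  (NB_cont a).div MZ_cont fun θ => MZ_ne hp θ
lemma logMZ_cont (hp : IsPr p) : Continuous (fun θ : X → ℝ => Real.log (MZ p θ)) :=
  MZ_cont.log fun θ => MZ_ne hp θ
end gibbsb

/-- Growth-regularity of a function of `θ`. -/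
def Rg {X : Type*} [Fintype X] (f : (X → ℝ) → ℝ) : Prop :=
  Continuous f ∧ ∃ C c : ℝ, 0 ≤ C ∧ 0 ≤ c ∧ ∀ θ B, 0 ≤ B → (∀ x, |θ x| ≤ B) → |f θ| ≤ C * rexp (c * B)

section rg
variable {X : Type*} [Fintype X] {f g : (X → ℝ) → ℝ}
lemma Rg.mul (hf : Rg f) (hg : Rg g) : Rg (fun θ => f θ * g θ) := by
  obtain ⟨h1, C, c, hC, hc, h⟩ := hf
  obtain ⟨h2, D, d, hD, hd, h'⟩ := hg
  refine ⟨h1.mul h2, C * D, c + d, by positivity, by positivity, fun θ B hB hθ => ?_⟩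
  rw [abs_mul, add_mul, Real.exp_add]
  calc |f θ| * |g θ| ≤ (C * rexp (c * B)) * (D * rexp (d * B)) :=
        mul_le_mul (h θ B hB hθ) (h' θ B hB hθ) (abs_nonneg _) (by positivity)
    _ = _ := by ring
lemma Rg.add (hf : Rg f) (hg : Rg g) : Rg (fun θ => f θ + g θ) := by
  obtain ⟨h1, C, c, hC, hc, h⟩ := hf
  obtain ⟨h2, D, d, hD, hd, h'⟩ := hg
  refine ⟨h1.add h2, C + D, c + d, by positivity, by positivity, fun θ B hB hθ => ?_⟩
  have e1 : rexp (c * B) ≤ rexp ((c + d) * B) := Real.exp_le_exp.2 (by nlinarith)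
  have e2 : rexp (d * B) ≤ rexp ((c + d) * B) := Real.exp_le_exp.2 (by nlinarith)
  have := abs_add_le (f θ) (g θ)
  nlinarith [h θ B hB hθ, h' θ B hB hθ]
lemma Rg.const (C : ℝ) : Rg (fun _ : X → ℝ => C) :=
  ⟨continuous_const, |C|, 0, abs_nonneg _, le_rfl, fun θ B _ _ => by simp⟩
lemma Rg.neg (hf : Rg f) : Rg (fun θ => -f θ) := by
  simpa using (Rg.const (-1)).mul hf
lemma Rg.sub (hf : Rg f) (hg : Rg g) : Rg (fun θ => f θ - g θ) := by
  simpa only [sub_eq_add_neg] using hf.add hg.neg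
lemma Rg.pow2 (hf : Rg f) : Rg (fun θ => f θ ^ 2) := by
  simpa only [sq] using hf.mul hf
lemma Rg.sum {ι : Type*} (s : Finset ι) {f : ι → (X → ℝ) → ℝ} (h : ∀ i, Rg (f i)) :
    Rg (fun θ => ∑ i ∈ s, f i θ) := by
  classical
  induction s using Finset.induction_on with
  | empty => simpa using Rg.const (X := X) 0
  | insert a s ha ih => simp only [Finset.sum_insert ha]; exact (h a).add ih
variable {p : X → ℝ}
lemma Rg.MZ (hp : IsPr p) : Rg (fun θ => MZ p θ) :=
  ⟨MZ_cont, 1, 1, by norm_num, by norm_num, fun θ B _ h => by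
    rw [abs_of_pos (MZ_pos hp θ), one_mul, one_mul]
    exact MZ_le hp θ B fun x => (abs_le.1 (h x)).2⟩
lemma Rg.Br (hp : IsPr p) (a : X → ℝ) : Rg (fun θ => Br p θ a) :=
  ⟨Br_cont hp a, ∑ x, |a x|, 0, Finset.sum_nonneg fun _ _ => abs_nonneg _, le_rfl, fun θ B _ _ => by
    rw [zero_mul, Real.exp_zero, mul_one]
    exact Br_abs_le hp θ fun x =>
      Finset.single_le_sum (f := fun x => |a x|) (fun _ _ => abs_nonneg _) (Finset.mem_univ x)⟩
lemma Rg.logMZ (hp : IsPr p) : Rg (fun θ => Real.log (_root_.MZ p θ)) :=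
  ⟨logMZ_cont hp, 1, 1, by norm_num, by norm_num, fun θ B hB h => by
    refine (log_MZ_abs_le hp θ h).trans ?_
    rw [one_mul, one_mul]; linarith [Real.add_one_le_exp B]⟩
lemma Rg.Cv (hp : IsPr p) (a b : X → ℝ) : Rg (fun θ => Cv p θ a b) :=
  (Rg.Br hp _).sub ((Rg.Br hp a).mul (Rg.Br hp b))
end rg

set_option linter.unusedSectionVars false

/-! ### the generic Gaussian channel -/
section model
variable {X K : Type*} [Fintype X] [Fintype K]

/-- exponent of the posterior weight -/
def th (φ : X → K → ℝ) (γ w : K → ℝ) (x : X) : ℝ :=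
  ∑ k, (√(γ k) * φ x k * w k - γ k * φ x k ^ 2 / 2)

/-- expectation under the marginal law of the observation -/
def EM (p : X → ℝ) (φ : X → K → ℝ) (γ : K → ℝ) (f : (K → ℝ) → ℝ) : ℝ :=
  ∫ w, MZ p (th φ γ w) * f w ∂(GK K)

/-- free energy -/
def Free (p : X → ℝ) (φ : X → K → ℝ) (γ : K → ℝ) : ℝ :=
  EM p φ γ (fun w => Real.log (MZ p (th φ γ w)))

lemma th_continuous2 (φ : X → K → ℝ) (x : X) :
    Continuous (fun z : (K → ℝ) × (K → ℝ) => th φ z.1 z.2 x) := by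
  unfold th; fun_prop

lemma th_cont (φ : X → K → ℝ) (γ : K → ℝ) : Continuous (fun w => th φ γ w) := by
  unfold th; fun_prop

lemma th_cont' (φ : X → K → ℝ) (w : K → ℝ) : Continuous (fun γ => th φ γ w) := by
  unfold th; fun_prop

lemma exists_phi_bound (φ : X → K → ℝ) : ∃ C, 0 ≤ C ∧ ∀ x k, |φ x k| ≤ C := by
  refine ⟨∑ x, ∑ k, |φ x k|, by positivity, fun x k => ?_⟩
  have h1 := Finset.single_le_sum (f := fun k => |φ x k|) (fun _ _ => abs_nonneg _) (Finset.mem_univ k)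
  have h2 := Finset.single_le_sum (f := fun x => ∑ k, |φ x k|) (fun _ _ => by positivity) (Finset.mem_univ x)
  exact h1.trans h2

lemma th_bound {φ : X → K → ℝ} {C : ℝ} (hC : 0 ≤ C) (hφ : ∀ x k, |φ x k| ≤ C) {γ : K → ℝ} {G : ℝ}
    (hG0 : 0 ≤ G) (hG : ∀ k, |γ k| ≤ G) (w : K → ℝ) (x : X) :
    |th φ γ w x| ≤ (√G * C + Fintype.card K * (G * C ^ 2 / 2)) * (1 + l1 w) := by
  have h1 : |th φ γ w x| ≤ ∑ k, (√G * C * |w k| + G * C ^ 2 / 2) := by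
    refine (Finset.abs_sum_le_sum_abs _ _).trans (Finset.sum_le_sum fun k _ => ?_)
    refine (abs_sub _ _).trans (add_le_add ?_ ?_)
    · rw [abs_mul, abs_mul, abs_of_nonneg (Real.sqrt_nonneg _)]
      refine mul_le_mul_of_nonneg_right ?_ (abs_nonneg _)
      exact mul_le_mul (Real.sqrt_le_sqrt ((le_abs_self _).trans (hG k))) (hφ x k) (abs_nonneg _) (Real.sqrt_nonneg _)
    · rw [abs_div, abs_mul, abs_pow, abs_two]
      refine div_le_div_of_nonneg_right ?_ (by norm_num)
      exact mul_le_mul (hG k) (pow_le_pow_left₀ (abs_nonneg _) (hφ x k) 2) (by positivity) hG0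
  refine h1.trans ?_
  rw [Finset.sum_add_distrib, ← Finset.mul_sum, Finset.sum_const, Finset.card_univ, nsmul_eq_mul]
  have h2 : (0:ℝ) ≤ √G * C := by positivity
  have h3 : (0:ℝ) ≤ Fintype.card K * (G * C ^ 2 / 2) := by positivity
  have h4 := l1_nonneg w
  change √G * C * l1 w + _ ≤ _
  nlinarith

/-- a uniform exponential bound -/
lemma Rg.th_bound {f : (X → ℝ) → ℝ} (hf : Rg f) (φ : X → K → ℝ) {G : ℝ} (hG0 : 0 ≤ G) :
    ∃ D e : ℝ, 0 ≤ D ∧ ∀ γ : K → ℝ, (∀ k, |γ k| ≤ G) → ∀ w, |f (th φ γ w)| ≤ D * rexp (e * l1 w) := by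
  obtain ⟨_, C, c, hC, hc, h⟩ := hf
  obtain ⟨C', hC', hφ⟩ := exists_phi_bound φ
  set B := (√G * C' + Fintype.card K * (G * C' ^ 2 / 2)) with hB
  have hB0 : 0 ≤ B := by positivity
  refine ⟨C * rexp (c * B), c * B, by positivity, fun γ hγ w => ?_⟩
  refine (h _ (B * (1 + l1 w)) (mul_nonneg hB0 (by linarith [l1_nonneg w]))
    (fun x => _root_.th_bound hC' hφ hG0 hγ w x)).trans (le_of_eq ?_)
  rw [mul_assoc, ← Real.exp_add]; congr 2; ring

lemma exists_G (γ : K → ℝ) : ∃ G, 0 ≤ G ∧ ∀ k, |γ k| ≤ G :=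
  ⟨l1 γ, l1_nonneg γ, abs_le_l1 γ⟩

lemma Rg.EB {f : (X → ℝ) → ℝ} (hf : Rg f) (φ : X → K → ℝ) (γ : K → ℝ) : EB (fun w => f (th φ γ w)) := by
  obtain ⟨G, hG, h⟩ := exists_G γ
  obtain ⟨D, e, _, hD⟩ := hf.th_bound φ hG
  exact ⟨D, e, fun w => hD γ h w⟩

lemma Rg.cont {f : (X → ℝ) → ℝ} (hf : Rg f) (φ : X → K → ℝ) (γ : K → ℝ) :
    Continuous (fun w => f (th φ γ w)) := hf.1.comp (th_cont φ γ)

/-- integrals of regular functions depend continuously on the SNR vector -/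
lemma Rg.continuous_integral {f : (X → ℝ) → ℝ} (hf : Rg f) (φ : X → K → ℝ) :
    Continuous (fun γ : K → ℝ => ∫ w, f (th φ γ w) ∂(GK K)) := by
  rw [continuous_iff_continuousAt]
  intro γ₀
  obtain ⟨D, e, _, hD⟩ := hf.th_bound φ (G := l1 γ₀ + 1) (by linarith [l1_nonneg γ₀])
  have hev : ∀ᶠ γ in 𝓝 γ₀, ∀ k, |γ k| ≤ l1 γ₀ + 1 := by
    have : Tendsto l1 (𝓝 γ₀) (𝓝 (l1 γ₀)) := l1_continuous.tendsto γ₀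
    filter_upwards [this.eventually (gt_mem_nhds (show l1 γ₀ < l1 γ₀ + 1 by linarith))] with γ h k
    exact (abs_le_l1 γ k).trans h.le
  refine continuousAt_of_dominated (bound := fun w => D * rexp (e * l1 w)) ?_ ?_ (integrable_exp_l1 D e) ?_
  · exact Eventually.of_forall fun γ => (hf.cont φ γ).aestronglyMeasurable
  · filter_upwards [hev] with γ h
    exact ae_of_all _ fun w => hD γ h w
  · exact ae_of_all _ fun w => (hf.1.comp (th_cont' φ w)).continuousAt

/-- The heat-equation derivative lemma. -/
lemma heat {Φ : (X → ℝ) → ℝ} {D1 : (X → ℝ) → (X → ℝ) → ℝ} {D2 : (X → ℝ) → (X → ℝ) → ℝ}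
    (hΦ : Rg Φ) (h1 : ∀ b, Rg (fun θ => D1 θ b)) (h2 : ∀ b, Rg (fun θ => D2 θ b))
    (hlin : ∀ θ b b' c, D1 θ (fun x => b x + c * b' x) = D1 θ b + c * D1 θ b')
    (hd1 : ∀ (Θ : ℝ → X → ℝ) (θ' : X → ℝ) (s : ℝ), (∀ x, HasDerivAt (fun t => Θ t x) (θ' x) s) →
      HasDerivAt (fun t => Φ (Θ t)) (D1 (Θ s) θ') s)
    (hd2 : ∀ (Θ : ℝ → X → ℝ) (b : X → ℝ) (c s : ℝ),
      (∀ x, HasDerivAt (fun t => Θ t x) (c * b x) s) →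
      HasDerivAt (fun t => D1 (Θ t) b) (c * D2 (Θ s) b) s)
    (φ : X → K → ℝ) (c d : K → ℝ) (s₀ : ℝ) (h0 : ∀ k, 0 < c k + s₀ * d k ∨ (d k = 0 ∧ 0 ≤ c k)) :
    HasDerivAt (fun s => ∫ w, Φ (th φ (fun k => c k + s * d k) w) ∂(GK K))
      (∑ k, d k / 2 * ∫ w, (D2 (th φ (fun k => c k + s₀ * d k) w) (fun x => φ x k)
        - D1 (th φ (fun k => c k + s₀ * d k) w) (fun x => φ x k ^ 2)) ∂(GK K)) s₀ := by
  classical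
  have hzero : ∀ θ, D1 θ (fun _ => 0) = 0 := by
    intro θ
    have := hlin θ (fun _ => 0) (fun _ => 0) (-1)
    simp only [mul_zero, add_zero] at this
    linarith
  have hsum : ∀ θ (a : K → ℝ) (b : K → X → ℝ), D1 θ (fun x => ∑ k, a k * b k x) = ∑ k, a k * D1 θ (b k) := by
    intro θ a b
    have : ∀ s : Finset K, D1 θ (fun x => ∑ k ∈ s, a k * b k x) = ∑ k ∈ s, a k * D1 θ (b k) := by
      intro s
      induction s using Finset.induction_on with
      | empty => simpa using hzero θ
      | insert i s hi ih =>
        simp only [Finset.sum_insert hi]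
        have := hlin θ (fun x => ∑ k ∈ s, a k * b k x) (b i) (a i)
        rw [ih] at this
        rw [add_comm, ← this]
        congr 1; funext x; ring
    exact this Finset.univ
  have hadd : ∀ θ b b', D1 θ (fun x => b x + b' x) = D1 θ b + D1 θ b' := by
    intro θ b b'; simpa using hlin θ b b' 1
  let gs : ℝ → K → ℝ := fun s k => c k + s * d k
  let a1 : ℝ → K → ℝ := fun s k => d k / (2 * √(gs s k))
  -- eventual bounds
  have hev1 : ∀ᶠ s in 𝓝 s₀, ∀ k, 0 < gs s k ∨ (d k = 0 ∧ 0 ≤ c k) := by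
    rw [Filter.eventually_all]
    intro k
    rcases h0 k with h | h
    · have : Continuous (fun s => gs s k) := by simp only [gs]; fun_prop
      filter_upwards [this.continuousAt.eventually (lt_mem_nhds h)] with s hs using Or.inl hs
    · exact Eventually.of_forall fun s => Or.inr h
  have hev2 : ∀ᶠ s in 𝓝 s₀, ∀ k, |a1 s k| ≤ l1 (a1 s₀) + 1 := by
    rw [Filter.eventually_all]
    intro k
    rcases h0 k with h | h
    · have : ContinuousAt (fun s => |a1 s k|) s₀ := by
        simp only [a1, gs]
        have : 2 * √(c k + s₀ * d k) ≠ 0 := by positivity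
        fun_prop (disch := assumption)
      filter_upwards [this.eventually (gt_mem_nhds (show |a1 s₀ k| < l1 (a1 s₀) + 1 by
        linarith [abs_le_l1 (a1 s₀) k]))] with s hs using hs.le
    · refine Eventually.of_forall fun s => ?_
      simp only [a1, h.1, zero_div, abs_zero]
      linarith [l1_nonneg (fun k => d k / (2 * √(gs s₀ k)))]
  have hev3 : ∀ᶠ s in 𝓝 s₀, ∀ k, |gs s k| ≤ l1 (gs s₀) + 1 := by
    have : Continuous (fun s => l1 (gs s)) := by simp only [gs, l1]; fun_prop
    filter_upwards [this.continuousAt.eventually (gt_mem_nhds (show l1 (gs s₀) < l1 (gs s₀) + 1 by linarith))] with s h k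
    exact (abs_le_l1 (gs s) k).trans h.le
  let G := l1 (gs s₀) + 1
  have hG : 0 ≤ G := by simp only [G]; linarith [l1_nonneg (gs s₀)]
  let E := l1 (a1 s₀) + 1
  have hE : 0 ≤ E := by simp only [E]; linarith [l1_nonneg (a1 s₀)]
  -- derivative of th
  have hthd : ∀ s, (∀ k, 0 < gs s k ∨ (d k = 0 ∧ 0 ≤ c k)) → ∀ w x,
      HasDerivAt (fun t => th φ (gs t) w x)
        (∑ k, (a1 s k * w k) * φ x k + ∑ k, (-(d k / 2)) * φ x k ^ 2) s := by
    intro s hs w x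
    unfold th
    rw [← Finset.sum_add_distrib]
    refine HasDerivAt.fun_sum fun k _ => ?_
    have hg : HasDerivAt (fun t => gs t k) (d k) s := by
      simpa [gs] using ((hasDerivAt_id s).mul_const (d k)).const_add (c k)
    have hsq : HasDerivAt (fun t => √(gs t k)) (a1 s k) s := by
      rcases hs k with h | h
      · exact hg.sqrt h.ne'
      · have e1 : (fun t => √(gs t k)) = fun _ => √(c k) := by
          funext t; simp [gs, h.1]
        have e2 : a1 s k = 0 := by simp [a1, h.1]
        rw [e1, e2]; exact hasDerivAt_const _ _
    refine (((hsq.mul_const (φ x k)).mul_const (w k)).sub ((hg.mul_const (φ x k ^ 2)).div_const 2)).congr_deriv ?_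
    ring
  -- formula for derivative of integrand
  let F' : ℝ → (K → ℝ) → ℝ := fun s w => ∑ k, (a1 s k * w k) * D1 (th φ (gs s) w) (fun x => φ x k)
    + ∑ k, (-(d k / 2)) * D1 (th φ (gs s) w) (fun x => φ x k ^ 2)
  have hder : ∀ s, (∀ k, 0 < gs s k ∨ (d k = 0 ∧ 0 ≤ c k)) → ∀ w,
      HasDerivAt (fun t => Φ (th φ (gs t) w)) (F' s w) s := by
    intro s hs w
    refine (hd1 _ _ s (hthd s hs w)).congr_deriv ?_
    simp only [F']
    rw [hadd, hsum _ (fun k => a1 s k * w k) (fun k x => φ x k), hsum _ _ (fun k x => φ x k ^ 2)]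
  -- bounds
  choose DA eA hDA hbA using fun k => (h1 (fun x => φ x k)).th_bound φ hG
  choose DB eB hDB hbB using fun k => (h1 (fun x => φ x k ^ 2)).th_bound φ hG
  let bd : (K → ℝ) → ℝ := fun w => ∑ k, (E * |w k|) * (DA k * rexp (eA k * l1 w))
    + ∑ k, |d k / 2| * (DB k * rexp (eB k * l1 w))
  have hbdI : Integrable bd (GK K) := by
    refine EB.integrable ?_ ?_
    · refine EB.add (EB.sum _ fun k => EB.mul ?_ ?_) (EB.sum _ fun k => EB.mul (EB.const _) ?_)
      · refine EB.of_linear E hE fun w => ?_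
        rw [abs_mul, abs_of_nonneg hE, abs_abs]
        exact mul_le_mul_of_nonneg_left (by linarith [abs_le_l1 w k]) hE
      · exact ⟨DA k, eA k, fun w => by rw [abs_of_nonneg (mul_nonneg (hDA k) (Real.exp_pos _).le)]⟩
      · exact ⟨DB k, eB k, fun w => by rw [abs_of_nonneg (mul_nonneg (hDB k) (Real.exp_pos _).le)]⟩
    · have := l1_continuous (K := K)
      simp only [bd]; fun_prop
  have key := hasDerivAt_integral_of_dominated_loc_of_deriv_le (μ := GK K)
    (F := fun s w => Φ (th φ (gs s) w)) (F' := F') (bound := bd) (x₀ := s₀)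
    (s := {s | (∀ k, 0 < gs s k ∨ (d k = 0 ∧ 0 ≤ c k)) ∧ (∀ k, |a1 s k| ≤ E) ∧ (∀ k, |gs s k| ≤ G)})
    (hev1.and (hev2.and hev3)) (Eventually.of_forall fun s => (hΦ.cont φ _).aestronglyMeasurable)
    ((hΦ.EB φ _).integrable (hΦ.cont φ _))
    (by
      have hA := fun k => (h1 (fun x => φ x k)).cont φ (gs s₀)
      have hB := fun k => (h1 (fun x => φ x k ^ 2)).cont φ (gs s₀)
      have : Continuous (F' s₀) :=
        (continuous_finsetSum _ fun k _ => (continuous_const.mul (continuous_apply k)).mul (hA k)).add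
          (continuous_finsetSum _ fun k _ => continuous_const.mul (hB k))
      exact this.aestronglyMeasurable)
    (by
      refine ae_of_all _ fun w s hs => ?_
      rw [Real.norm_eq_abs]
      refine (abs_add_le _ _).trans (add_le_add ?_ ?_)
      · refine (Finset.abs_sum_le_sum_abs _ _).trans (Finset.sum_le_sum fun k _ => ?_)
        rw [abs_mul, abs_mul]
        exact mul_le_mul (mul_le_mul_of_nonneg_right (hs.2.1 k) (abs_nonneg _)) (hbA k _ hs.2.2 w) (abs_nonneg _)
          (mul_nonneg hE (abs_nonneg _))
      · refine (Finset.abs_sum_le_sum_abs _ _).trans (Finset.sum_le_sum fun k _ => ?_)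
        rw [abs_mul, abs_neg]
        exact mul_le_mul_of_nonneg_left (hbB k _ hs.2.2 w) (abs_nonneg _))
    hbdI (ae_of_all _ fun w s hs => hder s hs.1 w)
  refine key.2.congr_deriv ?_
  -- integration by parts
  have hcA := fun k => (h1 (fun x => φ x k)).cont φ (gs s₀)
  have hcB := fun k => (h1 (fun x => φ x k ^ 2)).cont φ (gs s₀)
  have hcC := fun k => (h2 (fun x => φ x k)).cont φ (gs s₀)
  have hIA := fun k => ((EB.coord k).mul ((h1 (fun x => φ x k)).EB φ (gs s₀))).integrable
    ((continuous_apply k).mul (hcA k))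
  have hIB := fun k => ((h1 (fun x => φ x k ^ 2)).EB φ (gs s₀)).integrable (hcB k)
  have hIC := fun k => ((h2 (fun x => φ x k)).EB φ (gs s₀)).integrable (hcC k)
  have hibp : ∀ k, ∫ w, w k * D1 (th φ (gs s₀) w) (fun x => φ x k) ∂(GK K)
      = √(gs s₀ k) * ∫ w, D2 (th φ (gs s₀) w) (fun x => φ x k) ∂(GK K) := by
    intro k
    rw [← integral_const_mul]
    refine ibp_GK k _ (fun w => √(gs s₀ k) * D2 (th φ (gs s₀) w) (fun x => φ x k)) (hcA k)
      (continuous_const.mul (hcC k)) ((h1 _).EB φ _) ((EB.const _).mul ((h2 _).EB φ _)) fun w => ?_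
    have := hd2 (fun t => th φ (gs s₀) (w + t • Pi.single k (1:ℝ))) (fun x => φ x k) (√(gs s₀ k)) 0 ?_
    · simpa using this
    · intro x
      have e : (fun t : ℝ => th φ (gs s₀) (w + t • Pi.single k (1:ℝ)) x)
          = fun t => th φ (gs s₀) w x + t * (√(gs s₀ k) * φ x k) := by
        funext t
        unfold th
        rw [← sub_eq_iff_eq_add', ← Finset.sum_sub_distrib, Finset.sum_eq_single k]
        · simp; ring
        · intro j _ hj; simp [Pi.single_eq_of_ne hj]
        · simp
      rw [e]
      simpa using ((hasDerivAt_id (0:ℝ)).mul_const (√(gs s₀ k) * φ x k)).const_add (th φ (gs s₀) w x)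
  simp only [F']
  have hI1 : ∀ k, Integrable (fun w => (a1 s₀ k * w k) * D1 (th φ (gs s₀) w) (fun x => φ x k)) (GK K) := by
    intro k
    simp only [mul_assoc]
    exact (hIA k).const_mul _
  have hI2 : ∀ k, Integrable (fun w => (-(d k / 2)) * D1 (th φ (gs s₀) w) (fun x => φ x k ^ 2)) (GK K) :=
    fun k => (hIB k).const_mul _
  rw [integral_add (integrable_finsetSum _ fun k _ => hI1 k) (integrable_finsetSum _ fun k _ => hI2 k),
    integral_finsetSum _ (fun k _ => hI1 k), integral_finsetSum _ (fun k _ => hI2 k),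
    ← Finset.sum_add_distrib]
  refine Finset.sum_congr rfl fun k _ => ?_
  have e1 : ∫ w, (a1 s₀ k * w k) * D1 (th φ (gs s₀) w) (fun x => φ x k) ∂(GK K)
      = a1 s₀ k * (√(gs s₀ k) * ∫ w, D2 (th φ (gs s₀) w) (fun x => φ x k) ∂(GK K)) := by
    rw [← hibp k, ← integral_const_mul]
    exact integral_congr_ae (ae_of_all _ fun w => by simp only []; ring)
  rw [e1, integral_const_mul, integral_sub (hIC k) (hIB k)]
  have e2 : a1 s₀ k * √(gs s₀ k) = d k / 2 := by
    simp only [a1]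
    rcases h0 k with h | h
    · have : √(gs s₀ k) ≠ 0 := (Real.sqrt_pos.2 h).ne'
      field_simp
    · simp [h.1]
  rw [← mul_assoc, e2]; ring

end model

set_option linter.unusedSectionVars false

section model2
variable {X K : Type*} [Fintype X] [Fintype K]

/-- continuous of exponential growth -/
def Nc (f : (K → ℝ) → ℝ) : Prop := Continuous f ∧ EB f

lemma Nc.add {f g : (K → ℝ) → ℝ} (hf : Nc f) (hg : Nc g) : Nc (fun w => f w + g w) :=
  ⟨hf.1.add hg.1, hf.2.add hg.2⟩
lemma Nc.sub {f g : (K → ℝ) → ℝ} (hf : Nc f) (hg : Nc g) : Nc (fun w => f w - g w) :=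
  ⟨hf.1.sub hg.1, hf.2.sub hg.2⟩
lemma Nc.mul {f g : (K → ℝ) → ℝ} (hf : Nc f) (hg : Nc g) : Nc (fun w => f w * g w) :=
  ⟨hf.1.mul hg.1, hf.2.mul hg.2⟩
lemma Nc.const (c : ℝ) : Nc (fun _ : K → ℝ => c) := ⟨continuous_const, EB.const c⟩
lemma Nc.coord (k : K) : Nc (fun w : K → ℝ => w k) := ⟨continuous_apply k, EB.coord k⟩
lemma Nc.sum {ι : Type*} (s : Finset ι) {f : ι → (K → ℝ) → ℝ} (h : ∀ i, Nc (f i)) :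
    Nc (fun w => ∑ i ∈ s, f i w) :=
  ⟨continuous_finsetSum _ fun i _ => (h i).1, EB.sum s fun i => (h i).2⟩
lemma Nc.pow2 {f : (K → ℝ) → ℝ} (hf : Nc f) : Nc (fun w => f w ^ 2) := by
  simpa only [sq] using hf.mul hf
lemma Nc.abs {f : (K → ℝ) → ℝ} (hf : Nc f) : Nc (fun w => |f w|) :=
  ⟨hf.1.abs, by obtain ⟨C, c, h⟩ := hf.2; exact ⟨C, c, fun w => by rw [abs_abs]; exact h w⟩⟩
lemma Nc.int {f : (K → ℝ) → ℝ} (hf : Nc f) : Integrable f (GK K) := hf.2.integrable hf.1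
lemma Rg.nc {f : (X → ℝ) → ℝ} (hf : Rg f) (φ : X → K → ℝ) (γ : K → ℝ) : Nc (fun w => f (th φ γ w)) :=
  ⟨hf.cont φ γ, hf.EB φ γ⟩

/-- translation of the argument -/
lemma Nc.shift {f : (K → ℝ) → ℝ} (hf : Nc f) (m : K → ℝ) : Nc (fun w => f (w + m)) := by
  refine ⟨hf.1.comp (by fun_prop), ?_⟩
  obtain ⟨C, c, hC, hc, h⟩ := hf.2.nonneg_form
  refine ⟨C * rexp (c * l1 m), c, fun w => (h _).trans ?_⟩
  rw [mul_assoc, ← Real.exp_add]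
  refine mul_le_mul_of_nonneg_left (Real.exp_le_exp.2 ?_) hC
  rw [← mul_add]
  refine mul_le_mul_of_nonneg_left ?_ hc
  unfold l1
  rw [← Finset.sum_add_distrib]
  refine Finset.sum_le_sum fun k _ => ?_
  rw [add_comm]; exact abs_add_le _ _

variable {p : X → ℝ} {φ : X → K → ℝ} {γ : K → ℝ}

lemma EM_add (hp : IsPr p) {f g : (K → ℝ) → ℝ} (hf : Nc f) (hg : Nc g) :
    EM p φ γ (fun w => f w + g w) = EM p φ γ f + EM p φ γ g := by
  unfold EM
  rw [← integral_add (((Rg.MZ hp).nc φ γ).mul hf).int (((Rg.MZ hp).nc φ γ).mul hg).int]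
  simp only [mul_add]

lemma EM_sub (hp : IsPr p) {f g : (K → ℝ) → ℝ} (hf : Nc f) (hg : Nc g) :
    EM p φ γ (fun w => f w - g w) = EM p φ γ f - EM p φ γ g := by
  unfold EM
  rw [← integral_sub (((Rg.MZ hp).nc φ γ).mul hf).int (((Rg.MZ hp).nc φ γ).mul hg).int]
  simp only [mul_sub]

lemma EM_smul (c : ℝ) (f : (K → ℝ) → ℝ) :
    EM p φ γ (fun w => c * f w) = c * EM p φ γ f := by
  unfold EM
  rw [← integral_const_mul]
  exact integral_congr_ae (ae_of_all _ fun w => by simp only []; ring)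

lemma EM_sum (hp : IsPr p) {ι : Type*} (s : Finset ι) {f : ι → (K → ℝ) → ℝ} (h : ∀ i, Nc (f i)) :
    EM p φ γ (fun w => ∑ i ∈ s, f i w) = ∑ i ∈ s, EM p φ γ (f i) := by
  unfold EM
  rw [← integral_finsetSum _ fun i _ => (((Rg.MZ hp).nc φ γ).mul (h i)).int]
  simp only [Finset.mul_sum]

lemma EM_mono (hp : IsPr p) {f g : (K → ℝ) → ℝ} (hf : Nc f) (hg : Nc g) (h : ∀ w, f w ≤ g w) :
    EM p φ γ f ≤ EM p φ γ g :=
  integral_mono (((Rg.MZ hp).nc φ γ).mul hf).int (((Rg.MZ hp).nc φ γ).mul hg).int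
    fun w => mul_le_mul_of_nonneg_left (h w) (MZ_pos hp _).le

lemma EM_nonneg (hp : IsPr p) {f : (K → ℝ) → ℝ} (h : ∀ w, 0 ≤ f w) : 0 ≤ EM p φ γ f :=
  integral_nonneg fun w => mul_nonneg (MZ_pos hp _).le (h w)

/-- change of measure -/
lemma nishimori (hp : IsPr p) (hγ : ∀ k, 0 ≤ γ k) (a : X → ℝ) {f : (K → ℝ) → ℝ} (hf : Nc f) :
    ∑ x, p x * (a x * ∫ g, f (g + fun k => √(γ k) * φ x k) ∂(GK K))
      = EM p φ γ (fun w => Br p (th φ γ w) a * f w) := by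
  unfold EM
  have e1 : ∀ w, MZ p (th φ γ w) * (Br p (th φ γ w) a * f w)
      = ∑ x, p x * a x * (rexp (th φ γ w x) * f w) := by
    intro w
    rw [← mul_assoc, MZ_mul_Br hp, NB, Finset.sum_mul]
    exact Finset.sum_congr rfl fun x _ => by ring
  simp only [e1]
  have hexp : ∀ x, Rg (fun θ : X → ℝ => rexp (θ x)) := fun x =>
    ⟨by fun_prop, 1, 1, by norm_num, by norm_num, fun θ B _ h => by
      rw [Real.abs_exp, one_mul, one_mul]; exact Real.exp_le_exp.2 ((le_abs_self _).trans (h x))⟩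
  rw [integral_finsetSum _ fun x _ => ((((hexp x).nc φ γ).mul hf).int).const_mul _]
  refine Finset.sum_congr rfl fun x _ => ?_
  rw [integral_const_mul, shift_GK]
  have : ∀ w, ∑ k, (√(γ k) * φ x k * w k - (√(γ k) * φ x k) ^ 2 / 2) = th φ γ w x := by
    intro w
    unfold th
    refine Finset.sum_congr rfl fun k _ => ?_
    rw [mul_pow, Real.sq_sqrt (hγ k)]
  simp only [this]
  ring

lemma nishimori1 (hp : IsPr p) (hγ : ∀ k, 0 ≤ γ k) {f : (K → ℝ) → ℝ} (hf : Nc f) :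
    ∑ x, p x * ∫ g, f (g + fun k => √(γ k) * φ x k) ∂(GK K) = EM p φ γ f := by
  have := nishimori (φ := φ) hp hγ (fun _ => 1) hf
  simpa [Br_const hp] using this

lemma EM_const (hp : IsPr p) (hγ : ∀ k, 0 ≤ γ k) (c : ℝ) : EM p φ γ (fun _ => c) = c := by
  rw [← nishimori1 hp hγ (Nc.const c)]
  simp [← Finset.sum_mul, hp.sum]

lemma EM_abs_le (hp : IsPr p) (hγ : ∀ k, 0 ≤ γ k) {f : (K → ℝ) → ℝ} (hf : Nc f) {C : ℝ}
    (h : ∀ w, |f w| ≤ C) : |EM p φ γ f| ≤ C := by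
  rw [abs_le]
  constructor
  · rw [← EM_const (φ := φ) hp hγ (-C)]
    exact EM_mono hp (Nc.const _) hf fun w => (abs_le.1 (h w)).1
  · conv_rhs => rw [← EM_const (φ := φ) hp hγ C]
    exact EM_mono hp hf (Nc.const _) fun w => (abs_le.1 (h w)).2

lemma EM_abs (hp : IsPr p) {f : (K → ℝ) → ℝ} (hf : Nc f) :
    |EM p φ γ f| ≤ EM p φ γ (fun w => |f w|) := by
  rw [abs_le]
  constructor
  · have := EM_smul (p := p) (φ := φ) (γ := γ) (-1) (fun w => |f w|)
    rw [neg_eq_neg_one_mul, ← this]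
    exact EM_mono hp ((Nc.const _).mul hf.abs) hf fun w => by linarith [neg_abs_le (f w)]
  · exact EM_mono hp hf hf.abs fun w => le_abs_self _

/-! derivatives -/

lemma free_hasDerivAt (hp : IsPr p) (φ : X → K → ℝ) (c d : K → ℝ) (s₀ : ℝ)
    (h0 : ∀ k, 0 < c k + s₀ * d k ∨ (d k = 0 ∧ 0 ≤ c k)) :
    HasDerivAt (fun s => Free p φ (fun k => c k + s * d k))
      (∑ k, d k / 2 * EM p φ (fun k => c k + s₀ * d k)
        (fun w => Br p (th φ (fun k => c k + s₀ * d k) w) (fun x => φ x k) ^ 2)) s₀ := by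
  have := heat (Φ := fun θ => MZ p θ * Real.log (MZ p θ))
    (D1 := fun θ b => MZ p θ * (Br p θ b * (Real.log (MZ p θ) + 1)))
    (D2 := fun θ b => MZ p θ * (Br p θ b * (Br p θ b * (Real.log (MZ p θ) + 1))
      + (Cv p θ b b * (Real.log (MZ p θ) + 1) + Br p θ b * Br p θ b)))
    ((Rg.MZ hp).mul (Rg.logMZ hp))
    (fun b => (Rg.MZ hp).mul ((Rg.Br hp b).mul ((Rg.logMZ hp).add (Rg.const 1))))
    (fun b => (Rg.MZ hp).mul (((Rg.Br hp b).mul ((Rg.Br hp b).mul ((Rg.logMZ hp).add (Rg.const 1)))).add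
      (((Rg.Cv hp b b).mul ((Rg.logMZ hp).add (Rg.const 1))).add ((Rg.Br hp b).mul (Rg.Br hp b)))))
    (by
      intro θ b b' c
      rw [Br_add θ b (fun x => c * b' x), Br_smul]; ring)
    (by
      intro Θ θ' s h
      refine ((hasDerivAt_MZ hp h).mul (hasDerivAt_logMZ hp h)).congr_deriv ?_
      ring)
    (by
      intro Θ b c s h
      refine ((hasDerivAt_MZ hp h).mul ((hasDerivAt_Br hp h b).mul
        ((hasDerivAt_logMZ hp h).add_const 1))).congr_deriv ?_
      simp only [Cv_smul, Br_smul, Pi.mul_apply, Pi.pow_apply, Pi.sub_apply]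
      ring)
    φ c d s₀ h0
  refine this.congr_deriv (Finset.sum_congr rfl fun k _ => ?_)
  congr 1
  unfold EM
  refine integral_congr_ae (ae_of_all _ fun w => ?_)
  simp only [Cv, ← sq]
  ring

lemma ov_hasDerivAt (hp : IsPr p) (φ : X → K → ℝ) (a : X → ℝ) (c d : K → ℝ) (s₀ : ℝ)
    (h0 : ∀ k, 0 < c k + s₀ * d k ∨ (d k = 0 ∧ 0 ≤ c k)) :
    HasDerivAt (fun s => EM p φ (fun k => c k + s * d k)
        (fun w => Br p (th φ (fun k => c k + s * d k) w) a ^ 2))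
      (∑ k, d k * EM p φ (fun k => c k + s₀ * d k)
        (fun w => Cv p (th φ (fun k => c k + s₀ * d k) w) a (fun x => φ x k) ^ 2)) s₀ := by
  have hA := Rg.Br hp a
  have hAA := hA.mul hA
  have := heat (Φ := fun θ => MZ p θ * Br p θ a ^ 2)
    (D1 := fun θ b => MZ p θ * (2 * Br p θ a * Br p θ (fun x => a x * b x) - Br p θ a ^ 2 * Br p θ b))
    (D2 := fun θ b => MZ p θ * (Br p θ b *
        (2 * Br p θ a * Br p θ (fun x => a x * b x) - Br p θ a ^ 2 * Br p θ b)
      + ((2 * Cv p θ a b * Br p θ (fun x => a x * b x) + 2 * Br p θ a * Cv p θ (fun x => a x * b x) b)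
        - (2 * Br p θ a * Cv p θ a b * Br p θ b + Br p θ a ^ 2 * Cv p θ b b))))
    ((Rg.MZ hp).mul (Rg.Br hp a).pow2)
    (fun b => (Rg.MZ hp).mul ((((Rg.const 2).mul hA).mul (Rg.Br hp _)).sub (hA.pow2.mul (Rg.Br hp b))))
    (fun b => (Rg.MZ hp).mul (((Rg.Br hp b).mul
      ((((Rg.const 2).mul hA).mul (Rg.Br hp _)).sub (hA.pow2.mul (Rg.Br hp b)))).add
      (((((Rg.const 2).mul (Rg.Cv hp _ _)).mul (Rg.Br hp _)).add
        (((Rg.const 2).mul (Rg.Br hp _)).mul (Rg.Cv hp _ _))).sub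
        (((((Rg.const 2).mul (Rg.Br hp _)).mul (Rg.Cv hp _ _)).mul (Rg.Br hp _)).add
          (hA.pow2.mul (Rg.Cv hp _ _))))))
    (by
      intro θ b b' c
      have e : (fun x => a x * (b x + c * b' x)) = fun x => a x * b x + c * (a x * b' x) := by
        funext x; ring
      rw [e, Br_add θ (fun x => a x * b x) (fun x => c * (a x * b' x)),
        Br_smul θ c (fun x => a x * b' x), Br_add θ b (fun x => c * b' x), Br_smul]
      ring)
    (by
      intro Θ θ' s h
      refine ((hasDerivAt_MZ hp h).mul ((hasDerivAt_Br hp h a).pow 2)).congr_deriv ?_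
      simp only [Cv, Pi.pow_apply]
      push_cast
      ring)
    (by
      intro Θ b c s h
      have hBa := hasDerivAt_Br hp h a
      refine ((hasDerivAt_MZ hp h).mul (((hBa.const_mul 2).mul (hasDerivAt_Br hp h (fun x => a x * b x))).sub
        ((hBa.pow 2).mul (hasDerivAt_Br hp h b)))).congr_deriv ?_
      simp only [Cv_smul, Br_smul, Pi.mul_apply, Pi.pow_apply, Pi.sub_apply]
      push_cast
      ring)
    φ c d s₀ h0
  refine this.congr_deriv (Finset.sum_congr rfl fun k _ => ?_)
  rw [div_mul_eq_mul_div, mul_div_assoc]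
  congr 1
  unfold EM
  rw [← integral_div]
  refine integral_congr_ae (ae_of_all _ fun w => ?_)
  have e1 : (fun x => a x * φ x k ^ 2) = fun x => a x * φ x k * φ x k := by funext x; ring
  have e2 : (fun x => φ x k ^ 2) = fun x => φ x k * φ x k := by funext x; ring
  simp only [Cv, e1, e2]
  ring

lemma free_continuous (hp : IsPr p) (φ : X → K → ℝ) : Continuous (fun γ => Free p φ γ) :=
  ((Rg.MZ hp).mul (Rg.logMZ hp)).continuous_integral φ

lemma EM_continuous (hp : IsPr p) (φ : X → K → ℝ) {f : (X → ℝ) → ℝ} (hf : Rg f) :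
    Continuous (fun γ => EM p φ γ (fun w => f (th φ γ w))) :=
  ((Rg.MZ hp).mul hf).continuous_integral φ

lemma free_nonneg (hp : IsPr p) (φ : X → K → ℝ) (hγ : ∀ k, 0 ≤ γ k) : 0 ≤ Free p φ γ := by
  have h1 : EM p φ γ (fun _ => 1) = 1 := EM_const hp hγ 1
  unfold EM at h1
  have hM := (Rg.MZ hp).nc φ γ
  have h2 : ∫ w, (MZ p (th φ γ w) * 1 - 1) ∂(GK K) = 0 := by
    rw [integral_sub (hM.mul (Nc.const 1)).int (Nc.const 1).int, h1]; simp
  rw [← h2]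
  refine integral_mono ((hM.mul (Nc.const 1)).sub (Nc.const 1)).int
    (((Rg.MZ hp).mul (Rg.logMZ hp)).nc φ γ).int fun w => ?_
  have hpos := MZ_pos hp (th φ γ w)
  have := Real.one_sub_inv_le_log_of_pos hpos
  have h3 := mul_le_mul_of_nonneg_left this hpos.le
  rw [mul_sub, mul_inv_cancel₀ hpos.ne'] at h3
  exact h3

lemma free_zero (hp : IsPr p) (φ : X → K → ℝ) : Free p φ (fun _ => 0) = 0 := by
  unfold Free EM
  have : ∀ w : K → ℝ, MZ p (th φ (fun _ => 0) w) = 1 := by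
    intro w; simp [MZ, th, hp.sum]
  simp [this]

/-- convexity: supporting line inequality -/
lemma free_supp (hp : IsPr p) (φ : X → K → ℝ) (c d : K → ℝ) (hc : ∀ k, 0 < c k ∨ (d k = 0 ∧ 0 ≤ c k))
    (h1 : ∀ k, 0 ≤ c k + d k) :
    Free p φ c + ∑ k, d k / 2 * EM p φ c (fun w => Br p (th φ c w) (fun x => φ x k) ^ 2)
      ≤ Free p φ (fun k => c k + d k) := by
  have hpos : ∀ s, 0 ≤ s → s < 1 → ∀ k, 0 < c k + s * d k ∨ (d k = 0 ∧ 0 ≤ c k) := by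
    intro s hs hs1 k
    rcases hc k with h | h
    · left
      have := h1 k
      nlinarith
    · exact Or.inr h
  let f : ℝ → ℝ := fun s => Free p φ (fun k => c k + s * d k)
  let D : ℝ → ℝ := fun s => ∑ k, d k / 2 * EM p φ (fun k => c k + s * d k)
        (fun w => Br p (th φ (fun k => c k + s * d k) w) (fun x => φ x k) ^ 2)
  have hf : ∀ s, 0 ≤ s → s < 1 → HasDerivAt f (D s) s := fun s hs hs1 =>
    free_hasDerivAt hp φ c d s (hpos s hs hs1)
  have hfc : Continuous f := (free_continuous hp φ).comp (by fun_prop)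
  have hD : ∀ s, 0 ≤ s → s < 1 → HasDerivAt D (∑ k, d k / 2 * ∑ l, d l * EM p φ (fun k => c k + s * d k)
        (fun w => Cv p (th φ (fun k => c k + s * d k) w) (fun x => φ x k) (fun x => φ x l) ^ 2)) s := by
    intro s hs hs1
    refine HasDerivAt.fun_sum fun k _ => ?_
    exact (ov_hasDerivAt hp φ (fun x => φ x k) c d s (hpos s hs hs1)).const_mul _
  have hD0 : ∀ s, 0 ≤ ∑ k, d k / 2 * ∑ l, d l * EM p φ (fun k => c k + s * d k)
        (fun w => Cv p (th φ (fun k => c k + s * d k) w) (fun x => φ x k) (fun x => φ x l) ^ 2) := by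
    intro s
    have e : ∑ k, d k / 2 * ∑ l, d l * EM p φ (fun k => c k + s * d k)
        (fun w => Cv p (th φ (fun k => c k + s * d k) w) (fun x => φ x k) (fun x => φ x l) ^ 2)
        = EM p φ (fun k => c k + s * d k) (fun w => 2⁻¹ * ∑ k, ∑ l, d k * d l *
        Cv p (th φ (fun k => c k + s * d k) w) (fun x => φ x k) (fun x => φ x l) ^ 2) := by
      have hn : ∀ k l, Nc (fun w => d k * d l *
        Cv p (th φ (fun k => c k + s * d k) w) (fun x => φ x k) (fun x => φ x l) ^ 2) := fun k l =>
        (Nc.const _).mul (((Rg.Cv hp _ _).pow2).nc φ _)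
      rw [EM_smul, EM_sum hp _ (fun k => Nc.sum _ (hn k)), Finset.mul_sum]
      refine Finset.sum_congr rfl fun k _ => ?_
      rw [EM_sum hp _ (hn k), Finset.mul_sum, Finset.mul_sum]
      refine Finset.sum_congr rfl fun l _ => ?_
      rw [EM_smul]; ring
    rw [e]
    refine EM_nonneg hp fun w => mul_nonneg (by norm_num) ?_
    exact Cv_sq_psd hp _ (fun k x => φ x k) d
  obtain ⟨ξ, hξ, hξ'⟩ := exists_hasDerivAt_eq_slope f D one_pos hfc.continuousOn
    (fun s hs => hf s hs.1.le hs.2)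
  have hmono : D 0 ≤ D ξ := by
    have : MonotoneOn D (Set.Icc 0 ξ) := by
      refine monotoneOn_of_deriv_nonneg (convex_Icc 0 ξ) ?_ ?_ ?_
      · exact fun s hs => (hD s hs.1 (hs.2.trans_lt hξ.2)).continuousAt.continuousWithinAt
      · intro s hs
        rw [interior_Icc] at hs
        exact (hD s hs.1.le (hs.2.trans hξ.2)).differentiableAt.differentiableWithinAt
      · intro s hs
        rw [interior_Icc] at hs
        rw [(hD s hs.1.le (hs.2.trans hξ.2)).deriv]
        exact hD0 s
    exact this ⟨le_rfl, hξ.1.le⟩ ⟨hξ.1.le, le_rfl⟩ hξ.1.le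
  rw [hξ'] at hmono
  simp only [f, D, zero_mul, add_zero, one_mul, sub_zero, div_one] at hmono
  linarith

/-- monotonicity and Lipschitz bound -/
lemma free_lip (hp : IsPr p) (φ : X → K → ℝ) (c d : K → ℝ) (hc : ∀ k, 0 ≤ c k) (hd : ∀ k, 0 ≤ d k)
    (B : K → ℝ) (hB : ∀ x k, |φ x k| ≤ B k) :
    Free p φ c ≤ Free p φ (fun k => c k + d k) ∧
    Free p φ (fun k => c k + d k) ≤ Free p φ c + ∑ k, d k / 2 * B k ^ 2 := by
  let f : ℝ → ℝ := fun s => Free p φ (fun k => c k + s * d k)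
  let D : ℝ → ℝ := fun s => ∑ k, d k / 2 * EM p φ (fun k => c k + s * d k)
        (fun w => Br p (th φ (fun k => c k + s * d k) w) (fun x => φ x k) ^ 2)
  have hf : ∀ s, 0 < s → HasDerivAt f (D s) s := fun s hs =>
    free_hasDerivAt hp φ c d s (fun k => by
      rcases (hd k).lt_or_eq with h | h
      · left; have := hc k; positivity
      · right; exact ⟨h.symm, hc k⟩)
  have hfc : Continuous f := (free_continuous hp φ).comp (by fun_prop)
  obtain ⟨ξ, hξ, hξ'⟩ := exists_hasDerivAt_eq_slope f D one_pos hfc.continuousOn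
    (fun s hs => hf s hs.1)
  have h1 : 0 ≤ D ξ := Finset.sum_nonneg fun k _ => mul_nonneg (by linarith [hd k])
    (EM_nonneg hp fun w => sq_nonneg _)
  have h2 : D ξ ≤ ∑ k, d k / 2 * B k ^ 2 := by
    refine Finset.sum_le_sum fun k _ => mul_le_mul_of_nonneg_left ?_ (by linarith [hd k])
    have := EM_abs_le (φ := φ) (γ := fun k => c k + ξ * d k) hp
      (fun k => add_nonneg (hc k) (mul_nonneg hξ.1.le (hd k))) (((Rg.Br hp (fun x => φ x k)).pow2).nc φ (fun k => c k + ξ * d k))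
      (C := B k ^ 2) (fun w => by
        rw [abs_pow]
        exact pow_le_pow_left₀ (abs_nonneg _) (Br_abs_le hp _ fun x => hB x k) 2)
    exact (le_abs_self _).trans this
  rw [hξ'] at h1 h2
  simp only [f, zero_mul, add_zero, one_mul, sub_zero, div_one] at h1 h2
  constructor <;> linarith

end model2

set_option linter.unusedSectionVars false

/-! ### finitely supported measures -/
section finsupp
variable {X α β : Type*} [Fintype X] [MeasurableSpace α] [MeasurableSingletonClass α] [MeasurableSpace β]

lemma fin_measure_eq (μ : Measure α) (e : X → α) (he : Function.Injective e)
    (h : ∀ᵐ a ∂μ, a ∈ Set.range e) : μ = ∑ x, μ {e x} • Measure.dirac (e x) := by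
  classical
  have h1 : ∀ᵐ a ∂μ, a ∈ Finset.univ.image e := by
    filter_upwards [h] with a ha
    simpa using ha
  have h2 := Measure.ae_mem_finset_iff.1 h1
  rw [Finset.sum_image (fun x _ y _ hxy => he hxy)] at h2
  exact h2

lemma fin_integral (μ : Measure α) [IsFiniteMeasure μ] (e : X → α) (he : Function.Injective e)
    (h : ∀ᵐ a ∂μ, a ∈ Set.range e) (f : α → ℝ) :
    ∫ a, f a ∂μ = ∑ x, μ.real {e x} * f (e x) := by
  conv_lhs => rw [fin_measure_eq μ e he h]
  rw [integral_finsetSum_measure]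
  · simp [integral_smul_measure, Measure.real]
  · intro x _
    exact (integrable_dirac (by simp)).smul_measure (measure_ne_top _ _)

lemma fin_integral_prod (μ : Measure α) [IsFiniteMeasure μ] (ν : Measure β) [SFinite ν]
    (e : X → α) (he : Function.Injective e)
    (h : ∀ᵐ a ∂μ, a ∈ Set.range e) (f : α × β → ℝ) (hf : ∀ x, Integrable (fun b => f (e x, b)) ν) :
    ∫ z, f z ∂(μ.prod ν) = ∑ x, μ.real {e x} * ∫ b, f (e x, b) ∂ν := by
  have hm : μ.prod ν = ∑ x, μ {e x} • ν.map (Prod.mk (e x)) := by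
    conv_lhs => rw [fin_measure_eq μ e he h]
    rw [← Measure.sum_fintype, Measure.prod_sum_left, Measure.sum_fintype]
    simp only [Measure.prod_smul_left, Measure.dirac_prod]
  rw [hm, integral_finsetSum_measure]
  · refine Finset.sum_congr rfl fun x _ => ?_
    rw [integral_smul_measure, (measurableEmbedding_prodMk_left (e x)).integral_map]
    rfl
  · intro x _
    refine Integrable.smul_measure ?_ (measure_ne_top _ _)
    rw [(measurableEmbedding_prodMk_left (e x)).integrable_map_iff]
    exact hf x

lemma fin_isPr (μ : Measure α) [IsProbabilityMeasure μ] (e : X → α) (he : Function.Injective e)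
    (h : ∀ᵐ a ∂μ, a ∈ Set.range e) : IsPr (fun x => μ.real {e x}) :=
  ⟨fun _ => measureReal_nonneg, by
    have := fin_integral μ e he h (fun _ => 1)
    simp at this
    exact this.symm⟩
end finsupp

/-- the prior weights -/
def pS (S : Finset ℝ) (P : Measure ℝ) (x : S) : ℝ := P.real {(x : ℝ)}

section scalar
variable (S : Finset ℝ) (P : Measure ℝ) [IsProbabilityMeasure P]

lemma ae_range_S (hS : P ((↑S : Set ℝ)ᶜ) = 0) : ∀ᵐ a ∂P, a ∈ Set.range (fun x : S => (x : ℝ)) := by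
  rw [ae_iff]
  refine measure_mono_null ?_ hS
  intro a ha
  simpa using ha

lemma pS_isPr (hS : P ((↑S : Set ℝ)ᶜ) = 0) : IsPr (pS S P) :=
  fin_isPr P (fun x : S => (x : ℝ)) Subtype.val_injective (ae_range_S S P hS)

/-- scalar feature -/
def phi1 (x : S) (_ : Unit) : ℝ := x

lemma th1_planted {γ : ℝ} (hγ : 0 ≤ γ) (g : Unit → ℝ) (x x₀ : S) :
    th (phi1 S) (fun _ => γ) (g + fun _ => √γ * phi1 S x₀ ()) x
      = √γ * x * g () + γ * x * x₀ - γ * (x : ℝ) ^ 2 / 2 := by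
  simp only [th, phi1, Finset.univ_unique, Finset.sum_singleton, Pi.add_apply]
  have := Real.mul_self_sqrt hγ
  linear_combination (x : ℝ) * x₀ * this

lemma integral_GK_unit (f : ℝ → ℝ) : ∫ g, f (g ()) ∂(GK Unit) = ∫ z, f z ∂stdG := by
  have := (measurePreserving_funUnique stdG Unit).integral_comp
    (MeasurableEquiv.funUnique Unit ℝ).measurableEmbedding f
  exact this

lemma integrable_GK_unit (f : ℝ → ℝ) : Integrable (fun g : Unit → ℝ => f (g ())) (GK Unit) ↔ Integrable f stdG := by
  have := (measurePreserving_funUnique stdG Unit).integrable_comp_emb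
    (MeasurableEquiv.funUnique Unit ℝ).measurableEmbedding (g := f)
  exact this

lemma weight_sum (hS : P ((↑S : Set ℝ)ᶜ) = 0) {γ : ℝ} (hγ : 0 ≤ γ) (x₀ : S) (g : Unit → ℝ) :
    ∫ x, scalarWeight γ x₀ (g ()) x ∂P
      = MZ (pS S P) (th (phi1 S) (fun _ => γ) (g + fun _ => √γ * phi1 S x₀ ())) := by
  rw [fin_integral P (fun x : S => (x : ℝ)) Subtype.val_injective (ae_range_S S P hS)]
  unfold MZ scalarWeight
  refine Finset.sum_congr rfl fun x _ => ?_
  rw [th1_planted S hγ]; rfl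

lemma weight_sum' (hS : P ((↑S : Set ℝ)ᶜ) = 0) {γ : ℝ} (hγ : 0 ≤ γ) (x₀ : S) (g : Unit → ℝ) :
    postMean P γ x₀ (g ())
      = Br (pS S P) (th (phi1 S) (fun _ => γ) (g + fun _ => √γ * phi1 S x₀ ())) (fun x => (x : ℝ)) := by
  unfold postMean Br
  rw [weight_sum S P hS hγ]
  congr 1
  rw [fin_integral P (fun x : S => (x : ℝ)) Subtype.val_injective (ae_range_S S P hS)]
  unfold NB scalarWeight
  refine Finset.sum_congr rfl fun x _ => ?_
  rw [th1_planted S hγ, ← mul_assoc]; rfl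

lemma psiF_eq (hS : P ((↑S : Set ℝ)ᶜ) = 0) {γ : ℝ} (hγ : 0 ≤ γ) :
    psiF P γ = Free (pS S P) (phi1 S) (fun _ => γ) := by
  have hp := pS_isPr S P hS
  have hn := (Rg.logMZ hp).nc (phi1 S) (fun _ : Unit => γ)
  unfold psiF Free
  rw [← nishimori1 hp (fun _ => hγ) hn, fin_integral_prod P stdG (fun x : S => (x : ℝ)) Subtype.val_injective (ae_range_S S P hS)]
  · refine Finset.sum_congr rfl fun x _ => ?_
    congr 1
    rw [← integral_GK_unit]
    refine integral_congr_ae (ae_of_all _ fun g => ?_)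
    simp only []
    rw [weight_sum S P hS hγ]
  · intro x
    rw [← integrable_GK_unit]
    refine ((hn.shift (fun _ => √γ * phi1 S x ())).int).congr (ae_of_all _ fun g => ?_)
    simp only []
    rw [weight_sum S P hS hγ]

lemma Fov_eq (hS : P ((↑S : Set ℝ)ᶜ) = 0) {γ : ℝ} (hγ : 0 ≤ γ) :
    Fov P γ = EM (pS S P) (phi1 S) (fun _ => γ)
      (fun w => Br (pS S P) (th (phi1 S) (fun _ => γ) w) (fun x => phi1 S x ()) ^ 2) := by
  have hp := pS_isPr S P hS
  have hn := (Rg.Br hp (fun x => phi1 S x ())).nc (phi1 S) (fun _ : Unit => γ)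
  unfold Fov
  simp only [sq]
  rw [← nishimori hp (fun _ => hγ) (fun x => phi1 S x ()) hn,
    fin_integral_prod P stdG (fun x : S => (x : ℝ)) Subtype.val_injective (ae_range_S S P hS)]
  · refine Finset.sum_congr rfl fun x _ => ?_
    congr 1
    rw [← integral_GK_unit, ← integral_const_mul]
    refine integral_congr_ae (ae_of_all _ fun g => ?_)
    simp only []
    rw [weight_sum' S P hS hγ]; rfl
  · intro x
    rw [← integrable_GK_unit]
    refine (((hn.shift (fun _ => √γ * phi1 S x ())).int).const_mul (x : ℝ)).congr (ae_of_all _ fun g => ?_)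
    simp only []
    rw [weight_sum' S P hS hγ]; rfl

/-- what we need to know about scalar channels -/
structure Scal (ψ F : ℝ → ℝ) (C : ℝ) : Prop where
  contF : ContinuousOn F (Set.Ici 0)
  contψ : ContinuousOn ψ (Set.Ici 0)
  F_nonneg : ∀ γ, 0 ≤ γ → 0 ≤ F γ
  F_le : ∀ γ, 0 ≤ γ → F γ ≤ C
  supp : ∀ γ γ', 0 ≤ γ → 0 ≤ γ' → ψ γ + F γ / 2 * (γ' - γ) ≤ ψ γ'
  ψ_nonneg : ∀ γ, 0 ≤ γ → 0 ≤ ψ γ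
  ψ_zero : ψ 0 = 0

lemma scal_of (hS : P ((↑S : Set ℝ)ᶜ) = 0) (K₀ : ℝ) (hK : ∀ x ∈ S, |x| ≤ K₀) :
    Scal (psiF P) (Fov P) (K₀ ^ 2) := by
  have hp := pS_isPr S P hS
  have hcF : ContinuousOn (Fov P) (Set.Ici 0) := by
    have : Continuous (fun γ : ℝ => EM (pS S P) (phi1 S) (fun _ => γ)
      (fun w => Br (pS S P) (th (phi1 S) (fun _ => γ) w) (fun x => phi1 S x ()) ^ 2)) :=
      (EM_continuous hp (phi1 S) (Rg.Br hp (fun x => phi1 S x ())).pow2).comp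
        (g := fun γ : Unit → ℝ => _) (f := fun γ : ℝ => fun _ : Unit => γ) (by fun_prop)
    exact this.continuousOn.congr fun γ hγ => Fov_eq S P hS hγ
  have hcψ : ContinuousOn (psiF P) (Set.Ici 0) := by
    have : Continuous (fun γ : ℝ => Free (pS S P) (phi1 S) (fun _ => γ)) :=
      (free_continuous hp (phi1 S)).comp (f := fun γ : ℝ => fun _ : Unit => γ) (by fun_prop)
    exact this.continuousOn.congr fun γ hγ => psiF_eq S P hS hγ
  have hsupp0 : ∀ γ γ', 0 < γ → 0 ≤ γ' → psiF P γ + Fov P γ / 2 * (γ' - γ) ≤ psiF P γ' := by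
    intro γ γ' hγ hγ'
    have := free_supp hp (phi1 S) (fun _ => γ) (fun _ => γ' - γ) (fun _ => Or.inl hγ) (fun _ => by linarith)
    simp only [Finset.univ_unique, Finset.sum_singleton, add_sub_cancel] at this
    rw [psiF_eq S P hS hγ.le, psiF_eq S P hS hγ', Fov_eq S P hS hγ.le]
    have e : (PUnit.unit : Unit) = () := rfl
    simp only [PUnit.default_eq_unit] at this
    linarith
  refine ⟨hcF, hcψ, ?_, ?_, ?_, ?_, ?_⟩
  · intro γ hγ
    rw [Fov_eq S P hS hγ]
    exact EM_nonneg hp fun w => sq_nonneg _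
  · intro γ hγ
    rw [Fov_eq S P hS hγ]
    refine (le_abs_self _).trans (EM_abs_le hp (fun _ => hγ) (((Rg.Br hp _).pow2).nc _ _) fun w => ?_)
    rw [abs_pow]
    exact pow_le_pow_left₀ (abs_nonneg _) (Br_abs_le hp _ fun x => hK x x.2) 2
  · intro γ γ' hγ hγ'
    rcases hγ.lt_or_eq with h | h
    · exact hsupp0 γ γ' h hγ'
    · subst h
      have hcont : ContinuousWithinAt (fun γ => psiF P γ + Fov P γ / 2 * (γ' - γ)) (Set.Ioi 0) 0 := by
        have h1 := (hcψ 0 (by simp)).mono (Set.Ioi_subset_Ici_self)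
        have h2 := (hcF 0 (by simp)).mono (Set.Ioi_subset_Ici_self)
        exact h1.add ((h2.div_const 2).mul (by fun_prop))
      refine le_of_tendsto hcont ?_
      filter_upwards [self_mem_nhdsWithin] with γ hγ0
      exact hsupp0 γ γ' hγ0 hγ'
  · intro γ hγ
    rw [psiF_eq S P hS hγ]; exact free_nonneg hp _ fun _ => hγ
  · rw [psiF_eq S P hS le_rfl]; exact free_zero hp _
end scalar

set_option linter.unusedSectionVars false

lemma Scal.mono {ψ F : ℝ → ℝ} {C : ℝ} (h : Scal ψ F C) {x y : ℝ} (hx : 0 ≤ x) (hxy : x ≤ y) :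
    F x ≤ F y := by
  have hy := hx.trans hxy
  have h1 := h.supp x y hx hy
  have h2 := h.supp y x hy hx
  rcases hxy.eq_or_lt with rfl | hlt
  · exact le_rfl
  · by_contra hc
    push Not at hc
    nlinarith

/-- monotone iteration -/
lemma iter_conv (T : ℝ → ℝ) (C : ℝ) (hm : ∀ x y, 0 ≤ x → x ≤ y → T x ≤ T y)
    (h0 : ∀ x, 0 ≤ x → 0 ≤ T x) (hC : ∀ x, 0 ≤ x → T x ≤ C) (hcont : ContinuousOn T (Set.Ici 0))
    (a : ℝ) (ha : 0 ≤ a) :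
    ∃ q, 0 ≤ q ∧ T q = q ∧ Tendsto (fun k => T^[k] a) atTop (𝓝 q) := by
  have hnn : ∀ k, 0 ≤ T^[k] a := by
    intro k
    induction k with
    | zero => simpa
    | succ k ih => rw [Function.iterate_succ_apply']; exact h0 _ ih
  have hlim : ∃ q, Tendsto (fun k => T^[k] a) atTop (𝓝 q) := by
    rcases le_total a (T a) with h | h
    · have hmono : Monotone (fun k => T^[k] a) := by
        apply monotone_nat_of_le_succ
        intro k
        induction k with
        | zero => simpa using h
        | succ k ih =>
          rw [Function.iterate_succ_apply', Function.iterate_succ_apply' T (k+1)]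
          exact hm _ _ (hnn k) ih
      refine ⟨_, tendsto_atTop_ciSup hmono ⟨max a C, ?_⟩⟩
      rintro _ ⟨k, rfl⟩
      cases k with
      | zero => simp
      | succ k => simp only [Function.iterate_succ_apply']; exact (hC _ (hnn k)).trans (le_max_right _ _)
    · have hmono : Antitone (fun k => T^[k] a) := by
        apply antitone_nat_of_succ_le
        intro k
        induction k with
        | zero => simpa using h
        | succ k ih =>
          rw [Function.iterate_succ_apply', Function.iterate_succ_apply' T k]
          have h3 := hnn (k+1)
          rw [Function.iterate_succ_apply'] at h3 ih
          exact hm _ _ h3 ih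
      refine ⟨_, tendsto_atTop_ciInf hmono ⟨0, ?_⟩⟩
      rintro _ ⟨k, rfl⟩
      exact hnn k
  obtain ⟨q, hq⟩ := hlim
  have hq0 : 0 ≤ q := ge_of_tendsto' hq hnn
  refine ⟨q, hq0, ?_, hq⟩
  have h1 : Tendsto (fun k => T (T^[k] a)) atTop (𝓝 (T q)) := by
    have := (hcont q hq0).tendsto
    exact this.comp (tendsto_nhdsWithin_iff.2 ⟨hq, Eventually.of_forall hnn⟩)
  have h2 : Tendsto (fun k => T^[k+1] a) atTop (𝓝 q) := hq.comp (tendsto_add_atTop_nat 1)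
  simp only [Function.iterate_succ_apply'] at h2
  exact tendsto_nhds_unique h1 h2

section
variable (PU PV : Measure ℝ) [IsProbabilityMeasure PU] [IsProbabilityMeasure PV]
  (C lam : ℝ)

lemma rsF_min_right (hV : Scal (psiF PV) (Fov PV) C) (hl : 0 < lam) (q b y : ℝ) (hb : 0 ≤ b) (hy : 0 ≤ y)
    (hq : q = Fov PV (lam * b)) : rsF PU PV lam q b ≤ rsF PU PV lam q y := by
  have := hV.supp (lam * b) (lam * y) (by positivity) (by positivity)
  unfold rsF
  rw [← hq] at this
  nlinarith

lemma rsF_min_left (hU : Scal (psiF PU) (Fov PU) C) (hl : 0 < lam) (q b y : ℝ) (hb : 0 ≤ b) (hy : 0 ≤ y)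
    (hq : q = Fov PU (lam * b)) : rsF PU PV lam b q ≤ rsF PU PV lam y q := by
  have := hU.supp (lam * b) (lam * y) (by positivity) (by positivity)
  unfold rsF
  rw [← hq] at this
  nlinarith

lemma exists_fix (hU : Scal (psiF PU) (Fov PU) C) (hV : Scal (psiF PV) (Fov PV) C) (hl : 0 < lam)
    (a : ℝ) (ha : 0 ≤ a) : ∃ q ∈ Gam PU PV lam,
      rsF PU PV lam a (Fov PU (lam * a)) ≤ rsF PU PV lam q.1 q.2 := by
  set T : ℝ → ℝ := fun x => Fov PV (lam * Fov PU (lam * x)) with hT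
  have hUc : ContinuousOn (fun x => Fov PU (lam * x)) (Set.Ici 0) :=
    hU.contF.comp (by fun_prop) fun x hx => mul_nonneg hl.le hx
  have hUm : Set.MapsTo (fun x => lam * Fov PU (lam * x)) (Set.Ici 0) (Set.Ici 0) := fun x hx =>
    mul_nonneg hl.le (hU.F_nonneg _ (mul_nonneg hl.le hx))
  obtain ⟨q, hq0, hq, hlim⟩ := iter_conv T C
    (fun x y hx hxy => hV.mono (hUm hx) (mul_le_mul_of_nonneg_left
      (hU.mono (mul_nonneg hl.le hx) (mul_le_mul_of_nonneg_left hxy hl.le)) hl.le))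
    (fun x hx => hV.F_nonneg _ (hUm hx)) (fun x hx => hV.F_le _ (hUm hx))
    (hV.contF.comp (continuousOn_const.mul hUc) hUm) a ha
  have hb : ∀ x, 0 ≤ x → 0 ≤ Fov PU (lam * x) := fun x hx => hU.F_nonneg _ (mul_nonneg hl.le hx)
  refine ⟨(q, Fov PU (lam * q)), ⟨hq0, hb q hq0, rfl, hq.symm⟩, ?_⟩
  have hnn : ∀ k, 0 ≤ T^[k] a := by
    intro k
    induction k with
    | zero => simpa
    | succ k ih => rw [Function.iterate_succ_apply']; exact hV.F_nonneg _ (hUm ih)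
  set g : ℝ → ℝ := fun x => rsF PU PV lam x (Fov PU (lam * x)) with hg
  have hstep : ∀ x, 0 ≤ x → g x ≤ g (T x) := by
    intro x hx
    have hTx : 0 ≤ T x := hV.F_nonneg _ (hUm hx)
    exact (rsF_min_left PU PV C lam hU hl _ x (T x) hx hTx rfl).trans
      (rsF_min_right PU PV C lam hV hl (T x) (Fov PU (lam * x)) _ (hb x hx) (hb _ hTx) rfl)
  have hk : ∀ k, g a ≤ g (T^[k] a) := by
    intro k
    induction k with
    | zero => simp
    | succ k ih => rw [Function.iterate_succ_apply']; exact ih.trans (hstep _ (hnn k))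
  have hgc : ContinuousOn g (Set.Ici 0) := by
    have h1 : ContinuousOn (fun x => psiF PU (lam * x)) (Set.Ici 0) :=
      hU.contψ.comp (by fun_prop) fun x hx => mul_nonneg hl.le hx
    have h2 : ContinuousOn (fun x => psiF PV (lam * Fov PU (lam * x))) (Set.Ici 0) :=
      hV.contψ.comp (continuousOn_const.mul hUc) hUm
    exact (h1.add h2).sub ((by fun_prop : ContinuousOn (fun x : ℝ => lam / 2 * x) (Set.Ici 0)).mul hUc)
  have : Tendsto (fun k => g (T^[k] a)) atTop (𝓝 (g q)) :=
    (hgc q hq0).tendsto.comp (tendsto_nhdsWithin_iff.2 ⟨hlim, Eventually.of_forall hnn⟩)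
  exact ge_of_tendsto' this hk

lemma Gam_bdd (hU : Scal (psiF PU) (Fov PU) C) (hV : Scal (psiF PV) (Fov PV) C) (hl : 0 < lam) :
    BddAbove ((fun q : ℝ × ℝ => rsF PU PV lam q.1 q.2) '' Gam PU PV lam) := by
  have hC : 0 ≤ C := (hU.F_nonneg 0 le_rfl).trans (hU.F_le 0 le_rfl)
  refine ⟨rsF PU PV lam 0 C + psiF PU (lam * C) , ?_⟩
  rintro _ ⟨q, ⟨h1, h2, h3, h4⟩, rfl⟩
  have hq2 : q.2 ≤ C := by rw [h3]; exact hU.F_le _ (by positivity)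
  have hq1 : q.1 ≤ C := by rw [h4]; exact hV.F_le _ (by positivity)
  have ha := rsF_min_right PU PV C lam hV hl q.1 q.2 C h2 hC h4
  have hb := hU.supp (lam * q.1) (lam * C) (by positivity) (by positivity)
  have hn := hU.F_nonneg (lam * q.1) (by positivity)
  have hpos : 0 ≤ Fov PU (lam * q.1) / 2 * (lam * C - lam * q.1) :=
    mul_nonneg (by positivity) (by nlinarith)
  have : 0 ≤ lam / 2 * q.1 * C := by positivity
  have h0 := hU.ψ_nonneg 0 le_rfl
  simp only
  refine ha.trans ?_
  unfold rsF
  simp only [mul_zero, zero_mul, sub_zero]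
  linarith

/-- The sup over fixed points dominates `x ↦ rsF x (F_U(λ x))`. -/
lemma rsF_le_L (hU : Scal (psiF PU) (Fov PU) C) (hV : Scal (psiF PV) (Fov PV) C) (hl : 0 < lam)
    (a : ℝ) (ha : 0 ≤ a) : rsF PU PV lam a (Fov PU (lam * a)) ≤
      sSup ((fun q : ℝ × ℝ => rsF PU PV lam q.1 q.2) '' Gam PU PV lam) := by
  obtain ⟨q, hq, h⟩ := exists_fix PU PV C lam hU hV hl a ha
  exact h.trans (le_csSup (Gam_bdd PU PV C lam hU hV hl) ⟨q, hq, rfl⟩)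

lemma opt_parts (hU : Scal (psiF PU) (Fov PU) C) (hV : Scal (psiF PV) (Fov PV) C) (hl : 0 < lam) :
    sSup ((fun q : ℝ × ℝ => rsF PU PV lam q.1 q.2) '' Gam PU PV lam)
        = ⨆ q₁ : {x : ℝ // 0 ≤ x}, ⨅ q₂ : {x : ℝ // 0 ≤ x}, rsF PU PV lam q₁.1 q₂.1
    ∧ ∀ q ∈ Gam PU PV lam,
        ((∀ q' ∈ Gam PU PV lam, rsF PU PV lam q'.1 q'.2 ≤ rsF PU PV lam q.1 q.2)
          ↔ (rsF PU PV lam q.1 q.2 = ⨅ q₂ : {x : ℝ // 0 ≤ x}, rsF PU PV lam q.1 q₂.1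
             ∧ (⨅ q₂ : {x : ℝ // 0 ≤ x}, rsF PU PV lam q.1 q₂.1)
               = ⨆ q₁ : {x : ℝ // 0 ≤ x}, ⨅ q₂ : {x : ℝ // 0 ≤ x},
                   rsF PU PV lam q₁.1 q₂.1)) := by
  have hbdd := Gam_bdd PU PV C lam hU hV hl
  set L := sSup ((fun q : ℝ × ℝ => rsF PU PV lam q.1 q.2) '' Gam PU PV lam) with hL
  have hLq : ∀ q ∈ Gam PU PV lam, rsF PU PV lam q.1 q.2 ≤ L := fun q hq => le_csSup hbdd ⟨q, hq, rfl⟩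
  have hL0 : 0 ≤ L := by
    refine le_trans ?_ (rsF_le_L PU PV C lam hU hV hl 0 le_rfl)
    unfold rsF
    have h1 := hU.ψ_nonneg 0 le_rfl
    have h2 := hV.ψ_nonneg (lam * Fov PU 0) (mul_nonneg hl.le (hU.F_nonneg 0 le_rfl))
    simp only [mul_zero, zero_mul, sub_zero]
    linarith
  have : Nonempty {x : ℝ // 0 ≤ x} := ⟨⟨0, le_rfl⟩⟩
  have hinf : ∀ q ∈ Gam PU PV lam,
      rsF PU PV lam q.1 q.2 = ⨅ q₂ : {x : ℝ // 0 ≤ x}, rsF PU PV lam q.1 q₂.1 := by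
    rintro q ⟨h1, h2, h3, h4⟩
    have hmin : ∀ y : {x : ℝ // 0 ≤ x}, rsF PU PV lam q.1 q.2 ≤ rsF PU PV lam q.1 y.1 := fun y =>
      rsF_min_right PU PV C lam hV hl q.1 q.2 y.1 h2 y.2 h4
    apply le_antisymm
    · exact le_ciInf hmin
    · exact ciInf_le ⟨rsF PU PV lam q.1 q.2, by rintro _ ⟨y, rfl⟩; exact hmin y⟩ (⟨q.2, h2⟩ : {x : ℝ // 0 ≤ x})
  have hle : ∀ q₁ : {x : ℝ // 0 ≤ x}, (⨅ q₂ : {x : ℝ // 0 ≤ x}, rsF PU PV lam q₁.1 q₂.1) ≤ L := by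
    intro q₁
    by_cases hb : BddBelow (Set.range fun q₂ : {x : ℝ // 0 ≤ x} => rsF PU PV lam q₁.1 q₂.1)
    · exact (ciInf_le hb ⟨Fov PU (lam * q₁.1), hU.F_nonneg _ (mul_nonneg hl.le q₁.2)⟩).trans
        (rsF_le_L PU PV C lam hU hV hl q₁.1 q₁.2)
    · rw [iInf, Real.sInf_of_not_bddBelow hb]
      exact hL0
  have heq : L = ⨆ q₁ : {x : ℝ // 0 ≤ x}, ⨅ q₂ : {x : ℝ // 0 ≤ x}, rsF PU PV lam q₁.1 q₂.1 := by
    apply le_antisymm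
    · obtain ⟨q, hq, _⟩ := exists_fix PU PV C lam hU hV hl 0 le_rfl
      refine csSup_le (Set.Nonempty.image _ ⟨q, hq⟩) ?_
      rintro _ ⟨q, hq, rfl⟩
      simp only
      rw [hinf q hq]
      exact le_ciSup (f := fun q₁ : {x : ℝ // 0 ≤ x} => ⨅ q₂ : {x : ℝ // 0 ≤ x}, rsF PU PV lam q₁.1 q₂.1)
        ⟨L, by rintro _ ⟨y, rfl⟩; exact hle y⟩ ⟨q.1, hq.1⟩
    · exact ciSup_le hle
  refine ⟨heq, fun q hq => ⟨fun h => ⟨hinf q hq, ?_⟩, ?_⟩⟩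
  · rw [← heq, ← hinf q hq]
    apply le_antisymm (hLq q hq)
    refine csSup_le (Set.Nonempty.image _ ⟨q, hq⟩) ?_
    rintro _ ⟨q', hq', rfl⟩
    exact h q' hq'
  · rintro ⟨h1, h2⟩ q' hq'
    rw [h1, h2, ← heq]
    exact hLq q' hq'

end

set_option linter.unusedSectionVars false

/-- Coordinatewise Lipschitz functions on a product space. -/
structure LipC {ι α : Type} [Fintype ι] [MeasurableSpace α] (e : α → ℝ) (c : ι → ℝ)
    (f : (ι → α) → ℝ) : Prop where
  meas : Measurable f
  lip : ∀ x y, |f x - f y| ≤ ∑ k, c k * |e (x k) - e (y k)|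

section
variable {ι α : Type} [Fintype ι] [MeasurableSpace α] {μ : Measure α} [IsProbabilityMeasure μ]
  {e : α → ℝ} {c : ι → ℝ} {f : (ι → α) → ℝ}

lemma LipC.memLp [Nonempty α] (h : LipC e c f) (he : MemLp e 2 μ) : MemLp f 2 (Measure.pi fun _ : ι => μ) := by
  classical
  obtain ⟨y0⟩ := ‹Nonempty α›
  have hk : ∀ k, MemLp (fun x : ι → α => |c k| * |e (x k) - e y0|) 2 (Measure.pi fun _ : ι => μ) := by
    intro k
    have h1 : MemLp (fun y => e y - e y0) 2 μ := he.sub (memLp_const _)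
    have := (h1.comp_measurePreserving (measurePreserving_eval (fun _ : ι => μ) k)).norm.const_mul (|c k|)
    simpa [Function.comp_def] using this
  have hs : MemLp (fun x : ι → α => |f (fun _ => y0)| + ∑ k, |c k| * |e (x k) - e y0|) 2
      (Measure.pi fun _ : ι => μ) := by
    have ha : MemLp (fun _ : ι → α => |f (fun _ => y0)|) 2 (Measure.pi fun _ : ι => μ) := memLp_const _
    have hb : MemLp (fun x : ι → α => ∑ k, |c k| * |e (x k) - e y0|) 2 (Measure.pi fun _ : ι => μ) :=
      memLp_finsetSum _ fun k _ => hk k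
    exact ha.add hb
  refine hs.mono h.meas.aestronglyMeasurable (ae_of_all _ fun x => ?_)
  have h1 := h.lip x (fun _ => y0)
  have h2 : ∑ k, c k * |e (x k) - e y0| ≤ ∑ k, |c k| * |e (x k) - e y0| :=
    Finset.sum_le_sum fun k _ => mul_le_mul_of_nonneg_right (le_abs_self _) (abs_nonneg _)
  have h3 : 0 ≤ ∑ k, |c k| * |e (x k) - e y0| := Finset.sum_nonneg fun k _ => by positivity
  rw [Real.norm_eq_abs, Real.norm_eq_abs, abs_of_nonneg (add_nonneg (abs_nonneg _) h3)]
  have h4 := abs_sub_abs_le_abs_sub (f x) (f fun _ => y0)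
  linarith

lemma var_split {Ω : Type} [MeasurableSpace Ω] (ν : Measure Ω) [IsProbabilityMeasure ν] (X : Ω → ℝ)
    (hX : MemLp X 2 ν) (m : ℝ) :
    ∫ w, (X w - m) ^ 2 ∂ν = ∫ w, (X w - ∫ z, X z ∂ν) ^ 2 ∂ν + ((∫ z, X z ∂ν) - m) ^ 2 := by
  set a := ∫ z, X z ∂ν with ha
  have hi : Integrable X ν := hX.integrable (by norm_num)
  have h2 : Integrable (fun w => (X w - a) ^ 2) ν := (hX.sub (memLp_const a)).integrable_sq
  have h1 : Integrable (fun w => 2 * (a - m) * (X w - a)) ν := (hi.sub (integrable_const a)).const_mul _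
  have : ∀ w, (X w - m) ^ 2 = (X w - a) ^ 2 + (2 * (a - m) * (X w - a) + (a - m) ^ 2) := fun w => by ring
  simp only [this]
  have h3 : Integrable (fun w => 2 * (a - m) * (X w - a) + (a - m) ^ 2) ν := h1.add (integrable_const _)
  rw [integral_add h2 h3, integral_add h1 (integrable_const _),
    integral_const_mul, integral_sub hi (integrable_const a)]
  simp [← ha]

lemma efron_fin (y0 : α) (he : MemLp e 2 μ) (n : ℕ) : ∀ (c : Fin n → ℝ) (f : (Fin n → α) → ℝ),
    LipC e c f → (∀ k, 0 ≤ c k) →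
    ∫ x, (f x - ∫ z, f z ∂(Measure.pi fun _ : Fin n => μ)) ^ 2 ∂(Measure.pi fun _ : Fin n => μ)
      ≤ (∫ y, (e y - e y0) ^ 2 ∂μ) * ∑ k, c k ^ 2 := by
  have : Nonempty α := ⟨y0⟩
  have heD : Integrable (fun y => (e y - e y0) ^ 2) μ := (he.sub (memLp_const (e y0))).integrable_sq
  induction n with
  | zero =>
    intro c f h hc
    have : ∀ x, f x = f (fun i => i.elim0) := fun x => congrArg f (Subsingleton.elim _ _)
    simp only [this]
    simp
  | succ n ih =>
    intro c f h hc
    set pn := Measure.pi fun _ : Fin n => μ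
    have hmp := (measurePreserving_piFinSuccAbove (fun _ : Fin (n+1) => μ) 0).symm
    have hmem := (h.memLp he).comp_measurePreserving hmp
    have hform : ∀ p : α × (Fin n → α), (MeasurableEquiv.piFinSuccAbove (fun _ : Fin (n+1) => α) 0).symm p
        = Fin.cons p.1 p.2 := fun p => by
      simp [MeasurableEquiv.piFinSuccAbove, Fin.insertNthEquiv]
    set F : α × (Fin n → α) → ℝ := fun p => f (Fin.cons p.1 p.2) with hF
    have hFeq : f ∘ (MeasurableEquiv.piFinSuccAbove (fun _ : Fin (n+1) => α) 0).symm = F := by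
      ext p; simp only [Function.comp, hform, hF]
    rw [hFeq] at hmem
    have hInt0 : ∀ G : (Fin (n+1) → α) → ℝ, ∫ x, G x ∂(Measure.pi fun _ : Fin (n+1) => μ)
        = ∫ p, G (Fin.cons p.1 p.2) ∂(μ.prod pn) := by
      intro G
      rw [← hmp.integral_comp' (g := G)]
      simp only [hform]
      rfl
    rw [hInt0, hInt0 f]
    have hsec : ∀ y, LipC e (fun k : Fin n => c k.succ) (fun z => F (y, z)) := by
      intro y
      refine ⟨?_, fun x z => ?_⟩
      · have : Measurable F := by
          rw [← hFeq]; exact h.meas.comp (MeasurableEquiv.measurable _)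
        exact this.comp measurable_prodMk_left
      · have := h.lip (Fin.cons y x) (Fin.cons y z)
        rw [Fin.sum_univ_succ] at this
        simpa using this
    have hFi : Integrable F (μ.prod pn) := hmem.integrable (by norm_num)
    set m := ∫ p, F p ∂(μ.prod pn) with hm
    set fb : α → ℝ := fun y => ∫ z, F (y, z) ∂pn with hfb
    have hm' : m = ∫ y, fb y ∂μ := integral_prod F hFi
    have hF2 : Integrable (fun p => (F p - m) ^ 2) (μ.prod pn) := (hmem.sub (memLp_const m)).integrable_sq
    have hstep : ∫ p, (F p - m) ^ 2 ∂(μ.prod pn)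
        = ∫ y, (∫ z, (F (y, z) - fb y) ^ 2 ∂pn + (fb y - m) ^ 2) ∂μ := by
      rw [integral_prod _ hF2]
      refine integral_congr_ae (ae_of_all _ fun y => ?_)
      exact var_split pn _ ((hsec y).memLp he) m
    change ∫ p, (F p - m) ^ 2 ∂(μ.prod pn) ≤ _
    rw [hstep]
    have hfbl : ∀ y y', |fb y - fb y'| ≤ c 0 * |e y - e y'| := by
      intro y y'
      have h1 : Integrable (fun z => F (y, z)) pn := ((hsec y).memLp he).integrable (by norm_num)
      have h2 : Integrable (fun z => F (y', z)) pn := ((hsec y').memLp he).integrable (by norm_num)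
      rw [hfb]
      simp only
      rw [← integral_sub h1 h2]
      refine (abs_integral_le_integral_abs).trans ?_
      have : ∫ z, |F (y, z) - F (y', z)| ∂pn ≤ ∫ z, c 0 * |e y - e y'| ∂pn := by
        refine integral_mono (h1.sub h2).abs (integrable_const _) fun z => ?_
        have := h.lip (Fin.cons y z) (Fin.cons y' z)
        rw [Fin.sum_univ_succ] at this
        simpa using this
      simpa using this
    have hfm : MemLp fb 2 μ := by
      have hme : AEStronglyMeasurable fb μ := hFi.integral_prod_left.aestronglyMeasurable
      have hb : MemLp (fun y => |fb y0| + c 0 * |e y - e y0|) 2 μ := by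
        have ha : MemLp (fun _ : α => |fb y0|) 2 μ := memLp_const _
        have hb : MemLp (fun y => e y - e y0) 2 μ := he.sub (memLp_const (e y0))
        have hb' : MemLp (fun y => c 0 * |e y - e y0|) 2 μ := hb.norm.const_mul (c 0)
        exact ha.add hb'
      refine hb.mono hme (ae_of_all _ fun y => ?_)
      have := hfbl y y0
      have h0 := hc 0
      rw [Real.norm_eq_abs, Real.norm_eq_abs, abs_of_nonneg (add_nonneg (abs_nonneg _) (mul_nonneg h0 (abs_nonneg _)))]
      have h4 := abs_sub_abs_le_abs_sub (fb y) (fb y0)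
      linarith
    have hv2 : Integrable (fun y => (fb y - m) ^ 2) μ := (hfm.sub (memLp_const m)).integrable_sq
    have hv1 : Integrable (fun y => ∫ z, (F (y, z) - fb y) ^ 2 ∂pn) μ := by
      have h3 := (hF2.integral_prod_left).sub hv2
      refine h3.congr (ae_of_all _ fun y => ?_)
      simp only [Pi.sub_apply]
      rw [var_split pn _ ((hsec y).memLp he) m]
      simp [hfb]
    rw [integral_add hv1 hv2, Fin.sum_univ_succ, mul_add, add_comm]
    have hA : ∫ y, (fb y - m) ^ 2 ∂μ ≤ (∫ y, (e y - e y0) ^ 2 ∂μ) * c 0 ^ 2 := by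
      have h5 := var_split μ fb hfm (fb y0)
      rw [← hm'] at h5
      have h6 : ∫ y, (fb y - fb y0) ^ 2 ∂μ ≤ ∫ y, (e y - e y0) ^ 2 * c 0 ^ 2 ∂μ := by
        refine integral_mono (hfm.sub (memLp_const _)).integrable_sq (heD.mul_const _) fun y => ?_
        have := hfbl y y0
        simp only
        rw [← sq_abs, ← sq_abs (e y - e y0), ← mul_pow]
        exact pow_le_pow_left₀ (abs_nonneg _) (by linarith) 2
      rw [integral_mul_const] at h6
      nlinarith [sq_nonneg (m - fb y0)]
    have hB : ∫ y, ∫ z, (F (y, z) - fb y) ^ 2 ∂pn ∂μ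
        ≤ (∫ y, (e y - e y0) ^ 2 ∂μ) * ∑ k : Fin n, c k.succ ^ 2 := by
      have : ∫ y, ∫ z, (F (y, z) - fb y) ^ 2 ∂pn ∂μ
          ≤ ∫ _y : α, (∫ y, (e y - e y0) ^ 2 ∂μ) * ∑ k : Fin n, c k.succ ^ 2 ∂μ :=
        integral_mono hv1 (integrable_const _) fun y => ih _ _ (hsec y) fun k => hc k.succ
      simpa using this
    exact add_le_add hA hB

lemma efron (y0 : α) (he : MemLp e 2 μ) (h : LipC e c f) (hc : ∀ k, 0 ≤ c k) :
    ∫ x, (f x - ∫ z, f z ∂(Measure.pi fun _ : ι => μ)) ^ 2 ∂(Measure.pi fun _ : ι => μ)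
      ≤ (∫ y, (e y - e y0) ^ 2 ∂μ) * ∑ k, c k ^ 2 := by
  classical
  let E := Fintype.equivFin ι
  have hmp := measurePreserving_piCongrLeft (fun _ : ι => μ) E.symm
  have hform : ∀ (x : Fin (Fintype.card ι) → α), (MeasurableEquiv.piCongrLeft (fun _ : ι => α) E.symm) x
      = fun i => x (E i) := by
    intro x
    ext i
    have := MeasurableEquiv.piCongrLeft_apply_apply (β := fun _ : ι => α) E.symm x (E i)
    simpa using this
  have hInt0 : ∀ G : (ι → α) → ℝ, ∫ x, G x ∂(Measure.pi fun _ : ι => μ)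
      = ∫ x, G (fun i => x (E i)) ∂(Measure.pi fun _ : Fin (Fintype.card ι) => μ) := by
    intro G
    rw [← hmp.integral_comp' (g := G)]
    simp only [hform]
  rw [hInt0, hInt0 f]
  have h' : LipC e (fun k => c (E.symm k)) (fun x : Fin (Fintype.card ι) → α => f (fun i => x (E i))) := by
    refine ⟨?_, fun x y => ?_⟩
    · exact h.meas.comp (measurable_pi_lambda _ fun i => measurable_pi_apply _)
    · refine (h.lip _ _).trans (le_of_eq ?_)
      rw [← E.symm.sum_comp]
      simp
  refine (efron_fin y0 he _ _ _ h' fun k => hc _).trans (le_of_eq ?_)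
  congr 1
  exact E.symm.sum_comp (fun k => c k ^ 2)

/-- L1 concentration -/
lemma efron_l1 (y0 : α) (he : MemLp e 2 μ) (h : LipC e c f) (hc : ∀ k, 0 ≤ c k) :
    ∫ x, |f x - ∫ z, f z ∂(Measure.pi fun _ : ι => μ)| ∂(Measure.pi fun _ : ι => μ)
      ≤ √((∫ y, (e y - e y0) ^ 2 ∂μ) * ∑ k, c k ^ 2) := by
  have : Nonempty α := ⟨y0⟩
  have hm := h.memLp he
  set a := ∫ z, f z ∂(Measure.pi fun _ : ι => μ)
  have hm1 : MemLp (fun x => |f x - a|) 2 (Measure.pi fun _ : ι => μ) := (hm.sub (memLp_const a)).norm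
  refine Real.le_sqrt_of_sq_le ((?_ : _ ≤ _).trans (efron y0 he h hc))
  have := var_split (Measure.pi fun _ : ι => μ) _ hm1 0
  simp only [sub_zero, sq_abs] at this
  rw [this]
  have : 0 ≤ ∫ x, (|f x - a| - ∫ z, |f z - a| ∂(Measure.pi fun _ : ι => μ)) ^ 2 ∂(Measure.pi fun _ : ι => μ) :=
    integral_nonneg fun x => sq_nonneg _
  linarith
end

set_option linter.unusedSectionVars false

section quenched
variable {X K : Type} [Fintype X] [Fintype K] {p : X → ℝ} {φ : X → K → ℝ} {γ : K → ℝ}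

/-- joint expectation over the planted configuration and the Gaussian disorder -/
def PE (p : X → ℝ) (F : X → (K → ℝ) → ℝ) : ℝ := ∑ x, p x * ∫ g, F x g ∂(GK K)

lemma PE_add {F G : X → (K → ℝ) → ℝ} (hF : ∀ x, Nc (F x)) (hG : ∀ x, Nc (G x)) :
    PE p (fun x g => F x g + G x g) = PE p F + PE p G := by
  unfold PE
  rw [← Finset.sum_add_distrib]
  refine Finset.sum_congr rfl fun x _ => ?_
  rw [integral_add (hF x).int (hG x).int]; ring

lemma PE_sub {F G : X → (K → ℝ) → ℝ} (hF : ∀ x, Nc (F x)) (hG : ∀ x, Nc (G x)) :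
    PE p (fun x g => F x g - G x g) = PE p F - PE p G := by
  unfold PE
  rw [← Finset.sum_sub_distrib]
  refine Finset.sum_congr rfl fun x _ => ?_
  rw [integral_sub (hF x).int (hG x).int]; ring

lemma PE_smul (c : ℝ) (F : X → (K → ℝ) → ℝ) : PE p (fun x g => c * F x g) = c * PE p F := by
  unfold PE
  rw [Finset.mul_sum]
  refine Finset.sum_congr rfl fun x _ => ?_
  rw [integral_const_mul]; ring

lemma PE_sum {ι : Type*} (s : Finset ι) {F : ι → X → (K → ℝ) → ℝ} (hF : ∀ i x, Nc (F i x)) :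
    PE p (fun x g => ∑ i ∈ s, F i x g) = ∑ i ∈ s, PE p (F i) := by
  unfold PE
  rw [Finset.sum_comm]
  refine Finset.sum_congr rfl fun x _ => ?_
  rw [integral_finsetSum _ fun i _ => (hF i x).int, Finset.mul_sum]

lemma PE_const (hp : IsPr p) (c : ℝ) : PE p (fun _ (_ : K → ℝ) => c) = c := by
  unfold PE
  simp [← Finset.sum_mul, hp.sum]

lemma PE_mono (hp : IsPr p) {F G : X → (K → ℝ) → ℝ} (hF : ∀ x, Nc (F x)) (hG : ∀ x, Nc (G x))
    (h : ∀ x g, F x g ≤ G x g) : PE p F ≤ PE p G :=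
  Finset.sum_le_sum fun x _ => mul_le_mul_of_nonneg_left
    (integral_mono (hF x).int (hG x).int (h x)) (hp.nonneg x)

lemma PE_abs (hp : IsPr p) {F : X → (K → ℝ) → ℝ} (hF : ∀ x, Nc (F x)) :
    |PE p F| ≤ PE p (fun x g => |F x g|) := by
  have h1 := PE_mono hp hF (fun x => (hF x).abs) (fun x g => le_abs_self _)
  have h2 := PE_mono hp (fun x => (Nc.const (-1)).mul (hF x).abs) hF
    (fun x g => by have := neg_abs_le (F x g); linarith)
  rw [PE_smul] at h2
  rw [abs_le]; constructor <;> linarith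

lemma PE_nish (hp : IsPr p) (hγ : ∀ k, 0 ≤ γ k) (a : X → ℝ) {f : (K → ℝ) → ℝ} (hf : Nc f) :
    PE p (fun x g => a x * f (g + fun k => √(γ k) * φ x k)) = EM p φ γ (fun w => Br p (th φ γ w) a * f w) := by
  rw [← nishimori hp hγ a hf]
  unfold PE
  simp only [integral_const_mul]

lemma PE_nish1 (hp : IsPr p) (hγ : ∀ k, 0 ≤ γ k) {f : (K → ℝ) → ℝ} (hf : Nc f) :
    PE p (fun x g => f (g + fun k => √(γ k) * φ x k)) = EM p φ γ f := nishimori1 hp hγ hf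

/-- derivative of `th` in the direction of a coordinate -/
lemma th_dir [DecidableEq K] (k : K) (w : K → ℝ) (x : X) :
    HasDerivAt (fun t : ℝ => th φ γ (w + t • Pi.single k (1 : ℝ)) x) (√(γ k) * φ x k) 0 := by
  have e : (fun t : ℝ => th φ γ (w + t • Pi.single k (1 : ℝ)) x) = fun t => th φ γ w x + t * (√(γ k) * φ x k) := by
    funext t
    unfold th
    have : ∀ l, √(γ l) * φ x l * (w + t • (Pi.single k (1 : ℝ) : K → ℝ)) l - γ l * φ x l ^ 2 / 2
        = (√(γ l) * φ x l * w l - γ l * φ x l ^ 2 / 2) + t * (if l = k then √(γ l) * φ x l else 0) := by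
      intro l
      simp only [Pi.add_apply, Pi.smul_apply, smul_eq_mul, Pi.single_apply]
      split_ifs <;> ring
    rw [Finset.sum_congr rfl fun l _ => this l, Finset.sum_add_distrib, ← Finset.mul_sum]
    simp
  rw [e]
  simpa using ((hasDerivAt_id (0:ℝ)).mul_const (√(γ k) * φ x k)).const_add (th φ γ w x)

lemma Br_dir [DecidableEq K] (hp : IsPr p) (k : K) (w : K → ℝ) (a : X → ℝ) :
    HasDerivAt (fun t : ℝ => Br p (th φ γ (w + t • Pi.single k (1 : ℝ))) a)
      (√(γ k) * Cv p (th φ γ w) a (fun x => φ x k)) 0 := by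
  have := hasDerivAt_Br hp (Θ := fun t : ℝ => th φ γ (w + t • (Pi.single k (1 : ℝ) : K → ℝ))) (θ' := fun x => √(γ k) * φ x k) (s := 0)
    (fun x => th_dir (φ := φ) (γ := γ) k w x) a
  simp only [zero_smul, add_zero] at this
  rw [← Cv_smul]
  exact this

/-- Integration by parts under the planted law. -/
lemma EM_ibp [DecidableEq K] (hp : IsPr p) (k : K) (f f' : (K → ℝ) → ℝ) (hf : Nc f) (hf' : Nc f')
    (hd : ∀ w, HasDerivAt (fun t : ℝ => f (w + t • Pi.single k (1 : ℝ))) (f' w) 0) :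
    EM p φ γ (fun w => w k * Br p (th φ γ w) (fun x => φ x k) * f w)
      = √(γ k) * EM p φ γ (fun w => Br p (th φ γ w) (fun x => φ x k ^ 2) * f w)
        + EM p φ γ (fun w => Br p (th φ γ w) (fun x => φ x k) * f' w) := by
  have hM := (Rg.MZ hp).nc φ γ
  have hB := (Rg.Br hp (fun x => φ x k)).nc φ γ
  have hB2 := (Rg.Br hp (fun x => φ x k ^ 2)).nc φ γ
  rw [← EM_smul, ← EM_add hp ((Nc.const _).mul (hB2.mul hf)) (hB.mul hf')]
  unfold EM
  have h1 := (hM.mul hB).mul hf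
  have h2 := hM.mul (((Nc.const (√(γ k))).mul (hB2.mul hf)).add (hB.mul hf'))
  rw [← ibp_GK k _ _ h1.1 h2.1 h1.2 h2.2 ?_]
  · refine integral_congr_ae (ae_of_all _ fun w => ?_)
    simp only []; ring
  · intro w
    have e : ∀ w, MZ p (th φ γ w) * Br p (th φ γ w) (fun x => φ x k) * f w
        = NB p (th φ γ w) (fun x => φ x k) * f w := fun w => by rw [MZ_mul_Br hp]
    simp only [e]
    have hN := hasDerivAt_NB (p := p) (Θ := fun t : ℝ => th φ γ (w + t • (Pi.single k (1 : ℝ) : K → ℝ))) (θ' := fun x => √(γ k) * φ x k) (s := 0)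
      (fun x => th_dir (φ := φ) (γ := γ) k w x) (fun x => φ x k)
    refine (hN.mul (hd w)).congr_deriv ?_
    simp only [zero_smul, add_zero]
    have e2 : NB p (th φ γ w) (fun x => φ x k * (√(γ k) * φ x k)) =
        MZ p (th φ γ w) * (√(γ k) * Br p (th φ γ w) (fun x => φ x k ^ 2)) := by
      rw [← MZ_mul_Br hp, ← Br_smul (th φ γ w) (√(γ k))]
      congr 2; funext x; ring
    rw [e2, ← MZ_mul_Br hp]
    ring

end quenched

set_option linter.unusedSectionVars false

section quenched2
variable {X K : Type} [Fintype X] [Fintype K] [DecidableEq K] {p : X → ℝ} {φ : X → K → ℝ}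

/-- signal-to-noise vector with value `r²` on `I`. -/
def gr (I : Finset K) (c : K → ℝ) (r : ℝ) (k : K) : ℝ := if k ∈ I then r ^ 2 else c k

/-- quenched free energy -/
def Aq (p : X → ℝ) (φ : X → K → ℝ) (γ : K → ℝ) (x : X) (g : K → ℝ) : ℝ :=
  Real.log (MZ p (th φ γ (g + fun k => √(γ k) * φ x k)))

/-- quenched derivative in terms of the observation -/
def LL (p : X → ℝ) (φ : X → K → ℝ) (I : Finset K) (γ : K → ℝ) (r : ℝ) (x : X) (w : K → ℝ) : ℝ :=
  ∑ k ∈ I, (w k * Br p (th φ γ w) (fun y => φ y k) + φ x k * (r * Br p (th φ γ w) (fun y => φ y k))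
    - r * Br p (th φ γ w) (fun y => φ y k ^ 2))

variable {I : Finset K} {c : K → ℝ} {r : ℝ}

lemma gr_nonneg (hc : ∀ k, 0 ≤ c k) (k : K) : 0 ≤ gr I c r k := by
  unfold gr; split_ifs; exacts [sq_nonneg r, hc k]

lemma sqrt_gr (hr : 0 ≤ r) (k : K) (hk : k ∈ I) : √(gr I c r k) = r := by
  unfold gr; rw [if_pos hk, Real.sqrt_sq hr]

lemma LL_nc (hp : IsPr p) (γ : K → ℝ) (x : X) : Nc (LL p φ I γ r x) := by
  unfold LL
  refine Nc.sum _ fun k => ?_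
  have hB := (Rg.Br hp (fun x => φ x k)).nc φ γ
  have hB2 := (Rg.Br hp (fun x => φ x k ^ 2)).nc φ γ
  exact (((Nc.coord k).mul hB).add ((Nc.const _).mul ((Nc.const r).mul hB))).sub ((Nc.const r).mul hB2)

lemma Aq_nc (hp : IsPr p) (γ : K → ℝ) (x : X) : Nc (Aq p φ γ x) :=
  ((Rg.logMZ hp).nc φ γ).shift _

lemma PE_Aq (hp : IsPr p) {γ : K → ℝ} (hγ : ∀ k, 0 ≤ γ k) : PE p (Aq p φ γ) = Free p φ γ :=
  PE_nish1 hp hγ ((Rg.logMZ hp).nc φ γ)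

/-- convexity-type inequality for the quenched free energy -/
lemma Aq_conv (hp : IsPr p) (hc : ∀ k, 0 ≤ c k) (hr : 0 ≤ r) {r' : ℝ} (hr' : 0 ≤ r')
    (B : K → ℝ) (hB : ∀ x k, |φ x k| ≤ B k) (x : X) (g : K → ℝ) :
    Aq p φ (gr I c r) x g + (r' - r) * LL p φ I (gr I c r) r x (g + fun k => √(gr I c r k) * φ x k)
      - (r' - r) ^ 2 * ∑ k ∈ I, 3 / 2 * B k ^ 2 ≤ Aq p φ (gr I c r') x g := by
  have hg := gibbs_ineq hp (th φ (gr I c r) (g + fun k => √(gr I c r k) * φ x k))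
    (th φ (gr I c r') (g + fun k => √(gr I c r' k) * φ x k))
  set w := g + fun k => √(gr I c r k) * φ x k with hw
  set θ := th φ (gr I c r) w with hθ
  have hdiff : ∀ y, (r' - r) * (∑ k ∈ I, (w k * φ y k + φ x k * (r * φ y k) - r * φ y k ^ 2))
      + (r' - r) ^ 2 * (∑ k ∈ I, (φ y k * φ x k - φ y k ^ 2 / 2))
      = th φ (gr I c r') (g + fun k => √(gr I c r' k) * φ x k) y - θ y := by
    intro y
    rw [hθ]
    unfold th
    rw [← Finset.sum_sub_distrib, Finset.mul_sum, Finset.mul_sum, ← Finset.sum_add_distrib,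
      ← Finset.sum_subset (Finset.subset_univ I)]
    · refine Finset.sum_congr rfl fun k hk => ?_
      rw [hw]
      simp only [Pi.add_apply, sqrt_gr hr k hk, sqrt_gr hr' k hk]
      simp only [gr, if_pos hk]
      ring
    · intro k _ hk
      rw [hw]
      simp only [gr, if_neg hk, Pi.add_apply]
      ring
  have h1 : Br p θ (fun y => th φ (gr I c r') (g + fun k => √(gr I c r' k) * φ x k) y - θ y)
      = (r' - r) * LL p φ I (gr I c r) r x w
        + (r' - r) ^ 2 * Br p θ (fun y => ∑ k ∈ I, (φ y k * φ x k - φ y k ^ 2 / 2)) := by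
    simp only [← hdiff]
    rw [Br_add, Br_smul, Br_smul, Br_sum]
    congr 2
    unfold LL
    refine Finset.sum_congr rfl fun k _ => ?_
    rw [Br_sub, Br_add, Br_smul, Br_smul, Br_smul, Br_smul]
  have h2 : |Br p θ (fun y => ∑ k ∈ I, (φ y k * φ x k - φ y k ^ 2 / 2))| ≤ ∑ k ∈ I, 3 / 2 * B k ^ 2 := by
    refine Br_abs_le hp θ fun y => (Finset.abs_sum_le_sum_abs _ _).trans (Finset.sum_le_sum fun k _ => ?_)
    have a1 := hB y k
    have a2 := hB x k
    have a3 : |φ y k * φ x k| ≤ B k * B k := by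
      rw [abs_mul]; exact mul_le_mul a1 a2 (abs_nonneg _) ((abs_nonneg _).trans a1)
    have a4 : φ y k ^ 2 ≤ B k ^ 2 := by
      rw [← sq_abs]; exact pow_le_pow_left₀ (abs_nonneg _) a1 2
    have a5 := sq_nonneg (φ y k)
    rw [abs_le] at a3 ⊢
    constructor <;> nlinarith
  rw [h1] at hg
  have h3 := (abs_le.1 h2).1
  unfold Aq
  rw [← hw, ← hθ]
  nlinarith [sq_nonneg (r' - r)]

/-- the integration-by-parts identity for the quenched derivative -/
lemma PE_LL (hp : IsPr p) (hc : ∀ k, 0 ≤ c k) (hr : 0 ≤ r) (f : (K → ℝ) → ℝ) (f' : K → (K → ℝ) → ℝ)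
    (hf : Nc f) (hf' : ∀ k, Nc (f' k))
    (hd : ∀ k w, HasDerivAt (fun t : ℝ => f (w + t • Pi.single k (1 : ℝ))) (f' k w) 0) :
    PE p (fun x g => LL p φ I (gr I c r) r x (g + fun k => √(gr I c r k) * φ x k)
        * f (g + fun k => √(gr I c r k) * φ x k))
      = r * EM p φ (gr I c r) (fun w => (∑ k ∈ I, Br p (th φ (gr I c r) w) (fun y => φ y k) ^ 2) * f w)
        + ∑ k ∈ I, EM p φ (gr I c r) (fun w => Br p (th φ (gr I c r) w) (fun y => φ y k) * f' k w) := by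
  set γ := gr I c r with hγd
  have hγ : ∀ k, 0 ≤ γ k := gr_nonneg hc
  have hB := fun k => (Rg.Br hp (fun x => φ x k)).nc φ γ
  have hB2 := fun k => (Rg.Br hp (fun x => φ x k ^ 2)).nc φ γ
  have n1 : ∀ k, Nc (fun w : K → ℝ => w k * Br p (th φ γ w) (fun y => φ y k) * f w) :=
    fun k => ((Nc.coord k).mul (hB k)).mul hf
  have n2 : ∀ k, Nc (fun w : K → ℝ => r * (Br p (th φ γ w) (fun y => φ y k) * f w)) :=
    fun k => (Nc.const r).mul ((hB k).mul hf)
  have n3 : ∀ k, Nc (fun w : K → ℝ => r * (Br p (th φ γ w) (fun y => φ y k ^ 2) * f w)) :=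
    fun k => (Nc.const r).mul ((hB2 k).mul hf)
  have e : ∀ x g, LL p φ I γ r x (g + fun k => √(γ k) * φ x k) * f (g + fun k => √(γ k) * φ x k)
      = ∑ k ∈ I, (((fun w : K → ℝ => w k * Br p (th φ γ w) (fun y => φ y k) * f w) (g + fun k => √(γ k) * φ x k)
        + φ x k * (fun w : K → ℝ => r * (Br p (th φ γ w) (fun y => φ y k) * f w)) (g + fun k => √(γ k) * φ x k))
        - (fun w : K → ℝ => r * (Br p (th φ γ w) (fun y => φ y k ^ 2) * f w)) (g + fun k => √(γ k) * φ x k)) := by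
    intro x g
    unfold LL
    rw [Finset.sum_mul]
    exact Finset.sum_congr rfl fun k _ => by ring
  simp only [e]
  rw [PE_sum _ fun k x => (((n1 k).shift _).add ((Nc.const _).mul ((n2 k).shift _))).sub ((n3 k).shift _)]
  have e3 : EM p φ γ (fun w => (∑ k ∈ I, Br p (th φ γ w) (fun y => φ y k) ^ 2) * f w)
      = ∑ k ∈ I, EM p φ γ (fun w => Br p (th φ γ w) (fun y => φ y k) ^ 2 * f w) := by
    simp only [Finset.sum_mul]
    exact EM_sum hp _ fun k => (hB k).pow2.mul hf
  rw [e3, Finset.mul_sum, ← Finset.sum_add_distrib]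
  refine Finset.sum_congr rfl fun k hk => ?_
  rw [PE_sub (fun x => (((n1 k).shift _).add ((Nc.const _).mul ((n2 k).shift _)))) (fun x => (n3 k).shift _),
    PE_add (fun x => (n1 k).shift _) (fun x => (Nc.const _).mul ((n2 k).shift _)),
    PE_nish1 hp hγ (n1 k), PE_nish1 hp hγ (n3 k), PE_nish hp hγ (fun x => φ x k) (n2 k),
    EM_ibp hp k f (f' k) hf (hf' k) (hd k), EM_smul, sqrt_gr hr k hk]
  have e4 : (fun w => Br p (th φ γ w) (fun x => φ x k) * (r * (Br p (th φ γ w) (fun y => φ y k) * f w)))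
      = fun w => r * (Br p (th φ γ w) (fun y => φ y k) ^ 2 * f w) := by funext w; ring
  rw [e4, EM_smul]
  ring

/-- mean of the quenched derivative -/
lemma PE_LL1 (hp : IsPr p) (hc : ∀ k, 0 ≤ c k) (hr : 0 ≤ r) :
    PE p (fun x g => LL p φ I (gr I c r) r x (g + fun k => √(gr I c r k) * φ x k))
      = r * EM p φ (gr I c r) (fun w => ∑ k ∈ I, Br p (th φ (gr I c r) w) (fun y => φ y k) ^ 2) := by
  have := PE_LL (φ := φ) (I := I) hp hc hr (fun _ => 1) (fun _ _ => 0) (Nc.const 1) (fun _ => Nc.const 0)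
    (fun k w => hasDerivAt_const _ _)
  simp only [mul_one, mul_zero] at this
  rw [this]
  have h0 : EM p φ (gr I c r) (fun _ => 0) = 0 := by simp [EM]
  simp [h0]

/-- covariance bound from the fluctuations of the quenched derivative -/
lemma cov_le_LL (hp : IsPr p) (hc : ∀ k, 0 ≤ c k) (hr : 0 ≤ r) (f : (K → ℝ) → ℝ) (f' : K → (K → ℝ) → ℝ)
    (hf : Nc f) (hf' : ∀ k, Nc (f' k))
    (hd : ∀ k w, HasDerivAt (fun t : ℝ => f (w + t • Pi.single k (1 : ℝ))) (f' k w) 0)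
    (M : ℝ) (hM : ∀ w, |f w| ≤ M) :
    r * |EM p φ (gr I c r) (fun w => (∑ k ∈ I, Br p (th φ (gr I c r) w) (fun y => φ y k) ^ 2) * f w)
        - EM p φ (gr I c r) (fun w => ∑ k ∈ I, Br p (th φ (gr I c r) w) (fun y => φ y k) ^ 2)
          * EM p φ (gr I c r) f|
      ≤ M * PE p (fun x g => |LL p φ I (gr I c r) r x (g + fun k => √(gr I c r k) * φ x k)
          - PE p (fun x g => LL p φ I (gr I c r) r x (g + fun k => √(gr I c r k) * φ x k))|)
        + ∑ k ∈ I, EM p φ (gr I c r) (fun w => |Br p (th φ (gr I c r) w) (fun y => φ y k) * f' k w|) := by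
  have hI := PE_LL (φ := φ) (I := I) hp hc hr f f' hf hf' hd
  have hI1 := PE_LL1 (φ := φ) (I := I) hp hc hr
  set γ := gr I c r with hγd
  have hγ : ∀ k, 0 ≤ γ k := gr_nonneg hc
  have hB := fun k => (Rg.Br hp (fun x => φ x k)).nc φ γ
  set m := PE p (fun x g => LL p φ I γ r x (g + fun k => √(γ k) * φ x k)) with hm
  have nL : ∀ x, Nc (fun g => LL p φ I γ r x (g + fun k => √(γ k) * φ x k)) := fun x => (LL_nc hp γ x).shift _
  have nf : ∀ x, Nc (fun g => f (g + fun k => √(γ k) * φ x k)) := fun x => hf.shift _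
  have h1 : PE p (fun x g => (LL p φ I γ r x (g + fun k => √(γ k) * φ x k) - m)
      * f (g + fun k => √(γ k) * φ x k))
      = PE p (fun x g => LL p φ I γ r x (g + fun k => √(γ k) * φ x k)
        * f (g + fun k => √(γ k) * φ x k)) - m * EM p φ γ f := by
    rw [← PE_nish1 (φ := φ) hp hγ hf, ← PE_smul, ← PE_sub (fun x => (nL x).mul (nf x))
      (fun x => (Nc.const m).mul (nf x))]
    congr 1; funext x g; ring
  have h2 : |PE p (fun x g => (LL p φ I γ r x (g + fun k => √(γ k) * φ x k) - m)
      * f (g + fun k => √(γ k) * φ x k))| ≤ M * PE p (fun x g => |LL p φ I γ r x (g + fun k => √(γ k) * φ x k) - m|) := by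
    refine (PE_abs hp fun x => ((nL x).sub (Nc.const m)).mul (nf x)).trans ?_
    rw [← PE_smul]
    refine PE_mono hp (fun x => (((nL x).sub (Nc.const m)).mul (nf x)).abs)
      (fun x => (Nc.const M).mul ((nL x).sub (Nc.const m)).abs) fun x g => ?_
    rw [abs_mul, mul_comm]
    exact mul_le_mul_of_nonneg_right (hM _) (abs_nonneg _)
  have h3 : |∑ k ∈ I, EM p φ γ (fun w => Br p (th φ γ w) (fun y => φ y k) * f' k w)|
      ≤ ∑ k ∈ I, EM p φ γ (fun w => |Br p (th φ γ w) (fun y => φ y k) * f' k w|) :=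
    (Finset.abs_sum_le_sum_abs _ _).trans (Finset.sum_le_sum fun k _ => EM_abs hp ((hB k).mul (hf' k)))
  rw [← abs_of_nonneg hr, ← abs_mul, abs_of_nonneg hr]
  rw [h1, hI, hI1] at h2
  set E1 := EM p φ γ (fun w => (∑ k ∈ I, Br p (th φ γ w) (fun y => φ y k) ^ 2) * f w)
  set E2 := EM p φ γ (fun w => ∑ k ∈ I, Br p (th φ γ w) (fun y => φ y k) ^ 2)
  set E3 := ∑ k ∈ I, EM p φ γ (fun w => Br p (th φ γ w) (fun y => φ y k) * f' k w)
  have h4 : r * (E1 - E2 * EM p φ γ f) = (r * E1 + E3 - r * E2 * EM p φ γ f) - E3 := by ring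
  rw [h4]
  refine (abs_sub _ _).trans (add_le_add ?_ h3)
  rw [hI1]
  exact h2

/-- fluctuations of the quenched derivative from concentration of the quenched free energy -/
lemma LL_fluct (hp : IsPr p) (hc : ∀ k, 0 ≤ c k) {δ : ℝ} (hδ : 0 < δ) (hr : δ ≤ r)
    (B : K → ℝ) (hB : ∀ x k, |φ x k| ≤ B k) (D : ℝ)
    (hD : ∀ s, r - δ ≤ s → s ≤ r + δ → PE p (fun x g => |Aq p φ (gr I c s) x g - Free p φ (gr I c s)|) ≤ D) :
    PE p (fun x g => |LL p φ I (gr I c r) r x (g + fun k => √(gr I c r k) * φ x k)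
          - PE p (fun x g => LL p φ I (gr I c r) r x (g + fun k => √(gr I c r k) * φ x k))|)
      ≤ 4 * D / δ + (Free p φ (gr I c (r + δ)) - 2 * Free p φ (gr I c r) + Free p φ (gr I c (r - δ))) / δ
        + 2 * (∑ k ∈ I, 3 / 2 * B k ^ 2) * δ := by
  set C0 := ∑ k ∈ I, 3 / 2 * B k ^ 2 with hC0
  have hr0 : 0 ≤ r := hδ.le.trans hr
  set L : X → (K → ℝ) → ℝ := fun x g => LL p φ I (gr I c r) r x (g + fun k => √(gr I c r k) * φ x k) with hL
  have nL : ∀ x, Nc (L x) := fun x => (LL_nc hp _ x).shift _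
  have up : ∀ x g, L x g ≤ (Aq p φ (gr I c (r + δ)) x g - Aq p φ (gr I c r) x g) / δ + C0 * δ := by
    intro x g
    have := Aq_conv (I := I) hp hc hr0 (r' := r + δ) (by linarith) B hB x g
    rw [← sub_le_iff_le_add, le_div_iff₀ hδ]
    simp only [hL]
    nlinarith
  have lo : ∀ x g, (Aq p φ (gr I c r) x g - Aq p φ (gr I c (r - δ)) x g) / δ - C0 * δ ≤ L x g := by
    intro x g
    have := Aq_conv (I := I) hp hc hr0 (r' := r - δ) (by linarith) B hB x g
    rw [sub_le_iff_le_add, div_le_iff₀ hδ]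
    simp only [hL]
    nlinarith
  have nA : ∀ s x, Nc (Aq p φ (gr I c s) x) := fun s x => Aq_nc hp _ x
  have EA : ∀ s, PE p (Aq p φ (gr I c s)) = Free p φ (gr I c s) := fun s => PE_Aq hp (gr_nonneg hc)
  set b : ℝ → ℝ := fun s => Free p φ (gr I c s) with hb
  set m := PE p L with hm
  have mup : m ≤ (b (r + δ) - b r) / δ + C0 * δ := by
    have := PE_mono hp nL (G := fun x g => δ⁻¹ * (Aq p φ (gr I c (r + δ)) x g - Aq p φ (gr I c r) x g) + C0 * δ)
      (fun x => ((Nc.const _).mul ((nA _ x).sub (nA _ x))).add (Nc.const _)) (fun x g => by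
        have := up x g; rwa [div_eq_inv_mul] at this)
    rw [PE_add (fun x => ((Nc.const _).mul ((nA _ x).sub (nA _ x)))) (fun x => Nc.const _), PE_smul,
      PE_sub (nA _) (nA _), EA, EA, PE_const hp] at this
    rw [div_eq_inv_mul]; exact this
  have mlo : (b r - b (r - δ)) / δ - C0 * δ ≤ m := by
    have := PE_mono hp (F := fun x g => δ⁻¹ * (Aq p φ (gr I c r) x g - Aq p φ (gr I c (r - δ)) x g) - C0 * δ)
      (fun x => ((Nc.const _).mul ((nA _ x).sub (nA _ x))).sub (Nc.const _)) nL (fun x g => by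
        have := lo x g; rwa [div_eq_inv_mul] at this)
    rw [PE_sub (fun x => ((Nc.const _).mul ((nA _ x).sub (nA _ x)))) (fun x => Nc.const _), PE_smul,
      PE_sub (nA _) (nA _), EA, EA, PE_const hp] at this
    rw [div_eq_inv_mul]; exact this
  set Q : ℝ := δ⁻¹ * (b (r + δ) - 2 * b r + b (r - δ)) + 2 * C0 * δ with hQ
  have pt : ∀ x g, |L x g - m| ≤ δ⁻¹ * (|Aq p φ (gr I c (r + δ)) x g - b (r + δ)|
      + 2 * |Aq p φ (gr I c r) x g - b r| + |Aq p φ (gr I c (r - δ)) x g - b (r - δ)|) + Q := by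
    intro x g
    have u := up x g
    have l := lo x g
    set a1 := Aq p φ (gr I c (r + δ)) x g
    set a2 := Aq p φ (gr I c r) x g
    set a3 := Aq p φ (gr I c (r - δ)) x g
    have i1 := abs_le.1 (le_refl |a1 - b (r + δ)|)
    have i2 := abs_le.1 (le_refl |a2 - b r|)
    have i3 := abs_le.1 (le_refl |a3 - b (r - δ)|)
    have hi : 0 < δ⁻¹ := by positivity
    rw [div_eq_inv_mul] at u l mup mlo
    rw [abs_le]
    constructor
    · have : δ⁻¹ * (a3 - b (r - δ) - (a2 - b r)) ≤ δ⁻¹ * (|a1 - b (r + δ)| + 2 * |a2 - b r| + |a3 - b (r - δ)|) :=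
        mul_le_mul_of_nonneg_left (by linarith [abs_nonneg (a1 - b (r + δ)), abs_nonneg (a2 - b r)]) hi.le
      rw [hQ]
      linarith
    · have : δ⁻¹ * (a1 - b (r + δ) - (a2 - b r)) ≤ δ⁻¹ * (|a1 - b (r + δ)| + 2 * |a2 - b r| + |a3 - b (r - δ)|) :=
        mul_le_mul_of_nonneg_left (by linarith [abs_nonneg (a3 - b (r - δ)), abs_nonneg (a2 - b r)]) hi.le
      rw [hQ]
      linarith
  have nab : ∀ s x, Nc (fun g => |Aq p φ (gr I c s) x g - b s|) := fun s x => ((nA s x).sub (Nc.const _)).abs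
  have fin := PE_mono hp (fun x => ((nL x).sub (Nc.const m)).abs)
    (fun x => ((Nc.const δ⁻¹).mul (((nab (r + δ) x).add ((Nc.const 2).mul (nab r x))).add (nab (r - δ) x))).add
      (Nc.const Q)) pt
  rw [PE_add (fun x => ((Nc.const δ⁻¹).mul (((nab (r + δ) x).add ((Nc.const 2).mul (nab r x))).add (nab (r - δ) x))))
    (fun x => Nc.const Q), PE_const hp, PE_smul,
    PE_add (fun x => ((nab (r + δ) x).add ((Nc.const 2).mul (nab r x)))) (nab (r - δ)),
    PE_add (nab (r + δ)) (fun x => (Nc.const 2).mul (nab r x)), PE_smul] at fin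
  refine fin.trans ?_
  have d1 := hD (r + δ) (by linarith) le_rfl
  have d2 := hD r (by linarith) (by linarith)
  have d3 := hD (r - δ) le_rfl (by linarith)
  have hi : 0 < δ⁻¹ := by positivity
  have : δ⁻¹ * (PE p (fun x g => |Aq p φ (gr I c (r + δ)) x g - b (r + δ)|)
      + 2 * PE p (fun x g => |Aq p φ (gr I c r) x g - b r|) +
      PE p (fun x g => |Aq p φ (gr I c (r - δ)) x g - b (r - δ)|)) ≤ δ⁻¹ * (4 * D) :=
    mul_le_mul_of_nonneg_left (by linarith) hi.le
  rw [hQ, div_eq_inv_mul, div_eq_inv_mul]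
  linarith

end quenched2

set_option linter.unusedSectionVars false

lemma stdG_memLp : MemLp (fun y : ℝ => y) 2 stdG := by
  have := memLp_id_gaussianReal (μ := 0) (v := 1) 2
  exact_mod_cast this

lemma stdG_sq : ∫ y, (y - 0) ^ 2 ∂stdG = 1 := by
  have h := variance_id_gaussianReal (μ := 0) (v := 1)
  have h2 := variance_eq_integral (μ := gaussianReal 0 1) (X := id) (by fun_prop)
  rw [h] at h2
  simp only [id, integral_id_gaussianReal] at h2
  unfold stdG
  rw [← h2]; simp

lemma gauss_l1 {K : Type} [Fintype K] (f : (K → ℝ) → ℝ) (hm : Measurable f) (c : K → ℝ) (hc : ∀ k, 0 ≤ c k)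
    (hl : ∀ x y, |f x - f y| ≤ ∑ k, c k * |x k - y k|) :
    ∫ g, |f g - ∫ z, f z ∂(GK K)| ∂(GK K) ≤ √(∑ k, c k ^ 2) := by
  have := efron_l1 (μ := stdG) (e := fun y : ℝ => y) (f := f) 0 stdG_memLp ⟨hm, hl⟩ hc
  rw [stdG_sq, one_mul] at this
  exact this

section disc
variable {S : Type} [Fintype S] [MeasurableSpace S] [MeasurableSingletonClass S]

/-- discrete measure with given weights -/
def discM (q : S → ℝ) : Measure S := ∑ s, ENNReal.ofReal (q s) • Measure.dirac s

lemma discM_singleton (q : S → ℝ) (s : S) : discM q {s} = ENNReal.ofReal (q s) := by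
  classical
  unfold discM
  rw [Measure.finsetSum_apply]
  simp [Set.indicator_apply]

lemma discM_prob {q : S → ℝ} (hq : IsPr q) : IsProbabilityMeasure (discM q) := by
  constructor
  unfold discM
  rw [Measure.finsetSum_apply]
  simp only [Measure.smul_apply, measure_univ, smul_eq_mul, mul_one]
  rw [← ENNReal.ofReal_sum_of_nonneg fun i _ => hq.nonneg i, hq.sum, ENNReal.ofReal_one]

lemma disc_pi {ι : Type} [Fintype ι] [DecidableEq ι] {q : S → ℝ} (hq : IsPr q) (f : (ι → S) → ℝ) :
    ∫ x, f x ∂(Measure.pi fun _ : ι => discM q) = ∑ x : ι → S, (∏ i, q (x i)) * f x := by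
  haveI := discM_prob hq
  rw [integral_fintype .of_finite]
  refine Finset.sum_congr rfl fun x _ => ?_
  rw [smul_eq_mul]
  congr 1
  rw [Measure.real, Measure.pi_singleton, ENNReal.toReal_prod]
  exact Finset.prod_congr rfl fun i _ => by
    rw [discM_singleton, ENNReal.toReal_ofReal (hq.nonneg _)]

lemma disc_l1 {ι : Type} [Fintype ι] [DecidableEq ι] {q : S → ℝ} (hq : IsPr q) (f : (ι → S) → ℝ) (e : S → ℝ) (B c : ℝ)
    (he : ∀ s, |e s| ≤ B) (hc : 0 ≤ c) (hl : ∀ x y, |f x - f y| ≤ ∑ k, c * |e (x k) - e (y k)|) :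
    ∑ x : ι → S, (∏ i, q (x i)) * |f x - ∑ z : ι → S, (∏ i, q (z i)) * f z|
      ≤ √(4 * B ^ 2 * (Fintype.card ι * c ^ 2)) := by
  haveI := discM_prob hq
  obtain ⟨y0⟩ : Nonempty S := by
    by_contra h
    rw [not_nonempty_iff] at h
    have := hq.sum
    simp at this
  have hm : MemLp e 2 (discM q) := MemLp.of_bound (measurable_of_finite e).aestronglyMeasurable B
    (ae_of_all _ fun s => he s)
  have h := efron_l1 (μ := discM q) (e := e) (f := f) (c := fun _ => c) y0 hm
    ⟨measurable_of_finite f, hl⟩ (fun _ => hc)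
  rw [disc_pi hq, disc_pi hq] at h
  refine h.trans (Real.sqrt_le_sqrt ?_)
  simp only [Finset.sum_const, Finset.card_univ, nsmul_eq_mul]
  refine mul_le_mul_of_nonneg_right ?_ (by positivity)
  have : ∫ y, (e y - e y0) ^ 2 ∂(discM q) ≤ ∫ _y : S, 4 * B ^ 2 ∂(discM q) := by
    refine integral_mono .of_finite .of_finite fun y => ?_
    have h1 := abs_le.1 (he y)
    have h2 := abs_le.1 (he y0)
    simp only
    nlinarith
  simpa using this

lemma prod_isPr {ι : Type} [Fintype ι] [DecidableEq ι] {q : S → ℝ} (hq : IsPr q) :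
    IsPr (fun x : ι → S => ∏ i, q (x i)) := by
  refine ⟨fun x => Finset.prod_nonneg fun i _ => hq.nonneg _, ?_⟩
  have := Finset.prod_univ_sum (fun _ : ι => (Finset.univ : Finset S)) (fun _ s => q s)
  rw [Fintype.piFinset_univ] at this
  rw [← this]
  simp [hq.sum]
end disc

section nmodel
variable (n : ℕ) {S : Type} [Fintype S] (e pu pv : S → ℝ)

abbrev XN (n : ℕ) (S : Type) := (Fin n → S) × (Fin n → S)
abbrev KN (n : ℕ) := (Fin n × Fin n) ⊕ (Fin n ⊕ Fin n)

def pN (x : XN n S) : ℝ := (∏ i, pu (x.1 i)) * ∏ j, pv (x.2 j)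

def phN (x : XN n S) : KN n → ℝ
  | .inl k => e (x.1 k.1) * e (x.2 k.2)
  | .inr (.inl i) => e (x.1 i)
  | .inr (.inr j) => e (x.2 j)

def gN (t h1 h2 : ℝ) : KN n → ℝ
  | .inl _ => t / n
  | .inr (.inl _) => h1
  | .inr (.inr _) => h2

variable {n e pu pv}

lemma pN_isPr (hu : IsPr pu) (hv : IsPr pv) : IsPr (pN n pu pv) := by
  letI : MeasurableSpace S := ⊤
  haveI : MeasurableSingletonClass S := ⟨fun _ => trivial⟩
  have h1 := prod_isPr (ι := Fin n) hu
  have h2 := prod_isPr (ι := Fin n) hv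
  refine ⟨fun x => mul_nonneg (h1.nonneg x.1) (h2.nonneg x.2), ?_⟩
  unfold pN
  rw [Fintype.sum_prod_type]
  simp only [← Finset.mul_sum, h2.sum, h1.sum, mul_one]

lemma gN_nonneg {t h1 h2 : ℝ} (ht : 0 ≤ t) (hh1 : 0 ≤ h1) (hh2 : 0 ≤ h2) (k : KN n) : 0 ≤ gN n t h1 h2 k := by
  rcases k with k | k | k <;> simp only [gN] <;> positivity

variable {B : ℝ}

lemma mul_bound {a b A C : ℝ} (ha : |a| ≤ A) (hb : |b| ≤ C) : |a * b| ≤ A * C := by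
  rw [abs_mul]; exact mul_le_mul ha hb (abs_nonneg _) ((abs_nonneg _).trans ha)

/-- bound on the features -/
def bN (n : ℕ) (B : ℝ) : KN n → ℝ
  | .inl _ => B * B
  | .inr _ => B

lemma phN_le (he : ∀ s, |e s| ≤ B) (x : XN n S) (k : KN n) : |phN n e x k| ≤ bN n B k := by
  rcases k with k | k | k <;> simp only [phN, bN]
  · exact mul_bound (he _) (he _)
  · exact he _
  · exact he _

/-- planted form of the Hamiltonian -/
lemma th_planted {X K : Type} [Fintype X] [Fintype K] (φ : X → K → ℝ) {γ : K → ℝ} (hγ : ∀ k, 0 ≤ γ k) (x : X)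
    (g : K → ℝ) (y : X) : th φ γ (g + fun k => √(γ k) * φ x k) y
      = ∑ k, (√(γ k) * φ y k * g k + γ k * (φ y k * φ x k) - γ k * φ y k ^ 2 / 2) := by
  unfold th
  refine Finset.sum_congr rfl fun k _ => ?_
  simp only [Pi.add_apply]
  have := Real.mul_self_sqrt (hγ k)
  linear_combination (φ y k * φ x k) * this

/-- Lipschitz property of the quenched free energy -/
lemma Aq_lip {X K : Type} [Fintype X] [Fintype K] {p : X → ℝ} (hp : IsPr p) (φ : X → K → ℝ) {γ : K → ℝ}
    (hγ : ∀ k, 0 ≤ γ k) (b : K → ℝ) (hb : ∀ x k, |φ x k| ≤ b k) (x x' : X) (g g' : K → ℝ) :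
    |Aq p φ γ x g - Aq p φ γ x' g'| ≤ ∑ k, (√(γ k) * b k * |g k - g' k| + γ k * b k * |φ x k - φ x' k|) := by
  unfold Aq
  refine log_MZ_lip hp _ _ fun y => ?_
  rw [th_planted φ hγ, th_planted φ hγ, ← Finset.sum_sub_distrib]
  refine (Finset.abs_sum_le_sum_abs _ _).trans (Finset.sum_le_sum fun k _ => ?_)
  have e1 : (√(γ k) * φ y k * g k + γ k * (φ y k * φ x k) - γ k * φ y k ^ 2 / 2)
      - (√(γ k) * φ y k * g' k + γ k * (φ y k * φ x' k) - γ k * φ y k ^ 2 / 2)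
      = √(γ k) * (φ y k * (g k - g' k)) + γ k * (φ y k * (φ x k - φ x' k)) := by ring
  rw [e1]
  refine (abs_add_le _ _).trans ?_
  rw [abs_mul, abs_mul (γ k), abs_of_nonneg (Real.sqrt_nonneg _), abs_of_nonneg (hγ k), abs_mul, abs_mul, mul_assoc,
    mul_assoc]
  have := hb y k
  have h3 := hγ k
  gcongr

lemma sum_KN (f : KN n → ℝ) : ∑ k, f k = (∑ i, ∑ j, f (.inl (i, j))) + (∑ i, f (.inr (.inl i)) + ∑ j, f (.inr (.inr j))) := by
  rw [Fintype.sum_sum_type, Fintype.sum_sum_type, Fintype.sum_prod_type]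

/-- Concentration of the quenched free energy. -/
lemma conc (hu : IsPr pu) (hv : IsPr pv) (hB : 1 ≤ B) (he : ∀ s, |e s| ≤ B) {t h1 h2 M : ℝ}
    (hn : 0 < n) (ht : 0 ≤ t) (hh1 : 0 ≤ h1) (hh2 : 0 ≤ h2) (htM : t ≤ M) (hM1 : h1 ≤ M) (hM2 : h2 ≤ M) :
    PE (pN n pu pv) (fun x g => |Aq (pN n pu pv) (phN n e) (gN n t h1 h2) x g
      - Free (pN n pu pv) (phN n e) (gN n t h1 h2)|) ≤ (√(3 * M * B ^ 4) + 8 * M * B ^ 4) * √n := by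
  letI : MeasurableSpace S := ⊤
  haveI : MeasurableSingletonClass S := ⟨fun _ => trivial⟩
  have hp := pN_isPr (n := n) hu hv
  set γ := gN n t h1 h2 with hγd
  have hγ : ∀ k, 0 ≤ γ k := gN_nonneg ht hh1 hh2
  have hM : 0 ≤ M := ht.trans htM
  have hn' : (0 : ℝ) < n := by exact_mod_cast hn
  have hB0 : 0 ≤ B := by linarith
  set A := Aq (pN n pu pv) (phN n e) γ with hA
  have nA : ∀ x, Nc (A x) := fun x => Aq_nc hp _ x
  have hlip := Aq_lip hp (phN n e) hγ (bN n B) (phN_le he)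
  set A1 : XN n S → ℝ := fun x => ∫ g, A x g ∂(GK (KN n)) with hA1
  set A2 : (Fin n → S) → ℝ := fun u => ∑ v : Fin n → S, (∏ j, pv (v j)) * A1 (u, v) with hA2
  have hu' := prod_isPr (ι := Fin n) hu
  have hv' := prod_isPr (ι := Fin n) hv
  have hF : Free (pN n pu pv) (phN n e) γ = ∑ u : Fin n → S, (∏ i, pu (u i)) * A2 u := by
    rw [← PE_Aq hp hγ]
    unfold PE
    rw [Fintype.sum_prod_type]
    refine Finset.sum_congr rfl fun u _ => ?_
    rw [hA2]; simp only
    rw [Finset.mul_sum]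
    refine Finset.sum_congr rfl fun v _ => ?_
    have e0 : pN n pu pv (u, v) = (∏ i, pu (u i)) * ∏ j, pv (v j) := rfl
    rw [e0, mul_assoc]
  -- step 1
  have s1 : ∀ x, ∫ g, |A x g - A1 x| ∂(GK (KN n)) ≤ √(3 * M * B ^ 4) * √n := by
    intro x
    have := gauss_l1 (A x) (nA x).1.measurable (fun k => √(γ k) * bN n B k)
      (fun k => mul_nonneg (Real.sqrt_nonneg _) (by rcases k with k | k <;> simp only [bN] <;> positivity))
      (fun g g' => by have := hlip x x g g'; simpa using this)
    refine this.trans ?_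
    rw [← Real.sqrt_mul (by positivity)]
    refine Real.sqrt_le_sqrt ?_
    have e2 : ∀ k, (√(γ k) * bN n B k) ^ 2 = γ k * bN n B k ^ 2 := fun k => by
      rw [mul_pow, Real.sq_sqrt (hγ k)]
    simp only [e2, sum_KN]
    simp only [hγd, gN, bN, Finset.sum_const, Finset.card_univ, Fintype.card_fin, nsmul_eq_mul]
    have e3 : (n : ℝ) * (n * (t / n * (B * B) ^ 2)) = n * (t * B ^ 4) := by field_simp
    rw [e3]
    have hb2 : B ^ 2 ≤ B ^ 4 := pow_le_pow_right₀ hB (by norm_num)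
    have i1 : t * B ^ 4 ≤ M * B ^ 4 := by gcongr
    have i2 : h1 * B ^ 2 ≤ M * B ^ 4 := by gcongr
    have i3 : h2 * B ^ 2 ≤ M * B ^ 4 := by gcongr
    have : (n : ℝ) * (t * B ^ 4) + (n * (h1 * B ^ 2) + n * (h2 * B ^ 2)) = (t * B ^ 4 + (h1 * B ^ 2 + h2 * B ^ 2)) * n := by ring
    rw [this]
    exact mul_le_mul_of_nonneg_right (by linarith) hn'.le
  -- Lipschitz in x
  have lx : ∀ x x', |A1 x - A1 x'| ≤ ∑ k, γ k * bN n B k * |phN n e x k - phN n e x' k| := by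
    intro x x'
    rw [hA1]
    simp only
    rw [← integral_sub (nA x).int (nA x').int]
    refine (abs_integral_le_integral_abs).trans ?_
    have : ∫ g, |A x g - A x' g| ∂(GK (KN n)) ≤ ∫ _g, ∑ k, γ k * bN n B k * |phN n e x k - phN n e x' k| ∂(GK (KN n)) :=
      integral_mono ((nA x).sub (nA x')).abs.int (integrable_const _) fun g => by
        have := hlip x x' g g; simpa using this
    simpa using this
  have hB3 : B ≤ B ^ 3 := by simpa using pow_le_pow_right₀ hB (show 1 ≤ 3 by norm_num)
  have sq : √(4 * B ^ 2 * (Fintype.card (Fin n) * (2 * M * B ^ 3) ^ 2)) = 4 * M * B ^ 4 * √n := by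
    have : 4 * B ^ 2 * (Fintype.card (Fin n) * (2 * M * B ^ 3) ^ 2) = (4 * M * B ^ 4) ^ 2 * n := by
      simp only [Fintype.card_fin]; ring
    rw [this, Real.sqrt_mul (by positivity), Real.sqrt_sq (by positivity)]
  have lv : ∀ u v v', |A1 (u, v) - A1 (u, v')| ≤ ∑ j, 2 * M * B ^ 3 * |e (v j) - e (v' j)| := by
    intro u v v'
    refine (lx _ _).trans ?_
    rw [sum_KN]
    simp only [hγd, gN, bN, phN, sub_self, abs_zero, mul_zero, Finset.sum_const_zero, zero_add]
    have : ∀ i : Fin n, ∑ j, t / n * (B * B) * |e (u i) * e (v j) - e (u i) * e (v' j)|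
        ≤ ∑ j, t / n * (B * B) * (B * |e (v j) - e (v' j)|) := fun i => by
      refine Finset.sum_le_sum fun j _ => ?_
      rw [← mul_sub, abs_mul]
      have := he (u i)
      gcongr
    refine (add_le_add (Finset.sum_le_sum fun i _ => this i) le_rfl).trans ?_
    rw [Finset.sum_const, Finset.card_univ, Fintype.card_fin, nsmul_eq_mul, Finset.mul_sum, ← Finset.sum_add_distrib]
    refine Finset.sum_le_sum fun j _ => ?_
    have e4 : (n : ℝ) * (t / n * (B * B) * (B * |e (v j) - e (v' j)|)) + h2 * B * |e (v j) - e (v' j)|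
        = (t * B ^ 3 + h2 * B) * |e (v j) - e (v' j)| := by field_simp
    rw [e4]
    refine mul_le_mul_of_nonneg_right ?_ (abs_nonneg _)
    have i1 : t * B ^ 3 ≤ M * B ^ 3 := by gcongr
    have i2 : h2 * B ≤ M * B ^ 3 := by gcongr
    linarith
  have lu : ∀ u u' v, |A1 (u, v) - A1 (u', v)| ≤ ∑ j, 2 * M * B ^ 3 * |e (u j) - e (u' j)| := by
    intro u u' v
    refine (lx _ _).trans ?_
    rw [sum_KN, Finset.sum_comm]
    simp only [hγd, gN, bN, phN, sub_self, abs_zero, mul_zero, Finset.sum_const_zero, add_zero]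
    have : ∀ j : Fin n, ∑ i, t / n * (B * B) * |e (u i) * e (v j) - e (u' i) * e (v j)|
        ≤ ∑ i, t / n * (B * B) * (B * |e (u i) - e (u' i)|) := fun j => by
      refine Finset.sum_le_sum fun i _ => ?_
      rw [← sub_mul, abs_mul, mul_comm |e (u i) - e (u' i)|]
      have := he (v j)
      gcongr
    refine (add_le_add (Finset.sum_le_sum fun i _ => this i) le_rfl).trans ?_
    rw [Finset.sum_const, Finset.card_univ, Fintype.card_fin, nsmul_eq_mul, Finset.mul_sum, ← Finset.sum_add_distrib]
    refine Finset.sum_le_sum fun j _ => ?_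
    have e4 : (n : ℝ) * (t / n * (B * B) * (B * |e (u j) - e (u' j)|)) + h1 * B * |e (u j) - e (u' j)|
        = (t * B ^ 3 + h1 * B) * |e (u j) - e (u' j)| := by field_simp
    rw [e4]
    refine mul_le_mul_of_nonneg_right ?_ (abs_nonneg _)
    have i1 : t * B ^ 3 ≤ M * B ^ 3 := by gcongr
    have i2 : h1 * B ≤ M * B ^ 3 := by gcongr
    linarith
  have s2 : ∀ u : Fin n → S, ∑ v : Fin n → S, (∏ j, pv (v j)) * |A1 (u, v) - A2 u| ≤ 4 * M * B ^ 4 * √n := by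
    intro u
    rw [← sq]
    exact disc_l1 hv (fun v => A1 (u, v)) e B (2 * M * B ^ 3) he (by positivity) (lv u)
  have lA2 : ∀ u u', |A2 u - A2 u'| ≤ ∑ j, 2 * M * B ^ 3 * |e (u j) - e (u' j)| := by
    intro u u'
    rw [hA2]
    simp only
    rw [← Finset.sum_sub_distrib]
    refine (Finset.abs_sum_le_sum_abs _ _).trans ?_
    have : ∀ v : Fin n → S, |(∏ j, pv (v j)) * A1 (u, v) - (∏ j, pv (v j)) * A1 (u', v)|
        ≤ (∏ j, pv (v j)) * ∑ j, 2 * M * B ^ 3 * |e (u j) - e (u' j)| := fun v => by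
      rw [← mul_sub, abs_mul, abs_of_nonneg (hv'.nonneg v)]
      exact mul_le_mul_of_nonneg_left (lu u u' v) (hv'.nonneg v)
    refine (Finset.sum_le_sum fun v _ => this v).trans ?_
    rw [← Finset.sum_mul, hv'.sum, one_mul]
  have s3 : ∑ u : Fin n → S, (∏ j, pu (u j)) * |A2 u - Free (pN n pu pv) (phN n e) γ| ≤ 4 * M * B ^ 4 * √n := by
    rw [← sq, hF]
    exact disc_l1 hu A2 e B (2 * M * B ^ 3) he (by positivity) lA2
  -- assemble
  set F0 := Free (pN n pu pv) (phN n e) γ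
  have pt : ∀ x : XN n S, ∫ g, |A x g - F0| ∂(GK (KN n))
      ≤ √(3 * M * B ^ 4) * √n + |A1 x - A2 x.1| + |A2 x.1 - F0| := by
    intro x
    have h5 : ∫ g, |A x g - F0| ∂(GK (KN n)) ≤ ∫ g, (|A x g - A1 x| + (|A1 x - A2 x.1| + |A2 x.1 - F0|)) ∂(GK (KN n)) := by
      refine integral_mono ((nA x).sub (Nc.const _)).abs.int
        (((nA x).sub (Nc.const _)).abs.add (Nc.const _)).int fun g => ?_
      have a1 := abs_sub_le (A x g) (A1 x) F0
      have a2 := abs_sub_le (A1 x) (A2 x.1) F0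
      simp only
      linarith
    rw [integral_add ((nA x).sub (Nc.const _)).abs.int (integrable_const _)] at h5
    simp only [integral_const, probReal_univ, one_smul] at h5
    have := s1 x
    linarith
  have tot : PE (pN n pu pv) (fun x g => |A x g - F0|)
      ≤ ∑ x, pN n pu pv x * (√(3 * M * B ^ 4) * √n + |A1 x - A2 x.1| + |A2 x.1 - F0|) :=
    Finset.sum_le_sum fun x _ => mul_le_mul_of_nonneg_left (pt x) (hp.nonneg x)
  refine tot.trans ?_
  simp only [mul_add, Finset.sum_add_distrib]
  rw [← Finset.sum_mul, hp.sum]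
  have t2 : ∑ x, pN n pu pv x * |A1 x - A2 x.1| ≤ 4 * M * B ^ 4 * √n := by
    unfold pN
    rw [Fintype.sum_prod_type]
    have : ∀ u : Fin n → S, ∑ v : Fin n → S, (∏ i, pu (u i)) * (∏ j, pv (v j)) * |A1 (u, v) - A2 u|
        ≤ (∏ i, pu (u i)) * (4 * M * B ^ 4 * √n) := fun u => by
      simp only [mul_assoc, ← Finset.mul_sum]
      have := mul_le_mul_of_nonneg_left (s2 u) (hu'.nonneg u)
      simpa only [mul_assoc] using this
    refine (Finset.sum_le_sum fun u _ => this u).trans ?_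
    rw [← Finset.sum_mul, hu'.sum, one_mul]
  have t3 : ∑ x, pN n pu pv x * |A2 x.1 - F0| ≤ 4 * M * B ^ 4 * √n := by
    unfold pN
    rw [Fintype.sum_prod_type]
    refine le_trans (le_of_eq ?_) s3
    refine Finset.sum_congr rfl fun u _ => ?_
    simp only
    rw [← Finset.sum_mul, ← Finset.mul_sum, hv'.sum, mul_one]
  linarith

end nmodel

set_option linter.unusedSectionVars false

/-- abstract properties of the perturbed `n`-model -/
structure Mdl (F D1 D2 Dt : ℝ → ℝ → ℝ → ℝ) (C : ℝ) : Prop where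
  cF : Continuous fun z : ℝ × ℝ × ℝ => F z.1 z.2.1 z.2.2
  c1 : Continuous fun z : ℝ × ℝ × ℝ => D1 z.1 z.2.1 z.2.2
  c2 : Continuous fun z : ℝ × ℝ × ℝ => D2 z.1 z.2.1 z.2.2
  ct : Continuous fun z : ℝ × ℝ × ℝ => Dt z.1 z.2.1 z.2.2
  n1 : ∀ t a b, 0 ≤ D1 t a b
  n2 : ∀ t a b, 0 ≤ D2 t a b
  l1 : ∀ t a b, 0 ≤ t → 0 ≤ a → 0 ≤ b → D1 t a b ≤ C
  l2 : ∀ t a b, 0 ≤ t → 0 ≤ a → 0 ≤ b → D2 t a b ≤ C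
  nt : ∀ t a b, 0 ≤ Dt t a b
  lt : ∀ t a b, 0 ≤ t → 0 ≤ a → 0 ≤ b → Dt t a b ≤ C ^ 2
  der : ∀ t a b dt d1 d2 s : ℝ, (0 < t + s * dt ∨ dt = 0 ∧ 0 ≤ t) → (0 < a + s * d1 ∨ d1 = 0 ∧ 0 ≤ a) →
    (0 < b + s * d2 ∨ d2 = 0 ∧ 0 ≤ b) →
    HasDerivAt (fun s => F (t + s * dt) (a + s * d1) (b + s * d2))
      (dt / 2 * Dt (t + s * dt) (a + s * d1) (b + s * d2) + d1 / 2 * D1 (t + s * dt) (a + s * d1) (b + s * d2)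
        + d2 / 2 * D2 (t + s * dt) (a + s * d1) (b + s * d2)) s
  der1 : ∀ t a y : ℝ, 0 ≤ t → 0 ≤ a → 0 < y → ∃ d, 0 ≤ d ∧ HasDerivAt (fun y => D1 t a y) d y
  supp : ∀ t a b t' a' b' : ℝ, 0 < t → 0 < a → 0 < b → 0 ≤ t' → 0 ≤ a' → 0 ≤ b' →
    F t a b + ((t' - t) / 2 * Dt t a b + (a' - a) / 2 * D1 t a b + (b' - b) / 2 * D2 t a b) ≤ F t' a' b'
  lip : ∀ t a b dt d1 d2 : ℝ, 0 ≤ t → 0 ≤ a → 0 ≤ b → 0 ≤ dt → 0 ≤ d1 → 0 ≤ d2 →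
    F t a b ≤ F (t + dt) (a + d1) (b + d2) ∧
    F (t + dt) (a + d1) (b + d2) ≤ F t a b + (dt / 2 * C ^ 2 + d1 / 2 * C + d2 / 2 * C)

section nmodel
variable (n : ℕ) {S : Type} [Fintype S] (e pu pv : S → ℝ)

def MF (t a b : ℝ) : ℝ := Free (pN n pu pv) (phN n e) (gN n t a b) / n

/-- second moment of the Gibbs mean of feature `k` -/
def QN (k : KN n) (t a b : ℝ) : ℝ :=
  EM (pN n pu pv) (phN n e) (gN n t a b)
    (fun w => Br (pN n pu pv) (th (phN n e) (gN n t a b) w) (fun x => phN n e x k) ^ 2)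

def M1 (t a b : ℝ) : ℝ := (∑ i, QN n e pu pv (.inr (.inl i)) t a b) / n
def M2 (t a b : ℝ) : ℝ := (∑ i, QN n e pu pv (.inr (.inr i)) t a b) / n
def Mt (t a b : ℝ) : ℝ := (∑ i, ∑ j, QN n e pu pv (.inl (i, j)) t a b) / n ^ 2

variable {n e pu pv}

lemma gN_lin (t a b dt d1 d2 s : ℝ) :
    gN n (t + s * dt) (a + s * d1) (b + s * d2) = fun k => gN n t a b k + s * gN n dt d1 d2 k := by
  funext k
  rcases k with k | k | k <;> simp only [gN]
  ring

lemma gN_cont : Continuous fun z : ℝ × ℝ × ℝ => gN n z.1 z.2.1 z.2.2 := by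
  refine continuous_pi fun k => ?_
  rcases k with k | k | k <;> simp only [gN] <;> fun_prop

lemma QN_cont (hu : IsPr pu) (hv : IsPr pv) (k : KN n) :
    Continuous fun z : ℝ × ℝ × ℝ => QN n e pu pv k z.1 z.2.1 z.2.2 :=
  (EM_continuous (pN_isPr hu hv) (phN n e) ((Rg.Br (pN_isPr hu hv) (fun x => phN n e x k)).pow2)).comp gN_cont

lemma QN_nonneg (hu : IsPr pu) (hv : IsPr pv) (k : KN n) (t a b : ℝ) : 0 ≤ QN n e pu pv k t a b :=
  EM_nonneg (pN_isPr hu hv) fun w => sq_nonneg _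

variable {B : ℝ}

lemma QN_le (hu : IsPr pu) (hv : IsPr pv) (he : ∀ s, |e s| ≤ B) (k : KN n) {t a b : ℝ} (ht : 0 ≤ t) (ha : 0 ≤ a)
    (hb : 0 ≤ b) : QN n e pu pv k t a b ≤ bN n B k ^ 2 := by
  have hp := pN_isPr (n := n) hu hv
  refine (le_abs_self _).trans (EM_abs_le hp (gN_nonneg ht ha hb)
    (((Rg.Br hp (fun x => phN n e x k)).pow2).nc (phN n e) (gN n t a b)) fun w => ?_)
  rw [abs_pow]
  exact pow_le_pow_left₀ (abs_nonneg _) (Br_abs_le hp _ fun x => phN_le he x k) 2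

lemma sum_gN (f : KN n → ℝ) (dt d1 d2 : ℝ) : ∑ k, gN n dt d1 d2 k / 2 * f k
    = n * (dt / 2 * ((∑ i, ∑ j, f (.inl (i, j))) / n ^ 2) + d1 / 2 * ((∑ i, f (.inr (.inl i))) / n)
      + d2 / 2 * ((∑ i, f (.inr (.inr i))) / n)) := by
  rcases Nat.eq_zero_or_pos n with h | h
  · subst h; simp
  have hn : (n : ℝ) ≠ 0 := by positivity
  rw [sum_KN]
  simp only [gN, ← Finset.mul_sum]
  field_simp
  ring

lemma mdl (hu : IsPr pu) (hv : IsPr pv) (he : ∀ s, |e s| ≤ B) (hn : 0 < n) :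
    Mdl (MF n e pu pv) (M1 n e pu pv) (M2 n e pu pv) (Mt n e pu pv) (B ^ 2) := by
  have hp := pN_isPr (n := n) hu hv
  have hn' : (0 : ℝ) < n := by exact_mod_cast hn
  have cond : ∀ t a b dt d1 d2 s : ℝ, (0 < t + s * dt ∨ dt = 0 ∧ 0 ≤ t) → (0 < a + s * d1 ∨ d1 = 0 ∧ 0 ≤ a) →
      (0 < b + s * d2 ∨ d2 = 0 ∧ 0 ≤ b) →
      ∀ k, 0 < gN n t a b k + s * gN n dt d1 d2 k ∨ gN n dt d1 d2 k = 0 ∧ 0 ≤ gN n t a b k := by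
    intro t a b dt d1 d2 s h1 h2 h3 k
    rcases k with k | k | k <;> simp only [gN]
    · rcases h1 with h | ⟨h, h'⟩
      · left
        have : t / n + s * (dt / n) = (t + s * dt) / n := by ring
        rw [this]; positivity
      · right; rw [h]; exact ⟨zero_div _, by positivity⟩
    · exact h2
    · exact h3
  refine ⟨?_, ?_, ?_, ?_, ?_, ?_, ?_, ?_, ?_, ?_, ?_, ?_, ?_, ?_⟩
  · exact ((free_continuous hp (phN n e)).comp gN_cont).div_const _
  · exact (continuous_finsetSum _ fun i _ => QN_cont hu hv _).div_const _
  · exact (continuous_finsetSum _ fun i _ => QN_cont hu hv _).div_const _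
  · exact (continuous_finsetSum _ fun i _ => continuous_finsetSum _ fun j _ => QN_cont hu hv _).div_const _
  · intro t a b
    exact div_nonneg (Finset.sum_nonneg fun i _ => QN_nonneg hu hv _ _ _ _) hn'.le
  · intro t a b
    exact div_nonneg (Finset.sum_nonneg fun i _ => QN_nonneg hu hv _ _ _ _) hn'.le
  · intro t a b ht ha hb
    unfold M1
    rw [div_le_iff₀ hn']
    refine (Finset.sum_le_sum fun i _ => QN_le hu hv he _ ht ha hb).trans (le_of_eq ?_)
    simp [bN, mul_comm]
  · intro t a b ht ha hb
    unfold M2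
    rw [div_le_iff₀ hn']
    refine (Finset.sum_le_sum fun i _ => QN_le hu hv he _ ht ha hb).trans (le_of_eq ?_)
    simp [bN, mul_comm]
  · intro t a b
    exact div_nonneg (Finset.sum_nonneg fun i _ => Finset.sum_nonneg fun j _ => QN_nonneg hu hv _ _ _ _)
      (by positivity)
  · intro t a b ht ha hb
    unfold Mt
    rw [div_le_iff₀ (by positivity)]
    refine (Finset.sum_le_sum fun i _ => Finset.sum_le_sum fun j _ => QN_le hu hv he _ ht ha hb).trans (le_of_eq ?_)
    simp [bN]; ring
  · intro t a b dt d1 d2 s h1 h2 h3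
    have := (free_hasDerivAt hp (phN n e) (gN n t a b) (gN n dt d1 d2) s (cond t a b dt d1 d2 s h1 h2 h3)).div_const (n : ℝ)
    rw [sum_gN (fun k => EM (pN n pu pv) (phN n e) (fun k => gN n t a b k + s * gN n dt d1 d2 k)
      (fun w => Br (pN n pu pv) (th (phN n e) (fun k => gN n t a b k + s * gN n dt d1 d2 k) w) (fun x => phN n e x k) ^ 2)),
      mul_div_cancel_left₀ _ hn'.ne'] at this
    simp only [← gN_lin] at this
    exact this
  · intro t a y ht ha hy
    have hk : ∀ i : Fin n, ∃ d, 0 ≤ d ∧ HasDerivAt (fun y => QN n e pu pv (.inr (.inl i)) t a y) d y := by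
      intro i
      have := ov_hasDerivAt hp (phN n e) (fun x => phN n e x (.inr (.inl i))) (gN n t a 0) (gN n 0 0 1) y
        (cond t a 0 0 0 1 y (.inr ⟨rfl, ht⟩) (.inr ⟨rfl, ha⟩) (.inl (by linarith)))
      have e1 : (fun y => QN n e pu pv (.inr (.inl i)) t a y) = fun s => EM (pN n pu pv) (phN n e)
          (fun k => gN n t a 0 k + s * gN n 0 0 1 k) fun w =>
          (Br (pN n pu pv) (th (phN n e) (fun k => gN n t a 0 k + s * gN n 0 0 1 k) w) fun x =>
            phN n e x (Sum.inr (Sum.inl i))) ^ 2 := by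
        funext y
        unfold QN
        rw [← gN_lin]
        simp
      rw [← e1] at this
      refine ⟨_, ?_, this⟩
      refine Finset.sum_nonneg fun k _ => mul_nonneg ?_ (EM_nonneg hp fun w => sq_nonneg _)
      exact gN_nonneg le_rfl le_rfl zero_le_one k
    choose d hd hd' using hk
    refine ⟨(∑ i, d i) / n, div_nonneg (Finset.sum_nonneg fun i _ => hd i) hn'.le, ?_⟩
    exact (HasDerivAt.fun_sum fun i _ => hd' i).div_const _
  · intro t a b t' a' b' ht ha hb ht' ha' hb'
    have e0 := gN_lin (n := n) t a b (t' - t) (a' - a) (b' - b) 1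
    simp only [one_mul, add_sub_cancel] at e0
    have := free_supp hp (phN n e) (gN n t a b) (gN n (t' - t) (a' - a) (b' - b))
      (fun k => .inl (by rcases k with k | k | k <;> simp only [gN] <;> positivity))
      (fun k => by
        have := gN_nonneg (n := n) ht' ha' hb' k
        rw [e0] at this; exact this)
    rw [← e0, sum_gN (fun k => EM (pN n pu pv) (phN n e) (gN n t a b)
      (fun w => Br (pN n pu pv) (th (phN n e) (gN n t a b) w) (fun x => phN n e x k) ^ 2))] at this
    unfold MF M1 M2 Mt QN
    rw [le_div_iff₀ hn', add_mul, div_mul_cancel₀ _ hn'.ne', mul_comm _ (n : ℝ)]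
    exact this
  · intro t a b dt d1 d2 ht ha hb hdt hd1 hd2
    have e0 := gN_lin (n := n) t a b dt d1 d2 1
    simp only [one_mul] at e0
    have := free_lip hp (phN n e) (gN n t a b) (gN n dt d1 d2) (gN_nonneg ht ha hb) (gN_nonneg hdt hd1 hd2)
      (bN n B) (phN_le he)
    rw [← e0, sum_gN (fun k => bN n B k ^ 2)] at this
    unfold MF
    refine ⟨div_le_div_of_nonneg_right this.1 hn'.le, ?_⟩
    rw [div_le_iff₀ hn', add_mul, div_mul_cancel₀ _ hn'.ne', mul_comm _ (n : ℝ)]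
    refine this.2.trans (le_of_eq ?_)
    congr 2
    simp [bN]
    field_simp
end nmodel

set_option linter.unusedSectionVars false

lemma GK_inl (A A' : Type) [Fintype A] [Fintype A'] :
    (GK (A ⊕ A')).map (fun g a => g (.inl a)) = GK A := by
  refine (Measure.pi_eq fun s hs => ?_).symm
  have hm : Measurable (fun (g : A ⊕ A' → ℝ) (a : A) => g (.inl a)) := by fun_prop
  rw [Measure.map_apply hm (MeasurableSet.univ_pi hs)]
  have : (fun (g : A ⊕ A' → ℝ) (a : A) => g (.inl a)) ⁻¹' (Set.univ.pi s)
      = Set.univ.pi (fun k : A ⊕ A' => Sum.elim s (fun _ => Set.univ) k) := by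
    ext g
    simp [Set.mem_pi]
  rw [this]
  unfold GK
  rw [Measure.pi_pi]
  simp

lemma GK_curry (n : ℕ) : (GK (Fin n × Fin n)).map (fun g i j => g (i, j)) = noiseM n := by
  have := Measure.infinitePi_map_curry (X := ℝ) (fun (_ _ : Fin n) => stdG)
  simp only [Measure.infinitePi_eq_pi] at this
  exact this

lemma meas_curry (n : ℕ) : Measurable (fun (g : Fin n × Fin n → ℝ) (i j : Fin n) => g (i, j)) := by fun_prop
lemma meas_inl (A A' : Type) : Measurable (fun (g : A ⊕ A' → ℝ) (a : A) => g (.inl a)) := by fun_prop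

lemma integral_noise (n : ℕ) (f : (Fin n → Fin n → ℝ) → ℝ) (hf : Measurable f) :
    ∫ Z, f Z ∂(noiseM n) = ∫ g, f (fun i j => g (.inl (i, j))) ∂(GK (KN n)) := by
  rw [← GK_curry, integral_map (meas_curry n).aemeasurable hf.aestronglyMeasurable, ← GK_inl (Fin n × Fin n) (Fin n ⊕ Fin n),
    integral_map (meas_inl _ _).aemeasurable]
  exact (hf.comp (by fun_prop)).aestronglyMeasurable

lemma integrable_noise (n : ℕ) (f : (Fin n → Fin n → ℝ) → ℝ) (hf : Measurable f)
    (hi : Integrable (fun g : KN n → ℝ => f (fun i j => g (.inl (i, j)))) (GK (KN n))) : Integrable f (noiseM n) := by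
  rw [← GK_curry, integrable_map_measure hf.aestronglyMeasurable (meas_curry n).aemeasurable,
    ← GK_inl (Fin n × Fin n) (Fin n ⊕ Fin n), integrable_map_measure _ (meas_inl _ _).aemeasurable]
  · exact hi
  · exact (hf.comp (by fun_prop)).aestronglyMeasurable

section
variable (S : Finset ℝ) (PU PV : Measure ℝ) [IsProbabilityMeasure PU] [IsProbabilityMeasure PV]

/-- embedding of configurations -/
def emN (n : ℕ) (x : XN n S) : (Fin n → ℝ) × (Fin n → ℝ) := (fun i => x.1 i, fun j => x.2 j)

lemma emN_inj (n : ℕ) : Function.Injective (emN S n) := by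
  intro x y h
  simp only [emN, Prod.mk.injEq] at h
  refine Prod.ext ?_ ?_
  · funext i; exact Subtype.ext (congrFun h.1 i)
  · funext i; exact Subtype.ext (congrFun h.2 i)

lemma prior_prob (n : ℕ) : IsProbabilityMeasure (prior PU PV n) := by unfold prior; infer_instance

lemma pi_S (P : Measure ℝ) [IsProbabilityMeasure P] (hP : P ((↑S : Set ℝ)ᶜ) = 0) (n : ℕ) :
    ∀ᵐ u ∂(Measure.pi fun _ : Fin n => P), ∀ i, u i ∈ S := by
  rw [ae_all_iff]
  intro i
  have : ∀ᵐ x ∂P, x ∈ S := by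
    rw [ae_iff]; exact hP
  exact (measurePreserving_eval (fun _ : Fin n => P) i).quasiMeasurePreserving.ae this

lemma prior_range (hU : PU ((↑S : Set ℝ)ᶜ) = 0) (hV : PV ((↑S : Set ℝ)ᶜ) = 0) (n : ℕ) :
    ∀ᵐ a ∂(prior PU PV n), a ∈ Set.range (emN S n) := by
  have h1 := Measure.quasiMeasurePreserving_fst (μ := Measure.pi fun _ : Fin n => PU)
    (ν := Measure.pi fun _ : Fin n => PV) |>.ae (pi_S S PU hU n)
  have h2 := Measure.quasiMeasurePreserving_snd (μ := Measure.pi fun _ : Fin n => PU)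
    (ν := Measure.pi fun _ : Fin n => PV) |>.ae (pi_S S PV hV n)
  filter_upwards [h1, h2] with a ha hb
  exact ⟨(fun i => ⟨a.1 i, ha i⟩, fun i => ⟨a.2 i, hb i⟩), rfl⟩

lemma prior_real (n : ℕ) (x : XN n S) : (prior PU PV n).real {emN S n x} = pN n (pS S PU) (pS S PV) x := by
  unfold prior emN pN pS
  rw [← Set.singleton_prod_singleton, measureReal_prod_prod, Measure.real, Measure.real, Measure.pi_singleton, Measure.pi_singleton,
    ENNReal.toReal_prod, ENNReal.toReal_prod]
  rfl

lemma partFun_eq (hU : PU ((↑S : Set ℝ)ᶜ) = 0) (hV : PV ((↑S : Set ℝ)ᶜ) = 0) (n : ℕ) {lam : ℝ} (hl : 0 ≤ lam)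
    (x : XN n S) (Z : Fin n → Fin n → ℝ) :
    partFun PU PV lam n (emN S n x, Z) = ∑ y, pN n (pS S PU) (pS S PV) y *
      rexp (Ham lam n (emN S n x).1 (emN S n x).2 Z (emN S n y).1 (emN S n y).2) := by
  have := prior_prob PU PV n
  unfold partFun
  rw [fin_integral _ (emN S n) (emN_inj S n) (prior_range S PU PV hU hV n)]
  simp only [prior_real]

lemma Ham_eq (n : ℕ) {lam : ℝ} (hl : 0 ≤ lam) (x y : XN n S) (g : KN n → ℝ) :
    Ham lam n (emN S n x).1 (emN S n x).2 (fun i j => g (.inl (i, j))) (emN S n y).1 (emN S n y).2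
      = th (phN n Subtype.val) (gN n lam 0 0)
        (g + fun k => √(gN n lam 0 0 k) * phN n Subtype.val x k) y := by
  rw [th_planted _ (gN_nonneg hl le_rfl le_rfl), sum_KN]
  simp only [gN, phN, Real.sqrt_zero, zero_mul, zero_div, sub_zero, add_zero, Finset.sum_const_zero]
  unfold Ham emN
  refine Finset.sum_congr rfl fun i _ => Finset.sum_congr rfl fun j _ => ?_
  have : lam / (2 * n) = lam / n / 2 := by rw [div_div, mul_comm]
  rw [this]
  ring

lemma MF_eq (hU : PU ((↑S : Set ℝ)ᶜ) = 0) (hV : PV ((↑S : Set ℝ)ᶜ) = 0) (n : ℕ) {lam : ℝ} (hl : 0 ≤ lam) :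
    freeEnergy PU PV n lam = MF n Subtype.val (pS S PU) (pS S PV) lam 0 0 := by
  have hp := pN_isPr (n := n) (pS_isPr S PU hU) (pS_isPr S PV hV)
  have := prior_prob PU PV n
  have hg := gN_nonneg (n := n) hl le_rfl le_rfl
  have key : ∀ x (g : KN n → ℝ), Real.log (partFun PU PV lam n (emN S n x, fun i j => g (.inl (i, j))))
      = Aq (pN n (pS S PU) (pS S PV)) (phN n Subtype.val) (gN n lam 0 0) x g := by
    intro x g
    rw [partFun_eq S PU PV hU hV n hl]
    simp only [Ham_eq S n hl]
    rfl
  have hmeas : ∀ x, Measurable fun Z => Real.log (partFun PU PV lam n (emN S n x, Z)) := by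
    intro x
    simp only [partFun_eq S PU PV hU hV n hl]
    unfold Ham
    fun_prop
  unfold freeEnergy MF
  rw [← PE_Aq hp hg, one_div, inv_mul_eq_div]
  congr 1
  haveI : IsProbabilityMeasure (noiseM n) := by
    unfold noiseM; infer_instance
  unfold sampleM PE
  rw [fin_integral_prod _ _ (emN S n) (emN_inj S n) (prior_range S PU PV hU hV n)]
  · refine Finset.sum_congr rfl fun x _ => ?_
    rw [prior_real, integral_noise n _ (hmeas x)]
    simp only [key]
  · intro x
    refine integrable_noise n _ (hmeas x) ?_
    simp only [key]
    exact (Aq_nc hp _ x).int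
end

section decouple
variable {n : ℕ} {S : Type} [Fintype S] {e pu pv : S → ℝ}

/-- one-site feature -/
def ph1 (e : S → ℝ) (x : S) (_ : Unit) : ℝ := e x

lemma marg {q : S → ℝ} (hq : IsPr q) (i : Fin n) (G : S → ℝ) :
    ∑ x : Fin n → S, (∏ j, q (x j)) * G (x i) = ∑ s, q s * G s := by
  let _ : MeasurableSpace S := ⊤
  have : MeasurableSingletonClass S := ⟨fun _ => trivial⟩
  have := discM_prob hq
  rw [← disc_pi hq (fun x => G (x i))]
  have h := (measurePreserving_eval (fun _ : Fin n => discM q) i)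
  have h2 := integral_map (μ := Measure.pi fun _ : Fin n => discM q) (φ := Function.eval i) (f := G)
    h.measurable.aemeasurable (measurable_of_finite G).aestronglyMeasurable
  rw [h.map_eq] at h2
  simp only [Function.eval] at h2
  rw [← h2, integral_fintype .of_finite]
  refine Finset.sum_congr rfl fun s _ => ?_
  rw [Measure.real, discM_singleton, ENNReal.toReal_ofReal (hq.nonneg _), smul_eq_mul]

lemma fact (q : S → ℝ) (a : Fin n → S → ℝ) :
    ∑ x : Fin n → S, (∏ j, q (x j)) * rexp (∑ i, a i (x i)) = ∏ i, ∑ s, q s * rexp (a i s) := by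
  have := Finset.prod_univ_sum (fun _ : Fin n => (Finset.univ : Finset S)) (fun i s => q s * rexp (a i s))
  rw [Fintype.piFinset_univ] at this
  rw [this]
  refine Finset.sum_congr rfl fun x _ => ?_
  rw [Finset.prod_mul_distrib, Real.exp_sum]

lemma th1 {a : ℝ} (ha : 0 ≤ a) (x y : S) (z : ℝ) :
    th (ph1 e) (fun _ : Unit => a) ((fun _ => z) + fun k => √a * ph1 e x k) y
      = √a * e y * z + a * (e y * e x) - a * e y ^ 2 / 2 := by
  rw [th_planted (ph1 e) (fun _ => ha)]
  simp [ph1]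

lemma Aq_dec (hu : IsPr pu) (hv : IsPr pv) {a b : ℝ} (ha : 0 ≤ a) (hb : 0 ≤ b) (x : XN n S) (g : KN n → ℝ) :
    Aq (pN n pu pv) (phN n e) (gN n 0 a b) x g
      = (∑ i, Aq pu (ph1 e) (fun _ : Unit => a) (x.1 i) (fun _ => g (.inr (.inl i))))
        + ∑ i, Aq pv (ph1 e) (fun _ : Unit => b) (x.2 i) (fun _ => g (.inr (.inr i))) := by
  unfold Aq
  rw [← Real.log_prod (fun i _ => MZ_ne hu _), ← Real.log_prod (fun i _ => MZ_ne hv _),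
    ← Real.log_mul (Finset.prod_ne_zero_iff.2 fun i _ => MZ_ne hu _) (Finset.prod_ne_zero_iff.2 fun i _ => MZ_ne hv _)]
  congr 1
  unfold MZ
  simp only [th1 ha, th1 hb]
  rw [← fact, ← fact, Fintype.sum_prod_type, Finset.sum_mul]
  refine Finset.sum_congr rfl fun u _ => ?_
  rw [Finset.mul_sum]
  refine Finset.sum_congr rfl fun v _ => ?_
  rw [th_planted _ (gN_nonneg le_rfl ha hb), sum_KN]
  simp only [gN, phN, pN, zero_div, Real.sqrt_zero, zero_mul, sub_zero, add_zero, Finset.sum_const_zero, zero_add, Real.exp_add]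
  ring

lemma eval_int (k : KN n) (f : (Unit → ℝ) → ℝ) (hf : Nc f) :
    ∫ g, f (fun _ => g k) ∂(GK (KN n)) = ∫ g, f g ∂(GK Unit) ∧
      Integrable (fun g : KN n → ℝ => f (fun _ => g k)) (GK (KN n)) := by
  have h := measurePreserving_eval (fun _ : KN n => stdG) k
  have hm : Measurable fun z : ℝ => f (fun _ => z) := hf.1.measurable.comp (by fun_prop)
  have h1 := integral_GK_unit (fun z => f (fun _ => z))
  have h3 := integrable_GK_unit (fun z => f (fun _ => z))
  have e1 : (fun g : Unit → ℝ => f (fun _ => g ())) = f := by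
    funext g; congr 1
  rw [e1] at h3
  have e2 : ∫ g : Unit → ℝ, f (fun _ => g ()) ∂(GK Unit) = ∫ g, f g ∂(GK Unit) := by rw [e1]
  have h2 := integral_map (μ := GK (KN n)) (φ := Function.eval k) (f := fun z => f (fun _ => z))
    h.measurable.aemeasurable hm.aestronglyMeasurable
  have hme : (GK (KN n)).map (Function.eval k) = stdG := h.map_eq
  rw [hme] at h2
  refine ⟨by rw [← e2, h1, h2], ?_⟩
  have h4 := h3.1 hf.int
  rw [← hme, integrable_map_measure hm.aestronglyMeasurable h.measurable.aemeasurable] at h4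
  exact h4

lemma MF_zero (hu : IsPr pu) (hv : IsPr pv) (hn : 0 < n) {a b : ℝ} (ha : 0 ≤ a) (hb : 0 ≤ b) :
    MF n e pu pv 0 a b = Free pu (ph1 e) (fun _ : Unit => a) + Free pv (ph1 e) (fun _ : Unit => b) := by
  have hp := pN_isPr (n := n) hu hv
  let _ : MeasurableSpace S := ⊤
  have : MeasurableSingletonClass S := ⟨fun _ => trivial⟩
  have hu' := prod_isPr (ι := Fin n) hu
  have hv' := prod_isPr (ι := Fin n) hv
  have hn' : (0 : ℝ) < n := by exact_mod_cast hn
  unfold MF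
  rw [← PE_Aq hp (gN_nonneg le_rfl ha hb), ← PE_Aq hu (fun _ => ha), ← PE_Aq hv (fun _ => hb), div_eq_iff hn'.ne']
  set Ku : S → ℝ := fun s => ∫ g, Aq pu (ph1 e) (fun _ : Unit => a) s g ∂(GK Unit) with hKu
  set Kv : S → ℝ := fun s => ∫ g, Aq pv (ph1 e) (fun _ : Unit => b) s g ∂(GK Unit) with hKv
  have h1 : ∀ x : XN n S, ∫ g, Aq (pN n pu pv) (phN n e) (gN n 0 a b) x g ∂(GK (KN n))
      = ∑ i, Ku (x.1 i) + ∑ i, Kv (x.2 i) := by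
    intro x
    simp only [Aq_dec hu hv ha hb]
    rw [integral_add, integral_finsetSum, integral_finsetSum]
    · congr 1
      · exact Finset.sum_congr rfl fun i _ => (eval_int _ _ (Aq_nc hu _ _)).1
      · exact Finset.sum_congr rfl fun i _ => (eval_int _ _ (Aq_nc hv _ _)).1
    · exact fun i _ => (eval_int _ _ (Aq_nc hv _ _)).2
    · exact fun i _ => (eval_int _ _ (Aq_nc hu _ _)).2
    · exact integrable_finsetSum _ fun i _ => (eval_int _ _ (Aq_nc hu _ _)).2
    · exact integrable_finsetSum _ fun i _ => (eval_int _ _ (Aq_nc hv _ _)).2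
  have h2 : PE (pN n pu pv) (Aq (pN n pu pv) (phN n e) (gN n 0 a b))
      = ∑ x, pN n pu pv x * (∑ i, Ku (x.1 i) + ∑ i, Kv (x.2 i)) := by
    unfold PE
    exact Finset.sum_congr rfl fun x _ => by rw [h1]
  rw [h2]
  simp only [mul_add, Finset.sum_add_distrib, add_mul]
  congr 1
  · have : ∀ u : Fin n → S, ∑ v : Fin n → S, pN n pu pv (u, v) * ∑ i, Ku (u i) = ∑ i, (∏ j, pu (u j)) * Ku (u i) := by
      intro u
      simp only [pN]
      rw [← Finset.sum_mul, ← Finset.mul_sum, hv'.sum, mul_one, Finset.mul_sum]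
    rw [Fintype.sum_prod_type]
    simp only [this]
    rw [Finset.sum_comm]
    simp only [marg hu, Finset.sum_const, Finset.card_univ, Fintype.card_fin, nsmul_eq_mul]
    rw [mul_comm]; rfl
  · have : ∀ v : Fin n → S, ∑ u : Fin n → S, pN n pu pv (u, v) * ∑ i, Kv (v i) = ∑ i, (∏ j, pv (v j)) * Kv (v i) := by
      intro v
      simp only [pN]
      rw [← Finset.sum_mul, ← Finset.sum_mul, hu'.sum, one_mul, Finset.mul_sum]
    rw [Fintype.sum_prod_type, Finset.sum_comm]
    simp only [this]
    rw [Finset.sum_comm]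
    simp only [marg hv, Finset.sum_const, Finset.card_univ, Fintype.card_fin, nsmul_eq_mul]
    rw [mul_comm]; rfl

end decouple

set_option linter.unusedSectionVars false

section nmodel
variable (n : ℕ) {S : Type} [Fintype S] (e pu pv : S → ℝ)

/-- averaged squared posterior covariance -/
def Tau (t a b : ℝ) : ℝ := (∑ i, ∑ l, EM (pN n pu pv) (phN n e) (gN n t a b)
  (fun w => Cv (pN n pu pv) (th (phN n e) (gN n t a b) w) (fun x => phN n e x (.inr (.inl i)))
    (fun x => phN n e x (.inr (.inr l))) ^ 2)) / n ^ 2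

/-- averaged absolute posterior covariance -/
def Tab (t a b : ℝ) : ℝ := (∑ i, ∑ l, EM (pN n pu pv) (phN n e) (gN n t a b)
  (fun w => |Cv (pN n pu pv) (th (phN n e) (gN n t a b) w) (fun x => phN n e x (.inr (.inl i)))
    (fun x => phN n e x (.inr (.inr l)))|)) / n ^ 2

def CovN (t a b : ℝ) : ℝ := Mt n e pu pv t a b - M1 n e pu pv t a b * M2 n e pu pv t a b

variable {n e pu pv} {B : ℝ}

/-- index set of the `u`-perturbation -/
def IU (n : ℕ) : Finset (KN n) := Finset.univ.map ⟨fun i : Fin n => .inr (.inl i), fun i j h => by simpa using h⟩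

lemma sum_IU (f : KN n → ℝ) : ∑ k ∈ IU n, f k = ∑ i, f (.inr (.inl i)) := by
  unfold IU
  rw [Finset.sum_map]
  rfl

lemma mem_IU (k : KN n) : k ∈ IU n ↔ ∃ i : Fin n, .inr (.inl i) = k := by
  unfold IU
  rw [Finset.mem_map]
  simp only [Finset.mem_univ, true_and]
  rfl

lemma gr_IU (t b r : ℝ) : gr (IU n) (gN n t 0 b) r = gN n t (r ^ 2) b := by
  funext k
  rcases k with k | k | k <;> simp [gr, mem_IU, gN]

lemma Tau_cont (hu : IsPr pu) (hv : IsPr pv) :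
    Continuous fun z : ℝ × ℝ × ℝ => Tau n e pu pv z.1 z.2.1 z.2.2 :=
  (continuous_finsetSum _ fun i _ => continuous_finsetSum _ fun l _ =>
    (EM_continuous (pN_isPr hu hv) (phN n e) ((Rg.Cv (pN_isPr hu hv) (fun x => phN n e x (.inr (.inl i)))
      (fun x => phN n e x (.inr (.inr l)))).pow2)).comp gN_cont).div_const _

lemma Tab_le (hu : IsPr pu) (hv : IsPr pv) (hn : 0 < n) {t a b : ℝ} (ht : 0 ≤ t) (ha : 0 ≤ a) (hb : 0 ≤ b)
    {s : ℝ} (hs : 0 < s) : Tab n e pu pv t a b ≤ (s * Tau n e pu pv t a b + s⁻¹) / 2 := by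
  have hp := pN_isPr (n := n) hu hv
  have hn' : (0 : ℝ) < n := by exact_mod_cast hn
  have key : ∀ i l : Fin n, EM (pN n pu pv) (phN n e) (gN n t a b)
      (fun w => |Cv (pN n pu pv) (th (phN n e) (gN n t a b) w) (fun x => phN n e x (.inr (.inl i)))
      (fun x => phN n e x (.inr (.inr l)))|) ≤ s / 2 * EM (pN n pu pv) (phN n e) (gN n t a b)
      (fun w => Cv (pN n pu pv) (th (phN n e) (gN n t a b) w) (fun x => phN n e x (.inr (.inl i)))
      (fun x => phN n e x (.inr (.inr l))) ^ 2) + s⁻¹ / 2 := by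
    intro i l
    have nC := (Rg.Cv hp (fun x => phN n e x (.inr (.inl i))) (fun x => phN n e x (.inr (.inr l)))).nc
      (phN n e) (gN n t a b)
    rw [← EM_smul, ← EM_const (φ := phN n e) hp (gN_nonneg ht ha hb) (s⁻¹ / 2), ← EM_add hp ((Nc.const _).mul nC.pow2) (Nc.const _)]
    refine EM_mono hp nC.abs (((Nc.const _).mul nC.pow2).add (Nc.const _)) fun w => ?_
    generalize Cv (pN n pu pv) (th (phN n e) (gN n t a b) w) (fun x => phN n e x (.inr (.inl i)))
      (fun x => phN n e x (.inr (.inr l))) = y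
    have h1 : 0 ≤ s⁻¹ / 2 * (s * |y| - 1) ^ 2 := by positivity
    have h2 : s⁻¹ / 2 * (s * |y| - 1) ^ 2 = s / 2 * |y| ^ 2 + s⁻¹ / 2 - |y| := by
      field_simp; ring
    rw [sq_abs] at h2
    linarith
  unfold Tab Tau
  rw [div_le_iff₀ (by positivity)]
  refine (Finset.sum_le_sum fun i _ => Finset.sum_le_sum fun l _ => key i l).trans (le_of_eq ?_)
  simp only [Finset.sum_add_distrib, ← Finset.mul_sum, Finset.sum_const, Finset.card_univ, Fintype.card_fin, nsmul_eq_mul]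
  field_simp

lemma covA (hu : IsPr pu) (hv : IsPr pv) (hB : 0 ≤ B) (he : ∀ s, |e s| ≤ B) (hn : 0 < n) {t b r : ℝ} (ht : 0 ≤ t)
    (hb : 0 ≤ b) (hr : 0 ≤ r) :
    r * |CovN n e pu pv t (r ^ 2) b| ≤ B ^ 2 * ((PE (pN n pu pv) fun x g =>
      |LL (pN n pu pv) (phN n e) (IU n) (gN n t (r ^ 2) b) r x (g + fun k => √(gN n t (r ^ 2) b k) * phN n e x k)
        - PE (pN n pu pv) fun x g => LL (pN n pu pv) (phN n e) (IU n) (gN n t (r ^ 2) b) r x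
          (g + fun k => √(gN n t (r ^ 2) b k) * phN n e x k)|) / n)
      + 4 * B ^ 2 * r * Tab n e pu pv t (r ^ 2) b := by
  have hp := pN_isPr (n := n) hu hv
  have hn' : (0 : ℝ) < n := by exact_mod_cast hn
  set p := pN n pu pv with hpd
  set φ := phN n e with hφ
  set γ := gN n t (r ^ 2) b with hγd
  have hγ : ∀ k, 0 ≤ γ k := gN_nonneg ht (sq_nonneg r) hb
  set U : Fin n → XN n S → ℝ := fun i x => φ x (.inr (.inl i)) with hU
  set V : Fin n → XN n S → ℝ := fun l x => φ x (.inr (.inr l)) with hV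
  have bU : ∀ i x, |U i x| ≤ B := fun i x => phN_le he x (.inr (.inl i))
  have bV : ∀ i x, |V i x| ≤ B := fun i x => phN_le he x (.inr (.inr i))
  have nB : ∀ a : XN n S → ℝ, Nc fun w => Br p (th φ γ w) a := fun a => (Rg.Br hp a).nc φ γ
  have nC : ∀ a a' : XN n S → ℝ, Nc fun w => Cv p (th φ γ w) a a' := fun a a' => (Rg.Cv hp a a').nc φ γ
  set f : (KN n → ℝ) → ℝ := fun w => (n : ℝ)⁻¹ * ∑ l, Br p (th φ γ w) (V l) ^ 2 with hf
  set f' : KN n → (KN n → ℝ) → ℝ := fun k w => (n : ℝ)⁻¹ * ∑ l, 2 * Br p (th φ γ w) (V l) *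
    (√(γ k) * Cv p (th φ γ w) (V l) (fun x => φ x k)) with hf'
  have nf : Nc f := (Nc.const _).mul (Nc.sum _ fun l => (nB (V l)).pow2)
  have nf' : ∀ k, Nc (f' k) := fun k => (Nc.const _).mul (Nc.sum _ fun l =>
    ((Nc.const _).mul (nB (V l))).mul ((Nc.const _).mul (nC _ _)))
  have hfd : ∀ (k : KN n) (w : KN n → ℝ), HasDerivAt (fun s : ℝ => f (w + s • (Pi.single k (1:ℝ) : KN n → ℝ))) (f' k w) 0 := by
    intro k w
    refine (HasDerivAt.fun_sum fun l _ => ?_).const_mul _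
    have := (Br_dir (φ := φ) (γ := γ) hp k w (V l)).fun_pow 2
    simp only [zero_smul, add_zero, Nat.cast_ofNat, Nat.add_one_sub_one, pow_one] at this
    exact this
  have hM : ∀ w, |f w| ≤ B ^ 2 := by
    intro w
    rw [hf]
    simp only
    rw [abs_mul, abs_of_nonneg (by positivity), inv_mul_le_iff₀ hn']
    refine (Finset.abs_sum_le_sum_abs _ _).trans ?_
    refine (Finset.sum_le_sum (g := fun _ => B ^ 2) fun l _ => ?_).trans (le_of_eq (by simp))
    rw [abs_pow]
    exact pow_le_pow_left₀ (abs_nonneg _) (Br_abs_le hp _ (bV l)) 2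
  have main := cov_le_LL (φ := φ) (I := IU n) (c := gN n t 0 b) (r := r) hp (gN_nonneg ht le_rfl hb) hr f f' nf nf' hfd (B ^ 2) hM
  rw [gr_IU] at main
  simp only [sum_IU] at main
  rw [← hγd] at main
  -- express the pieces
  have e1 : EM p φ γ (fun w => ∑ i, Br p (th φ γ w) (fun y => φ y (.inr (.inl i))) ^ 2) = n * M1 n e pu pv t (r ^ 2) b := by
    rw [EM_sum hp _ (fun i => (nB _).pow2)]
    unfold M1
    rw [mul_div_cancel₀ _ hn'.ne']
    rfl
  have e2 : EM p φ γ f = M2 n e pu pv t (r ^ 2) b := by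
    rw [hf, EM_smul, EM_sum hp _ (fun i => (nB _).pow2), inv_mul_eq_div]
    rfl
  have e3 : EM p φ γ (fun w => (∑ i, Br p (th φ γ w) (fun y => φ y (.inr (.inl i))) ^ 2) * f w)
      = (n : ℝ)⁻¹ * ∑ i, ∑ l, EM p φ γ (fun w => Br p (th φ γ w) (U i) ^ 2 * Br p (th φ γ w) (V l) ^ 2) := by
    have : ∀ w, (∑ i, Br p (th φ γ w) (fun y => φ y (.inr (.inl i))) ^ 2) * f w
        = (n : ℝ)⁻¹ * ∑ i, ∑ l, Br p (th φ γ w) (U i) ^ 2 * Br p (th φ γ w) (V l) ^ 2 := by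
      intro w
      rw [hf]
      simp only
      rw [← Finset.sum_mul_sum]
      ring
    simp only [this]
    rw [EM_smul, EM_sum hp _ (fun i => Nc.sum _ fun l => (nB _).pow2.mul (nB _).pow2)]
    congr 1
    refine Finset.sum_congr rfl fun i _ => ?_
    rw [EM_sum hp _ (fun l => (nB _).pow2.mul (nB _).pow2)]
  rw [e1, e2, e3] at main
  -- remainder 1
  set A := ∑ i, ∑ l, EM p φ γ (fun w => |Cv p (th φ γ w) (U i) (V l)|) with hA
  have hTab : Tab n e pu pv t (r ^ 2) b = A / n ^ 2 := rfl
  have r1 : ∑ i, EM p φ γ (fun w => |Br p (th φ γ w) (fun y => φ y (.inr (.inl i))) * f' (.inr (.inl i)) w|)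
      ≤ 2 * B ^ 2 * r / n * A := by
    rw [hA, Finset.mul_sum]
    refine Finset.sum_le_sum fun i _ => ?_
    rw [← EM_sum hp _ (fun l => (nC _ _).abs), ← EM_smul]
    refine EM_mono hp ((nB _).mul (nf' _)).abs ((Nc.const _).mul (Nc.sum _ fun l => (nC _ _).abs)) fun w => ?_
    rw [abs_mul]
    have h1 := Br_abs_le hp (th φ γ w) (bU i)
    have h2 : |f' (.inr (.inl i)) w| ≤ (n : ℝ)⁻¹ * ∑ l, 2 * B * (r * |Cv p (th φ γ w) (U i) (V l)|) := by
      rw [hf']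
      simp only
      rw [abs_mul, abs_of_nonneg (show (0:ℝ) ≤ (n : ℝ)⁻¹ by positivity)]
      refine mul_le_mul_of_nonneg_left ((Finset.abs_sum_le_sum_abs _ _).trans (Finset.sum_le_sum fun l _ => ?_)) (by positivity)
      have hg : √(γ (.inr (.inl i))) = r := by rw [hγd]; simp only [gN]; exact Real.sqrt_sq hr
      rw [hg, abs_mul, abs_mul, abs_mul, abs_of_nonneg hr, abs_two, Cv_comm]
      have h3 := Br_abs_le hp (th φ γ w) (bV l)
      gcongr
    calc _ ≤ B * ((n : ℝ)⁻¹ * ∑ l, 2 * B * (r * |Cv p (th φ γ w) (U i) (V l)|)) :=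
          mul_le_mul h1 h2 (abs_nonneg _) hB
      _ = _ := by
          simp only [← Finset.mul_sum]
          field_simp
  -- remainder 2
  have r2 : |∑ i, ∑ l, QN n e pu pv (.inl (i, l)) t (r ^ 2) b
      - ∑ i, ∑ l, EM p φ γ (fun w => Br p (th φ γ w) (U i) ^ 2 * Br p (th φ γ w) (V l) ^ 2)| ≤ 2 * B ^ 2 * A := by
    rw [← Finset.sum_sub_distrib, hA, Finset.mul_sum]
    refine (Finset.abs_sum_le_sum_abs _ _).trans (Finset.sum_le_sum fun i _ => ?_)
    rw [← Finset.sum_sub_distrib, Finset.mul_sum]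
    refine (Finset.abs_sum_le_sum_abs _ _).trans (Finset.sum_le_sum fun l _ => ?_)
    unfold QN
    rw [← EM_sub hp (nB _).pow2 ((nB _).pow2.mul (nB _).pow2)]
    refine (EM_abs hp ((nB _).pow2.sub ((nB _).pow2.mul (nB _).pow2))).trans ?_
    rw [← EM_smul]
    refine EM_mono hp ((nB _).pow2.sub ((nB _).pow2.mul (nB _).pow2)).abs ((Nc.const _).mul (nC _ _).abs) fun w => ?_
    have hbr : Cv p (th φ γ w) (U i) (V l) = Br p (th φ γ w) (fun x => φ x (.inl (i, l)))
      - Br p (th φ γ w) (U i) * Br p (th φ γ w) (V l) := rfl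
    have h1 := Br_abs_le hp (th φ γ w) (bU i)
    have h2 := Br_abs_le hp (th φ γ w) (bV l)
    have h3 := Br_abs_le hp (th φ γ w) (fun x => phN_le he x (.inl (i, l)))
    simp only [bN] at h3
    have h4 := mul_bound h1 h2
    rw [hbr]
    have e5 : Br p (th φ γ w) (fun x => φ x (.inl (i, l))) ^ 2 - Br p (th φ γ w) (U i) ^ 2 * Br p (th φ γ w) (V l) ^ 2
        = (Br p (th φ γ w) (fun x => φ x (.inl (i, l))) + Br p (th φ γ w) (U i) * Br p (th φ γ w) (V l))
          * (Br p (th φ γ w) (fun x => φ x (.inl (i, l))) - Br p (th φ γ w) (U i) * Br p (th φ γ w) (V l)) := by ring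
    rw [e5, abs_mul]
    refine mul_le_mul_of_nonneg_right ((abs_add_le _ _).trans ?_) (abs_nonneg _)
    have h3' : |Br p (th φ γ w) (fun x => φ x (.inl (i, l)))| ≤ B * B := h3
    linarith
  -- assemble
  set Q := ∑ i, ∑ l, QN n e pu pv (.inl (i, l)) t (r ^ 2) b with hQ
  set E := ∑ i, ∑ l, EM p φ γ (fun w => Br p (th φ γ w) (U i) ^ 2 * Br p (th φ γ w) (V l) ^ 2) with hE
  have hcov : CovN n e pu pv t (r ^ 2) b = (Q - E) / n ^ 2
      + ((n : ℝ)⁻¹ * E - n * M1 n e pu pv t (r ^ 2) b * M2 n e pu pv t (r ^ 2) b) / n := by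
    have : Mt n e pu pv t (r ^ 2) b = Q / n ^ 2 := rfl
    unfold CovN
    rw [this]
    field_simp
    ring
  have hc2 : |CovN n e pu pv t (r ^ 2) b| ≤ 2 * B ^ 2 * A / n ^ 2
      + |(n : ℝ)⁻¹ * E - n * M1 n e pu pv t (r ^ 2) b * M2 n e pu pv t (r ^ 2) b| / n := by
    rw [hcov]
    refine (abs_add_le _ _).trans (add_le_add ?_ ?_)
    · rw [abs_div, abs_of_nonneg (show (0:ℝ) ≤ (n:ℝ)^2 by positivity)]
      gcongr
    · rw [abs_div, abs_of_nonneg hn'.le]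
  have main2 := div_le_div_of_nonneg_right (main.trans (add_le_add le_rfl r1)) hn'.le
  rw [add_div, mul_div_assoc, mul_div_assoc] at main2
  rw [hTab]
  calc _ ≤ r * (2 * B ^ 2 * A / n ^ 2
      + |(n : ℝ)⁻¹ * E - n * M1 n e pu pv t (r ^ 2) b * M2 n e pu pv t (r ^ 2) b| / n) := mul_le_mul_of_nonneg_left hc2 hr
    _ = r * (2 * B ^ 2 * A / n ^ 2)
      + r * (|(n : ℝ)⁻¹ * E - n * M1 n e pu pv t (r ^ 2) b * M2 n e pu pv t (r ^ 2) b| / n) := by ring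
    _ ≤ r * (2 * B ^ 2 * A / n ^ 2) + _ := add_le_add le_rfl main2
    _ = _ := by
      field_simp
      ring

end nmodel

set_option linter.unusedSectionVars false

lemma second_diff {β : ℝ → ℝ} (hβ : Continuous β) {ra rb δ m0 : ℝ} (hδ : 0 < δ)
    (h0 : ∀ r, ra - δ ≤ r → r ≤ ra → 0 ≤ β (r + δ) - β r)
    (hm : ∀ r, rb - δ ≤ r → r ≤ rb → β (r + δ) - β r ≤ m0) :
    ∫ r in ra..rb, (β (r + δ) - 2 * β r + β (r - δ)) ≤ δ * m0 := by
  set m : ℝ → ℝ := fun r => β (r + δ) - β r with hmd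
  have cm : Continuous m := by fun_prop
  have ii : ∀ x y, IntervalIntegrable m volume x y := fun x y => cm.intervalIntegrable x y
  have e1 : ∫ r in ra..rb, (β (r + δ) - 2 * β r + β (r - δ)) = (∫ r in ra..rb, m r) - ∫ r in ra..rb, m (r - δ) := by
    have cm' : Continuous fun r => m (r - δ) := by fun_prop
    rw [← intervalIntegral.integral_sub (ii _ _) (cm'.intervalIntegrable _ _)]
    refine intervalIntegral.integral_congr fun r _ => ?_
    simp only [hmd, sub_add_cancel]
    ring
  have e2 : ∫ r in ra..rb, m (r - δ) = ∫ r in (ra - δ)..(rb - δ), m r := intervalIntegral.integral_comp_sub_right _ _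
  have e3 : (∫ r in ra..rb, m r) - ∫ r in (ra - δ)..(rb - δ), m r
      = (∫ r in (rb - δ)..rb, m r) - ∫ r in (ra - δ)..ra, m r := by
    have a1 := intervalIntegral.integral_add_adjacent_intervals (ii (ra - δ) ra) (ii ra rb)
    have a2 := intervalIntegral.integral_add_adjacent_intervals (ii (ra - δ) (rb - δ)) (ii (rb - δ) rb)
    linarith
  rw [e1, e2, e3]
  have i1 : 0 ≤ ∫ r in (ra - δ)..ra, m r :=
    intervalIntegral.integral_nonneg (by linarith) fun r hr => h0 r hr.1 hr.2
  have i2 : ∫ r in (rb - δ)..rb, m r ≤ ∫ _r in (rb - δ)..rb, m0 :=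
    intervalIntegral.integral_mono_on (by linarith) (ii _ _) (by simp) fun r hr => hm r hr.1 hr.2
  rw [intervalIntegral.integral_const, smul_eq_mul, sub_sub_cancel] at i2
  linarith

lemma cont_mid {G : ℝ → ℝ → ℝ → ℝ} (hG : Continuous fun z : ℝ × ℝ × ℝ => G z.1 z.2.1 z.2.2) (t y : ℝ) :
    Continuous fun h => G t h y :=
  hG.comp (by fun_prop : Continuous fun h : ℝ => (t, h, y))

lemma quant_abs {F D1 D2 Dt : ℝ → ℝ → ℝ → ℝ} {B : ℝ} (hm : Mdl F D1 D2 Dt (B ^ 2)) {cov tau : ℝ → ℝ}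
    {N t y ra rb δ sn C0 : ℝ} (cC : Continuous fun h => |cov h|) (cT : Continuous tau)
    (ht : 0 ≤ t) (hy : 0 ≤ y) (hra : 0 < ra) (hab : ra ≤ rb) (hδ : 0 < δ) (hδ' : δ ≤ ra) (hδ1 : δ ≤ 1)
    (hsn0 : 0 < sn) (hsn2 : sn * sn = N)
    (i2 : ∫ h in (ra ^ 2)..(rb ^ 2), tau h ≤ B ^ 2 / N)
    (pw : ∀ r ∈ Set.Icc ra rb, |cov (r ^ 2)| * (2 * r) ≤
      2 * B ^ 2 * (4 * C0 / (δ * sn) + 3 * B ^ 2 * δ)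
      + 2 * B ^ 2 / δ * (F t ((r + δ) ^ 2) y - 2 * F t (r ^ 2) y + F t ((r - δ) ^ 2) y)
      + (2 * B ^ 2 * sn * (tau (r ^ 2) * (2 * r)) + 2 * B ^ 2 / sn * (2 * r))) :
    ∫ h in (ra ^ 2)..(rb ^ 2), |cov h| ≤
      2 * B ^ 2 * (4 * C0 / (δ * sn) + 3 * B ^ 2 * δ) * (rb - ra)
      + B ^ 4 * (2 * rb + 1) * δ + 2 * B ^ 2 * (B ^ 2 + (rb ^ 2 - ra ^ 2)) / sn := by
  set β : ℝ → ℝ := fun r => F t (r ^ 2) y with hβ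
  have cβ : Continuous β := (cont_mid hm.cF t y).comp (continuous_pow 2)
  have cv : ∀ G : ℝ → ℝ, Continuous G → ∫ h in (ra ^ 2)..(rb ^ 2), G h = ∫ r in ra..rb, G (r ^ 2) * (2 * r) := by
    intro G hG
    have := intervalIntegral.integral_comp_mul_deriv (a := ra) (b := rb) (f := fun r => r ^ 2) (f' := fun r => 2 * r)
      (g := G) (fun r _ => by simpa using hasDerivAt_pow 2 r) (by fun_prop) hG
    exact this.symm
  rw [cv _ cC]
  have c1 : Continuous fun r : ℝ => 2 * B ^ 2 / δ * (β (r + δ) - 2 * β r + β (r - δ)) := by fun_prop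
  have c2 : Continuous fun r : ℝ => 2 * B ^ 2 * sn * (tau (r ^ 2) * (2 * r)) :=
    ((cT.comp (continuous_pow 2)).mul (by fun_prop)).const_mul _
  have c3 : Continuous fun r : ℝ => 2 * B ^ 2 / sn * (2 * r) := by fun_prop
  have c0 : Continuous fun _ : ℝ => 2 * B ^ 2 * (4 * C0 / (δ * sn) + 3 * B ^ 2 * δ) := continuous_const
  have hI := intervalIntegral.integral_mono_on (μ := volume) hab
    (((cC.comp (continuous_pow 2)).mul (by fun_prop : Continuous fun r : ℝ => 2 * r)).intervalIntegrable _ _)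
    (((c0.add c1).add (c2.add c3)).intervalIntegrable _ _) pw
  refine hI.trans ?_
  have s1 := intervalIntegral.integral_add (μ := volume) ((c0.add c1).intervalIntegrable ra rb)
    ((c2.add c3).intervalIntegrable ra rb)
  have s2 := intervalIntegral.integral_add (μ := volume) (c0.intervalIntegrable ra rb) (c1.intervalIntegrable ra rb)
  have s3 := intervalIntegral.integral_add (μ := volume) (c2.intervalIntegrable ra rb) (c3.intervalIntegrable ra rb)
  simp only [Pi.add_apply] at s1 ⊢
  rw [s1, s2, s3, intervalIntegral.integral_const_mul, intervalIntegral.integral_const_mul,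
    intervalIntegral.integral_const_mul, ← cv _ cT, intervalIntegral.integral_const, smul_eq_mul]
  have i1 : ∫ r in ra..rb, 2 * r = rb ^ 2 - ra ^ 2 := by
    rw [intervalIntegral.integral_const_mul, integral_id]; ring
  rw [intervalIntegral.integral_const_mul (2 * B ^ 2 / sn), i1]
  have lipβ : ∀ r, 0 ≤ r → 0 ≤ β (r + δ) - β r ∧ β (r + δ) - β r ≤ ((r + δ) ^ 2 - r ^ 2) / 2 * B ^ 2 := by
    intro r hr
    have hd : 0 ≤ (r + δ) ^ 2 - r ^ 2 := by nlinarith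
    have := hm.lip t (r ^ 2) y 0 ((r + δ) ^ 2 - r ^ 2) 0 ht (sq_nonneg r) hy le_rfl hd le_rfl
    simp only [add_zero, zero_div, zero_mul, zero_add, add_sub_cancel] at this
    simp only [hβ]
    constructor <;> linarith [this.1, this.2]
  have i3 := second_diff (m0 := (2 * rb + 1) * δ / 2 * B ^ 2) (ra := ra) (rb := rb) cβ hδ
    (fun r h1 h2 => (lipβ r (by linarith)).1)
    (fun r h1 h2 => (lipβ r (by linarith)).2.trans (by
      refine mul_le_mul_of_nonneg_right ?_ (sq_nonneg B)
      nlinarith))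
  have j2 := mul_le_mul_of_nonneg_left i2 (by positivity : 0 ≤ 2 * B ^ 2 * sn)
  have j3 := mul_le_mul_of_nonneg_left i3 (by positivity : 0 ≤ 2 * B ^ 2 / δ)
  have k2 : 2 * B ^ 2 * sn * (B ^ 2 / N) = 2 * B ^ 2 * B ^ 2 / sn := by
    rw [← hsn2]; field_simp
  have k3 : 2 * B ^ 2 / δ * (δ * ((2 * rb + 1) * δ / 2 * B ^ 2)) = B ^ 4 * (2 * rb + 1) * δ := by
    field_simp
  rw [k2] at j2
  rw [k3] at j3
  have k4 : 2 * B ^ 2 * (B ^ 2 + (rb ^ 2 - ra ^ 2)) / sn = 2 * B ^ 2 * B ^ 2 / sn + 2 * B ^ 2 / sn * (rb ^ 2 - ra ^ 2) := by ring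
  rw [k4]
  linarith

section nmodel
variable {n : ℕ} {S : Type} [Fintype S] {e pu pv : S → ℝ} {B : ℝ}

lemma tau_der (hu : IsPr pu) (hv : IsPr pv) (hn : 0 < n) {t h y : ℝ} (ht : 0 ≤ t) (hh : 0 < h) (hy : 0 ≤ y) :
    HasDerivAt (fun h => M2 n e pu pv t h y) (n * Tau n e pu pv t h y) h := by
  have hp := pN_isPr (n := n) hu hv
  have hn' : (0 : ℝ) < n := by exact_mod_cast hn
  have hk : ∀ l : Fin n, HasDerivAt (fun h => QN n e pu pv (.inr (.inr l)) t h y)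
      (∑ i, EM (pN n pu pv) (phN n e) (gN n t h y)
        (fun w => Cv (pN n pu pv) (th (phN n e) (gN n t h y) w) (fun x => phN n e x (.inr (.inl i)))
        (fun x => phN n e x (.inr (.inr l))) ^ 2)) h := by
    intro l
    have := ov_hasDerivAt hp (phN n e) (fun x => phN n e x (.inr (.inr l))) (gN n t 0 y) (gN n 0 1 0) h
      (fun k => by
        rcases k with k | k | k <;> simp only [gN]
        · right; exact ⟨zero_div _, by positivity⟩
        · left; linarith
        · right; exact ⟨by trivial, hy⟩)
    rw [sum_KN] at this
    simp only [← gN_lin] at this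
    simp only [gN, zero_div, zero_mul, Finset.sum_const_zero, zero_add, one_mul, mul_zero, mul_one, add_zero] at this
    simp only [Cv_comm _ (fun x => phN n e x (.inr (.inr l)))] at this
    exact this
  have := (HasDerivAt.fun_sum (u := Finset.univ) fun l _ => hk l).div_const (n : ℝ)
  refine this.congr_deriv ?_
  unfold Tau
  rw [Finset.sum_comm]
  field_simp

lemma tau_int (hu : IsPr pu) (hv : IsPr pv) (he : ∀ s, |e s| ≤ B) (hn : 0 < n) {t y a b : ℝ} (ht : 0 ≤ t) (hy : 0 ≤ y)
    (ha : 0 < a) (hab : a ≤ b) : ∫ h in a..b, Tau n e pu pv t h y ≤ B ^ 2 / n := by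
  have hn' : (0 : ℝ) < n := by exact_mod_cast hn
  have hm := mdl (n := n) hu hv he hn
  have ct : Continuous fun h => Tau n e pu pv t h y := cont_mid (G := Tau n e pu pv) (Tau_cont hu hv) t y
  have := intervalIntegral.integral_eq_sub_of_hasDerivAt (a := a) (b := b)
    (f := fun h => M2 n e pu pv t h y) (f' := fun h => n * Tau n e pu pv t h y)
    (fun h hh => tau_der hu hv hn ht (by
      rw [Set.uIcc_of_le hab] at hh; linarith [hh.1]) hy) ((ct.const_mul _).intervalIntegrable _ _)
  rw [intervalIntegral.integral_const_mul] at this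
  rw [le_div_iff₀ hn', mul_comm, this]
  have h1 := hm.l2 t b y ht (by linarith) hy
  have h2 := hm.n2 t a y
  linarith

lemma CovN_cont (hu : IsPr pu) (hv : IsPr pv) (hn : 0 < n) :
    Continuous fun z : ℝ × ℝ × ℝ => CovN n e pu pv z.1 z.2.1 z.2.2 := by
  have he : ∃ B, ∀ s, |e s| ≤ B := by
    refine ⟨∑ s, |e s|, fun s => Finset.single_le_sum (f := fun s => |e s|) (fun _ _ => abs_nonneg _) (Finset.mem_univ s)⟩
  obtain ⟨B, he⟩ := he
  have hm := mdl (n := n) hu hv he hn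
  exact hm.ct.sub (hm.c1.mul hm.c2)

lemma cov_quant (hu : IsPr pu) (hv : IsPr pv) (hB : 1 ≤ B) (he : ∀ s, |e s| ≤ B) (hn : 0 < n) {t y ra rb δ M : ℝ}
    (ht : 0 ≤ t) (hy : 0 ≤ y) (hra : 0 < ra) (hab : ra ≤ rb) (hδ : 0 < δ) (hδ' : δ ≤ ra) (hδ1 : δ ≤ 1)
    (htM : t ≤ M) (hyM : y ≤ M) (hrM : (rb + 1) ^ 2 ≤ M) :
    ∫ h in (ra ^ 2)..(rb ^ 2), |CovN n e pu pv t h y| ≤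
      2 * B ^ 2 * (4 * (√(3 * M * B ^ 4) + 8 * M * B ^ 4) / (δ * √n) + 3 * B ^ 2 * δ) * (rb - ra)
      + B ^ 4 * (2 * rb + 1) * δ + 2 * B ^ 2 * (B ^ 2 + (rb ^ 2 - ra ^ 2)) / √n := by
  have hp := pN_isPr (n := n) hu hv
  have hn' : (0 : ℝ) < n := by exact_mod_cast hn
  have hm := mdl (n := n) hu hv he hn
  set C0 := √(3 * M * B ^ 4) + 8 * M * B ^ 4 with hC0
  set sn := √(n : ℝ) with hsn
  have hsn0 : 0 < sn := Real.sqrt_pos.2 hn'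
  have hsn2 : sn * sn = n := Real.mul_self_sqrt hn'.le
  have cC : Continuous fun h => |CovN n e pu pv t h y| :=
    (cont_mid (G := CovN n e pu pv) (CovN_cont hu hv hn) t y).abs
  have cT : Continuous fun h => Tau n e pu pv t h y := cont_mid (G := Tau n e pu pv) (Tau_cont hu hv) t y
  have pw : ∀ r ∈ Set.Icc ra rb, |CovN n e pu pv t (r ^ 2) y| * (2 * r) ≤
      2 * B ^ 2 * (4 * C0 / (δ * sn) + 3 * B ^ 2 * δ) + 2 * B ^ 2 / δ * (MF n e pu pv t ((r + δ) ^ 2) y - 2 * MF n e pu pv t (r ^ 2) y + MF n e pu pv t ((r - δ) ^ 2) y)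
      + (2 * B ^ 2 * sn * (Tau n e pu pv t (r ^ 2) y * (2 * r)) + 2 * B ^ 2 / sn * (2 * r)) := by
    intro r hr
    have hr0 : 0 ≤ r := by linarith [hr.1]
    have h1 := covA hu hv (by linarith) he hn ht hy hr0
    have hlf := LL_fluct (φ := phN n e) (I := IU n) (c := gN n t 0 y) (r := r) hp (gN_nonneg ht le_rfl hy) hδ
      (by linarith [hr.1]) (bN n B) (phN_le he) (C0 * sn) (fun s hs1 hs2 => by
        rw [gr_IU]
        have hs0 : 0 ≤ s := by linarith [hr.1]
        refine conc hu hv hB he hn ht (sq_nonneg s) hy htM ?_ hyM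
        refine le_trans (pow_le_pow_left₀ hs0 ?_ 2) hrM
        linarith [hr.2])
    simp only [gr_IU] at hlf
    rw [sum_IU] at hlf
    simp only [bN, Finset.sum_const, Finset.card_univ, Fintype.card_fin, nsmul_eq_mul] at hlf
    have h2 := div_le_div_of_nonneg_right hlf hn'.le
    have h3 : (4 * (C0 * sn) / δ + (Free (pN n pu pv) (phN n e) (gN n t ((r + δ) ^ 2) y)
        - 2 * Free (pN n pu pv) (phN n e) (gN n t (r ^ 2) y) + Free (pN n pu pv) (phN n e) (gN n t ((r - δ) ^ 2) y)) / δ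
        + 2 * (n * (3 / 2 * B ^ 2)) * δ) / n
        = 4 * C0 / (δ * sn) + (MF n e pu pv t ((r + δ) ^ 2) y - 2 * MF n e pu pv t (r ^ 2) y + MF n e pu pv t ((r - δ) ^ 2) y) / δ + 3 * B ^ 2 * δ := by
      simp only [MF]
      rw [← hsn2]
      field_simp
    rw [h3] at h2
    have h4 := Tab_le (e := e) hu hv hn ht (sq_nonneg r) hy hsn0
    have h5 := h1.trans (add_le_add (mul_le_mul_of_nonneg_left h2 (sq_nonneg B))
      (mul_le_mul_of_nonneg_left h4 (by positivity : 0 ≤ 4 * B ^ 2 * r)))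
    calc _ = 2 * (r * |CovN n e pu pv t (r ^ 2) y|) := by ring
      _ ≤ _ := mul_le_mul_of_nonneg_left h5 zero_le_two
      _ = _ := by
        field_simp
        ring
  exact quant_abs hm cC cT ht hy hra hab hδ hδ' hδ1 hsn0 hsn2
    (tau_int (e := e) hu hv he hn ht hy (by positivity : 0 < ra ^ 2) (by gcongr : ra ^ 2 ≤ rb ^ 2)) pw

/-- Asymptotic decorrelation of the two overlaps, on average over the perturbation. -/
theorem cov_thm (hu : IsPr pu) (hv : IsPr pv) (hB : 1 ≤ B) (he : ∀ s, |e s| ≤ B) {a b T Y ε : ℝ} (ha : 0 < a) (hab : a ≤ b)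
    (hT : 0 ≤ T) (hY : 0 ≤ Y) (hε : 0 < ε) : ∀ᶠ n : ℕ in atTop, ∀ t y, 0 ≤ t → t ≤ T → 0 ≤ y → y ≤ Y →
      ∫ h in a..b, |CovN n e pu pv t h y| ≤ ε := by
  set ra := √a with hra
  set rb := √b with hrb
  have hra0 : 0 < ra := Real.sqrt_pos.2 ha
  have hrab : ra ≤ rb := Real.sqrt_le_sqrt hab
  have ra2 : ra ^ 2 = a := Real.sq_sqrt ha.le
  have rb2 : rb ^ 2 = b := Real.sq_sqrt (by linarith)
  set M := T + Y + (rb + 1) ^ 2 with hM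
  set C0 := √(3 * M * B ^ 4) + 8 * M * B ^ 4 with hC0
  set K := 2 * B ^ 2 * (3 * B ^ 2) * (rb - ra) + B ^ 4 * (2 * rb + 1) with hK
  have hK0 : 0 ≤ K := by
    have : 0 ≤ rb - ra := by linarith
    positivity
  set δ := min (min ra 1) (ε / (2 * (K + 1))) with hδ
  have hδ0 : 0 < δ := lt_min (lt_min hra0 one_pos) (by positivity)
  have hδa : δ ≤ ra := (min_le_left _ _).trans (min_le_left _ _)
  have hδ1 : δ ≤ 1 := (min_le_left _ _).trans (min_le_right _ _)
  have hδK : K * δ ≤ ε / 2 := by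
    have h1 : δ ≤ ε / (2 * (K + 1)) := min_le_right _ _
    rw [le_div_iff₀ (by positivity)] at h1
    nlinarith
  set X := 2 * B ^ 2 * (4 * C0 / δ) * (rb - ra) + 2 * B ^ 2 * (B ^ 2 + (rb ^ 2 - ra ^ 2)) with hX
  have hlim : Tendsto (fun n : ℕ => X / √(n : ℝ)) atTop (𝓝 0) :=
    Tendsto.const_div_atTop (Real.tendsto_sqrt_atTop.comp tendsto_natCast_atTop_atTop) X
  have hev := hlim.eventually (ge_mem_nhds (show (0:ℝ) < ε / 2 by positivity))
  filter_upwards [hev, eventually_gt_atTop 0] with n hn1 hn t y ht htT hy hyY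
  have hq := cov_quant (e := e) hu hv hB he hn ht hy hra0 hrab hδ0 hδa hδ1 (M := M) (by nlinarith) (by nlinarith)
    (by linarith)
  rw [ra2, rb2] at hq
  refine hq.trans ?_
  have hn' : (0 : ℝ) < n := by exact_mod_cast hn
  have hsn : 0 < √(n : ℝ) := Real.sqrt_pos.2 hn'
  have : 2 * B ^ 2 * (4 * C0 / (δ * √n) + 3 * B ^ 2 * δ) * (rb - ra)
      + B ^ 4 * (2 * rb + 1) * δ + 2 * B ^ 2 * (B ^ 2 + (b - a)) / √n = X / √n + K * δ := by
    rw [hX, hK, ra2, rb2]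
    field_simp
    ring
  rw [this]
  linarith

end nmodel

set_option linter.unusedSectionVars false

lemma swap_cont {f : ℝ → ℝ → ℝ} (hf : Continuous fun z : ℝ × ℝ => f z.1 z.2) (a b c d : ℝ) :
    ∫ x in a..b, ∫ y in c..d, f x y = ∫ y in c..d, ∫ x in a..b, f x y := by
  refine intervalIntegral_intervalIntegral_swap ?_
  exact (hf.continuousOn.integrableOn_compact (isCompact_uIcc.prod isCompact_uIcc)).mono_set
    (Set.prod_mono Set.uIoc_subset_uIcc Set.uIoc_subset_uIcc)

/-- `C¹` cut-off -/
def chi (Y x : ℝ) : ℝ := (max (Y - x) 0) ^ 2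

lemma chi_cont {Y : ℝ} : Continuous (chi Y) := by unfold chi; fun_prop

lemma chi_nonneg {Y x : ℝ} : 0 ≤ chi Y x := sq_nonneg _

lemma chi_le {Y x : ℝ} (hY : 0 ≤ Y) (hx : 0 ≤ x) : chi Y x ≤ Y ^ 2 :=
  pow_le_pow_left₀ (le_max_right _ _) (max_le (by linarith) hY) 2

lemma chi_zero {Y x : ℝ} (h : Y ≤ x) : chi Y x = 0 := by
  unfold chi; rw [max_eq_right (by linarith)]; norm_num

lemma chi_der {Y x : ℝ} : HasDerivAt (chi Y) (-(2 * max (Y - x) 0)) x := by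
  rcases lt_trichotomy x Y with h | h | h
  · have h1 : HasDerivAt (fun x => (Y - x) ^ 2) (-(2 * max (Y - x) 0)) x := by
      have := ((hasDerivAt_id x).const_sub Y).pow 2
      refine this.congr_deriv ?_
      rw [max_eq_left (by linarith)]; simp
    refine h1.congr_of_eventuallyEq ?_
    filter_upwards [Iio_mem_nhds h] with z hz
    unfold chi; rw [max_eq_left (by linarith [Set.mem_Iio.1 hz])]
  · subst h
    rw [sub_self, max_self, mul_zero, neg_zero, hasDerivAt_iff_isLittleO]
    have : (fun z => (z - x) ^ 2) =o[𝓝 x] fun z => z - x := by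
      have h2 := Asymptotics.isLittleO_pow_id (𝕜 := ℝ) (n := 2) (by norm_num)
      have h3 : Tendsto (fun z => z - x) (𝓝 x) (𝓝 0) := by
        have : Continuous fun z : ℝ => z - x := by fun_prop
        simpa using this.tendsto x
      exact h2.comp_tendsto h3
    refine Asymptotics.IsBigO.trans_isLittleO ?_ this
    refine Asymptotics.IsBigO.of_bound 1 (Eventually.of_forall fun z => ?_)
    rw [chi_zero (le_refl x)]
    simp only [smul_zero, sub_zero, one_mul, Real.norm_eq_abs, abs_pow, chi]
    refine pow_le_pow_left₀ (abs_nonneg _) ?_ 2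
    rw [abs_of_nonneg (le_max_right _ _)]
    refine max_le ?_ (abs_nonneg _)
    rw [abs_sub_comm]
    exact le_abs_self _
  · rw [max_eq_right (by linarith), mul_zero, neg_zero]
    refine (hasDerivAt_const x (0 : ℝ)).congr_of_eventuallyEq ?_
    filter_upwards [Ioi_mem_nhds h] with z hz
    exact chi_zero (le_of_lt hz)

lemma ystep {A g g' : ℝ → ℝ} {Y c β : ℝ} (cA : Continuous A) (cg : Continuous g) (cg' : Continuous g')
    (hY : 0 ≤ Y) (hc : 0 ≤ c) (hA : ∀ y, 0 ≤ A y) (dA : ∀ y, 0 < y → ∃ d, 0 ≤ d ∧ HasDerivAt A d y)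
    (dg : ∀ y, 0 < y → HasDerivAt g (g' y) y) :
    ∫ y in (0:ℝ)..Y, A y * ((-(2 * max (Y - (y + c)) 0)) - β * chi Y (y + c) * g' y) * rexp (-β * g y) ≤ 0 := by
  have cchi : Continuous fun y => chi Y (y + c) := chi_cont.comp (by fun_prop)
  choose! d hd0 hd using dA
  have key := intervalIntegral.integral_le_sub_of_hasDeriv_right_of_le (a := 0) (b := Y)
    (g := fun y => A y * (chi Y (y + c) * rexp (-β * g y)))
    (g' := fun y => d y * (chi Y (y + c) * rexp (-β * g y)) + A y * ((-(2 * max (Y - (y + c)) 0)) * rexp (-β * g y)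
      + chi Y (y + c) * (rexp (-β * g y) * (-β * g' y))))
    (φ := fun y => A y * ((-(2 * max (Y - (y + c)) 0)) - β * chi Y (y + c) * g' y) * rexp (-β * g y)) hY
    (by fun_prop) (fun y hy => by
      have h1 : HasDerivAt (fun y => chi Y (y + c)) (-(2 * max (Y - (y + c)) 0)) y := by
        have := (chi_der (Y := Y) (x := y + c)).comp y ((hasDerivAt_id y).add_const c)
        rw [mul_one] at this
        exact this
      have h2 : HasDerivAt (fun y => rexp (-β * g y)) (rexp (-β * g y) * (-β * g' y)) y :=
        ((dg y hy.1).const_mul (-β)).exp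
      exact ((hd y hy.1).mul (h1.mul h2)).hasDerivWithinAt)
    (by
      apply Continuous.integrableOn_Icc
      fun_prop)
    (fun y hy => by
      have : 0 ≤ d y * (chi Y (y + c) * rexp (-β * g y)) :=
        mul_nonneg (hd0 y hy.1) (mul_nonneg chi_nonneg (exp_pos _).le)
      linarith)
  refine key.trans ?_
  rw [chi_zero (x := Y + c) (by linarith)]
  have : 0 ≤ A 0 * (chi Y (0 + c) * rexp (-β * g 0)) := mul_nonneg (hA 0) (mul_nonneg chi_nonneg (exp_pos _).le)
  linarith

section low
variable {F D1 D2 Dt : ℝ → ℝ → ℝ → ℝ} {C : ℝ}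

/-- the comparison function -/
def GG (F : ℝ → ℝ → ℝ → ℝ) (lam q h s y : ℝ) : ℝ := F s (h + (lam - s) * q) y - q * y / 2

def WW (F : ℝ → ℝ → ℝ → ℝ) (C Y β lam q h s y : ℝ) : ℝ := chi Y (y + C * s) * rexp (-β * GG F lam q h s y)

/-- One-parameter comparison. -/
lemma pde (hm : Mdl F D1 D2 Dt C) {lam q h β Y : ℝ} (hC : 0 ≤ C) (hF : ∀ t a b, 0 ≤ t → 0 ≤ a → 0 ≤ b → 0 ≤ F t a b)
    (hl : 0 ≤ lam) (hq : 0 ≤ q) (hh : 0 < h) (hβ : 0 ≤ β) (hY : 0 ≤ Y) :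
    ∫ y in (0:ℝ)..Y, WW F C Y β lam q h lam y ≤ (∫ y in (0:ℝ)..Y, WW F C Y β lam q h 0 y)
      + β / 2 * Y ^ 2 * rexp (β * (q * Y / 2)) *
        ∫ s in (0:ℝ)..lam, ∫ y in (0:ℝ)..Y, |Dt s (h + (lam - s) * q) y
          - D1 s (h + (lam - s) * q) y * D2 s (h + (lam - s) * q) y| := by
  have comp : ∀ G : ℝ → ℝ → ℝ → ℝ, Continuous (fun z : ℝ × ℝ × ℝ => G z.1 z.2.1 z.2.2) →
      Continuous fun z : ℝ × ℝ => G z.1 (h + (lam - z.1) * q) z.2 := fun G hG =>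
    hG.comp (by fun_prop : Continuous fun z : ℝ × ℝ => (z.1, h + (lam - z.1) * q, z.2))
  have cF := comp F hm.cF
  have c1 := comp D1 hm.c1
  have c2 := comp D2 hm.c2
  have ct := comp Dt hm.ct
  set f := fun s y => F s (h + (lam - s) * q) y with hf
  set d1 := fun s y => D1 s (h + (lam - s) * q) y with hd1
  set d2 := fun s y => D2 s (h + (lam - s) * q) y with hd2
  set dt := fun s y => Dt s (h + (lam - s) * q) y with hdt
  have cG : Continuous fun z : ℝ × ℝ => GG F lam q h z.1 z.2 := by
    unfold GG; exact cF.sub (by fun_prop)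
  have cchi : Continuous fun z : ℝ × ℝ => chi Y (z.2 + C * z.1) := chi_cont.comp (by fun_prop)
  have cW : Continuous fun z : ℝ × ℝ => WW F C Y β lam q h z.1 z.2 := by
    unfold WW; exact cchi.mul ((cG.const_mul (-β)).rexp)
  have sl : ∀ {G : ℝ → ℝ → ℝ}, Continuous (fun z : ℝ × ℝ => G z.1 z.2) → ∀ s, Continuous fun y => G s y := fun hG s =>
    hG.comp (by fun_prop : Continuous fun y : ℝ => (s, y))
  have sr : ∀ {G : ℝ → ℝ → ℝ}, Continuous (fun z : ℝ × ℝ => G z.1 z.2) → ∀ y, Continuous fun s => G s y := fun hG y =>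
    hG.comp (by fun_prop : Continuous fun s : ℝ => (s, y))
  set w : ℝ → ℝ → ℝ := fun s y => (C * (-(2 * max (Y - (y + C * s)) 0))
    - β * chi Y (y + C * s) * (1 / 2 * dt s y - q / 2 * d1 s y)) * rexp (-β * GG F lam q h s y) with hw
  have cw : Continuous fun z : ℝ × ℝ => w z.1 z.2 := by
    refine Continuous.mul (Continuous.sub (by fun_prop) ?_) ((cG.const_mul (-β)).rexp)
    exact (cchi.const_mul β).mul ((ct.const_mul _).sub (c1.const_mul _))
  have ftc : ∀ y ∈ Set.Icc 0 Y, ∫ s in (0:ℝ)..lam, w s y = WW F C Y β lam q h lam y - WW F C Y β lam q h 0 y := by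
    intro y hy
    refine intervalIntegral.integral_eq_sub_of_hasDerivAt_of_le hl (sr cW y).continuousOn (fun s hs => ?_)
      ((sr cw y).intervalIntegrable _ _)
    have h1 : HasDerivAt (fun s => GG F lam q h s y) (1 / 2 * dt s y - q / 2 * d1 s y) s := by
      have := (hm.der 0 (h + lam * q) y 1 (-q) 0 s (by left; linarith [hs.1]) (by
        left; nlinarith [hs.2]) (by right; exact ⟨rfl, hy.1⟩)).sub_const (q * y / 2)
      have ee : ∀ s, h + lam * q + s * -q = h + (lam - s) * q := fun s => by ring
      simp only [ee, zero_add, mul_one, mul_zero, add_zero, zero_div, zero_mul] at this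
      refine this.congr_deriv ?_
      simp only [hdt, hd1]; ring
    have h2 : HasDerivAt (fun s => chi Y (y + C * s)) (-(2 * max (Y - (y + C * s)) 0) * C) s := by
      have h3 : HasDerivAt (fun s : ℝ => y + C * s) C s := by
        simpa using ((hasDerivAt_id s).const_mul C).const_add y
      exact (chi_der (Y := Y) (x := y + C * s)).comp s h3
    refine (h2.mul ((h1.const_mul (-β)).exp)).congr_deriv ?_
    simp only [hw]; ring
  set E := rexp (β * (q * Y / 2)) with hE
  set r : ℝ → ℝ → ℝ := fun s y => d1 s y * ((-(2 * max (Y - (y + C * s)) 0))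
    - β * chi Y (y + C * s) * (1 / 2 * (d2 s y - q))) * rexp (-β * GG F lam q h s y) with hr
  have cr : Continuous fun z : ℝ × ℝ => r z.1 z.2 := by
    refine (c1.mul (Continuous.sub (by fun_prop) ?_)).mul ((cG.const_mul (-β)).rexp)
    exact (cchi.const_mul β).mul ((c2.sub continuous_const).const_mul _)
  have cV : Continuous fun z : ℝ × ℝ => |dt z.1 z.2 - d1 z.1 z.2 * d2 z.1 z.2| := (ct.sub (c1.mul c2)).abs
  have pw : ∀ s ∈ Set.Icc 0 lam, ∀ y ∈ Set.Icc 0 Y,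
      w s y ≤ r s y + β / 2 * Y ^ 2 * E * |dt s y - d1 s y * d2 s y| := by
    intro s hs y hy
    have hpos : 0 ≤ h + (lam - s) * q := by nlinarith [hs.2]
    have hG : rexp (-β * GG F lam q h s y) ≤ E := by
      refine exp_le_exp.2 ?_
      have h0 := hF s (h + (lam - s) * q) y hs.1 hpos hy.1
      unfold GG
      have : q * y / 2 ≤ q * Y / 2 := by nlinarith [hy.2]
      nlinarith
    have hE0 := (exp_pos (-β * GG F lam q h s y)).le
    have hx : 0 ≤ chi Y (y + C * s) := chi_nonneg
    have hx2 : chi Y (y + C * s) ≤ Y ^ 2 := chi_le hY (by nlinarith [hs.1, hy.1])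
    have hl1 : d1 s y ≤ C := hm.l1 _ _ _ hs.1 hpos hy.1
    have hmx : 0 ≤ max (Y - (y + C * s)) 0 := le_max_right _ _
    have e1 : w s y = r s y - (2 * max (Y - (y + C * s)) 0 * (C - d1 s y)) * rexp (-β * GG F lam q h s y)
        - β / 2 * chi Y (y + C * s) * rexp (-β * GG F lam q h s y) * (dt s y - d1 s y * d2 s y) := by
      simp only [hw, hr]; ring
    have e2 : 0 ≤ (2 * max (Y - (y + C * s)) 0 * (C - d1 s y)) * rexp (-β * GG F lam q h s y) :=
      mul_nonneg (mul_nonneg (by linarith) (by linarith)) hE0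
    have e3 : -(β / 2 * chi Y (y + C * s) * rexp (-β * GG F lam q h s y) * (dt s y - d1 s y * d2 s y)) ≤
        β / 2 * Y ^ 2 * E * |dt s y - d1 s y * d2 s y| := by
      rw [← mul_neg]
      have t1 : 0 ≤ β / 2 * chi Y (y + C * s) * rexp (-β * GG F lam q h s y) := by positivity
      have t2 : β / 2 * chi Y (y + C * s) * rexp (-β * GG F lam q h s y) ≤ β / 2 * Y ^ 2 * E := by gcongr
      exact (mul_le_mul_of_nonneg_left (neg_le_abs _) t1).trans (mul_le_mul_of_nonneg_right t2 (abs_nonneg _))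
    linarith
  have ys : ∀ s ∈ Set.Icc 0 lam, ∫ y in (0:ℝ)..Y, r s y ≤ 0 := by
    intro s hs
    have hpos : 0 < h + (lam - s) * q := by nlinarith [hs.2]
    have k2 : Continuous fun y => d2 s y := sl (G := d2) c2 s
    refine ystep (sl (G := d1) c1 s) (sl cG s) (by fun_prop : Continuous fun y => 1 / 2 * (d2 s y - q)) hY (mul_nonneg hC hs.1)
      (fun y => hm.n1 _ _ _) (fun y hy => hm.der1 _ _ y hs.1 hpos.le hy) (fun y hy => ?_)
    have h1 := hm.der s (h + (lam - s) * q) 0 0 0 1 y (by right; exact ⟨rfl, hs.1⟩) (by right; exact ⟨rfl, hpos.le⟩)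
      (by left; linarith)
    simp only [zero_add, mul_one, mul_zero, add_zero, zero_div, zero_mul] at h1
    have h2 : HasDerivAt (fun y : ℝ => q * y / 2) (q / 2) y := by
      simpa using ((hasDerivAt_id y).const_mul q).div_const 2
    refine (h1.sub h2).congr_deriv ?_
    simp only [hd2]; ring
  have i1 : (∫ y in (0:ℝ)..Y, WW F C Y β lam q h lam y) - (∫ y in (0:ℝ)..Y, WW F C Y β lam q h 0 y)
      = ∫ s in (0:ℝ)..lam, ∫ y in (0:ℝ)..Y, w s y := by
    rw [swap_cont cw, ← intervalIntegral.integral_sub ((sl cW lam).intervalIntegrable _ _)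
      ((sl cW 0).intervalIntegrable _ _)]
    refine intervalIntegral.integral_congr fun y hy => ?_
    rw [Set.uIcc_of_le hY] at hy
    exact (ftc y hy).symm
  have i2 : ∫ s in (0:ℝ)..lam, ∫ y in (0:ℝ)..Y, w s y ≤
      ∫ s in (0:ℝ)..lam, β / 2 * Y ^ 2 * E * ∫ y in (0:ℝ)..Y, |dt s y - d1 s y * d2 s y| := by
    refine intervalIntegral.integral_mono_on hl
      ((intervalIntegral.continuous_parametric_intervalIntegral_of_continuous' cw 0 Y).intervalIntegrable _ _)
      (((intervalIntegral.continuous_parametric_intervalIntegral_of_continuous' cV 0 Y).const_mul _).intervalIntegrable _ _)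
      fun s hs => ?_
    have kV : Continuous fun y => β / 2 * Y ^ 2 * E * |dt s y - d1 s y * d2 s y| :=
      (sl (G := fun s y => |dt s y - d1 s y * d2 s y|) cV s).const_mul _
    have kr : Continuous fun y => r s y := sl cr s
    have h1 : ∫ y in (0:ℝ)..Y, w s y ≤ ∫ y in (0:ℝ)..Y, (r s y + β / 2 * Y ^ 2 * E * |dt s y - d1 s y * d2 s y|) :=
      intervalIntegral.integral_mono_on hY ((sl cw s).intervalIntegrable _ _)
        ((by fun_prop : Continuous fun y => r s y + β / 2 * Y ^ 2 * E * |dt s y - d1 s y * d2 s y|).intervalIntegrable _ _) (pw s hs)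
    refine h1.trans ?_
    rw [intervalIntegral.integral_add (kr.intervalIntegrable _ _)
      (kV.intervalIntegrable _ _), intervalIntegral.integral_const_mul]
    linarith [ys s hs]
  rw [intervalIntegral.integral_const_mul] at i2
  linarith

end low

set_option linter.unusedSectionVars false

lemma exists_le_mean {f : ℝ → ℝ} (hf : Continuous f) {a b M : ℝ} (hab : a < b) (hM : ∫ x in a..b, f x ≤ M) :
    ∃ h ∈ Set.Icc a b, f h ≤ M / (b - a) := by
  obtain ⟨h, hh, hmin⟩ := isCompact_Icc.exists_isMinOn (Set.nonempty_Icc.2 hab.le) hf.continuousOn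
  refine ⟨h, hh, ?_⟩
  have h1 : ∫ _x in a..b, f h ≤ ∫ x in a..b, f x :=
    intervalIntegral.integral_mono_on hab.le (by simp) (hf.intervalIntegrable _ _) fun x hx => hmin hx
  rw [intervalIntegral.integral_const, smul_eq_mul] at h1
  rw [le_div_iff₀ (by linarith)]
  linarith

lemma shift_bound {V : ℝ → ℝ → ℝ → ℝ} (hV : Continuous fun z : ℝ × ℝ × ℝ => V z.1 z.2.1 z.2.2)
    (hV0 : ∀ s h y, 0 ≤ V s h y) {a b lam q Y κ : ℝ} (hab : a ≤ b) (hl : 0 ≤ lam) (hq : 0 ≤ q) (hY : 0 ≤ Y)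
    (hκ : ∀ s y, 0 ≤ s → s ≤ lam → 0 ≤ y → y ≤ Y → ∫ h in a..(b + lam * q), V s h y ≤ κ) :
    ∫ h in a..b, ∫ s in (0:ℝ)..lam, ∫ y in (0:ℝ)..Y, V s (h + (lam - s) * q) y ≤ lam * (Y * κ) := by
  have c3 : Continuous fun z : (ℝ × ℝ) × ℝ => V z.1.2 (z.1.1 + (lam - z.1.2) * q) z.2 :=
    hV.comp (by fun_prop : Continuous fun z : (ℝ × ℝ) × ℝ => (z.1.2, z.1.1 + (lam - z.1.2) * q, z.2))
  have c2 : Continuous fun z : ℝ × ℝ => ∫ y in (0:ℝ)..Y, V z.2 (z.1 + (lam - z.2) * q) y :=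
    intervalIntegral.continuous_parametric_intervalIntegral_of_continuous'
      (f := fun (z : ℝ × ℝ) y => V z.2 (z.1 + (lam - z.2) * q) y) c3 0 Y
  rw [swap_cont (f := fun h s => ∫ y in (0:ℝ)..Y, V s (h + (lam - s) * q) y) c2]
  have cs : Continuous fun s => ∫ h in a..b, ∫ y in (0:ℝ)..Y, V s (h + (lam - s) * q) y :=
    intervalIntegral.continuous_parametric_intervalIntegral_of_continuous'
      (f := fun s h => ∫ y in (0:ℝ)..Y, V s (h + (lam - s) * q) y)
      (c2.comp (by fun_prop : Continuous fun z : ℝ × ℝ => (z.2, z.1))) a b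
  have key : ∀ s ∈ Set.Icc 0 lam, ∫ h in a..b, ∫ y in (0:ℝ)..Y, V s (h + (lam - s) * q) y ≤ Y * κ := by
    intro s hs
    have c4 : Continuous fun z : ℝ × ℝ => V s (z.1 + (lam - s) * q) z.2 :=
      hV.comp (by fun_prop : Continuous fun z : ℝ × ℝ => (s, z.1 + (lam - s) * q, z.2))
    rw [swap_cont (f := fun h y => V s (h + (lam - s) * q) y) c4]
    have c5 : Continuous fun y => ∫ h in a..b, V s (h + (lam - s) * q) y :=
      intervalIntegral.continuous_parametric_intervalIntegral_of_continuous'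
        (f := fun y h => V s (h + (lam - s) * q) y)
        (c4.comp (by fun_prop : Continuous fun z : ℝ × ℝ => (z.2, z.1))) a b
    have h1 : ∫ y in (0:ℝ)..Y, (∫ h in a..b, V s (h + (lam - s) * q) y) ≤ ∫ _y in (0:ℝ)..Y, κ := by
      refine intervalIntegral.integral_mono_on hY (c5.intervalIntegrable _ _) (by simp) fun y hy => ?_
      refine le_trans ?_ (hκ s y hs.1 hs.2 hy.1 hy.2)
      rw [intervalIntegral.integral_comp_add_right (fun h => V s h y)]
      have d0 : 0 ≤ (lam - s) * q := mul_nonneg (by linarith [hs.2]) hq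
      have d1 : (lam - s) * q ≤ lam * q := mul_le_mul_of_nonneg_right (by linarith [hs.1]) hq
      exact intervalIntegral.integral_mono_interval (by linarith) (by linarith) (by linarith)
        (Eventually.of_forall fun h => hV0 s h y) ((cont_mid hV s y).intervalIntegrable _ _)
    refine h1.trans ?_
    rw [intervalIntegral.integral_const, smul_eq_mul, sub_zero]
  have h1 := intervalIntegral.integral_mono_on (μ := volume) hl (cs.intervalIntegrable 0 lam) (by simp) key
  refine h1.trans ?_
  rw [intervalIntegral.integral_const, smul_eq_mul, sub_zero]

section low
variable {F D1 D2 Dt : ℝ → ℝ → ℝ → ℝ} {C : ℝ}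

lemma low_one (hm : Mdl F D1 D2 Dt C) {lam q β η a b κ m : ℝ} (hC : 0 ≤ C)
    (hF : ∀ t a b, 0 ≤ t → 0 ≤ a → 0 ≤ b → 0 ≤ F t a b)
    (hl : 0 ≤ lam) (hq : 0 ≤ q) (ha : 0 < a) (hab : a < b) (hβ : 0 ≤ β) (hη : 0 < η)
    (hmin : ∀ y, 0 ≤ y → m ≤ F 0 (lam * q) y - q * y / 2)
    (hκ : ∀ s y, 0 ≤ s → s ≤ lam → 0 ≤ y → y ≤ C * lam + η →
      ∫ h in a..(b + lam * q), |Dt s h y - D1 s h y * D2 s h y| ≤ κ) :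
    (η / 2) ^ 3 * rexp (-β * (F lam 0 0 + (b + η) * C / 2)) ≤ (C * lam + η) ^ 3 * rexp (-β * m)
      + β / 2 * (C * lam + η) ^ 2 * rexp (β * (q * (C * lam + η) / 2)) * (lam * ((C * lam + η) * κ) / (b - a)) := by
  set Y := C * lam + η with hYd
  have hY : 0 < Y := by positivity
  have cV : Continuous fun z : ℝ × ℝ × ℝ => |Dt z.1 z.2.1 z.2.2 - D1 z.1 z.2.1 z.2.2 * D2 z.1 z.2.1 z.2.2| :=
    (hm.ct.sub (hm.c1.mul hm.c2)).abs
  have hsh := shift_bound (V := fun s h y => |Dt s h y - D1 s h y * D2 s h y|) cV (fun _ _ _ => abs_nonneg _)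
    hab.le hl hq hY.le hκ
  have c3 : Continuous fun z : (ℝ × ℝ) × ℝ => |Dt z.1.2 (z.1.1 + (lam - z.1.2) * q) z.2
      - D1 z.1.2 (z.1.1 + (lam - z.1.2) * q) z.2 * D2 z.1.2 (z.1.1 + (lam - z.1.2) * q) z.2| :=
    cV.comp (by fun_prop : Continuous fun z : (ℝ × ℝ) × ℝ => (z.1.2, z.1.1 + (lam - z.1.2) * q, z.2))
  have c2 := intervalIntegral.continuous_parametric_intervalIntegral_of_continuous' (μ := volume)
      (f := fun (z : ℝ × ℝ) y => |Dt z.2 (z.1 + (lam - z.2) * q) y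
      - D1 z.2 (z.1 + (lam - z.2) * q) y * D2 z.2 (z.1 + (lam - z.2) * q) y|) c3 0 Y
  have c1 := intervalIntegral.continuous_parametric_intervalIntegral_of_continuous' (μ := volume)
      (f := fun (h s : ℝ) => ∫ y in (0:ℝ)..Y, |Dt s (h + (lam - s) * q) y
      - D1 s (h + (lam - s) * q) y * D2 s (h + (lam - s) * q) y|) c2 0 lam
  obtain ⟨h, hh, hle⟩ := exists_le_mean c1 hab hsh
  have h0 : 0 < h := by linarith [hh.1]
  have P := pde hm hC hF hl hq h0 hβ hY.le
  have P2 := mul_le_mul_of_nonneg_left hle (by positivity : 0 ≤ β / 2 * Y ^ 2 * rexp (β * (q * Y / 2)))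
  have cW : ∀ s, Continuous fun y => WW F C Y β lam q h s y := by
    intro s
    have k1 : Continuous fun y => F s (h + (lam - s) * q) y :=
      hm.cF.comp (by fun_prop : Continuous fun y : ℝ => (s, h + (lam - s) * q, y))
    have k2 : Continuous fun y => chi Y (y + C * s) := chi_cont.comp (by fun_prop)
    unfold WW GG
    fun_prop
  have U : ∫ y in (0:ℝ)..Y, WW F C Y β lam q h 0 y ≤ Y ^ 3 * rexp (-β * m) := by
    have : ∫ y in (0:ℝ)..Y, WW F C Y β lam q h 0 y ≤ ∫ _y in (0:ℝ)..Y, Y ^ 2 * rexp (-β * m) := by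
      refine intervalIntegral.integral_mono_on hY.le ((cW 0).intervalIntegrable _ _) (by simp) fun y hy => ?_
      unfold WW
      refine mul_le_mul (chi_le hY.le (by simpa using hy.1)) (exp_le_exp.2 ?_) (exp_pos _).le (by positivity)
      have h1 := hmin y hy.1
      have h2 := (hm.lip 0 (lam * q) y 0 h 0 le_rfl (by positivity) hy.1 le_rfl h0.le le_rfl).1
      simp only [add_zero] at h2
      unfold GG
      rw [sub_zero, add_comm h]
      nlinarith
    rw [intervalIntegral.integral_const, smul_eq_mul, sub_zero] at this
    linarith
  have Lw : (η / 2) ^ 3 * rexp (-β * (F lam 0 0 + (b + η) * C / 2)) ≤ ∫ y in (0:ℝ)..Y, WW F C Y β lam q h lam y := by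
    have hηY : η / 2 ≤ Y := by
      have := mul_nonneg hC hl
      linarith
    have s1 : ∫ y in (0:ℝ)..(η / 2), WW F C Y β lam q h lam y ≤ ∫ y in (0:ℝ)..Y, WW F C Y β lam q h lam y :=
      intervalIntegral.integral_mono_interval le_rfl (by linarith) hηY
        (Eventually.of_forall fun y => mul_nonneg chi_nonneg (exp_pos _).le) ((cW lam).intervalIntegrable _ _)
    refine le_trans ?_ s1
    have : ∫ _y in (0:ℝ)..(η / 2), (η / 2) ^ 2 * rexp (-β * (F lam 0 0 + (b + η) * C / 2)) ≤
        ∫ y in (0:ℝ)..(η / 2), WW F C Y β lam q h lam y := by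
      refine intervalIntegral.integral_mono_on (by linarith) (by simp) ((cW lam).intervalIntegrable _ _) fun y hy => ?_
      unfold WW
      refine mul_le_mul ?_ (exp_le_exp.2 ?_) (exp_pos _).le chi_nonneg
      · unfold chi
        refine pow_le_pow_left₀ (by linarith) (le_max_of_le_left ?_) 2
        rw [hYd]; linarith [hy.2]
      · have h2 := (hm.lip lam 0 0 0 h y hl le_rfl le_rfl le_rfl h0.le hy.1).2
        simp only [add_zero, zero_add, zero_div, zero_mul] at h2
        unfold GG
        rw [sub_self, zero_mul, add_zero]
        have h3 : h * C ≤ b * C := mul_le_mul_of_nonneg_right hh.2 hC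
        have h4 : y * C ≤ η * C := mul_le_mul_of_nonneg_right (by linarith [hy.2]) hC
        have h5 : 0 ≤ q * y := mul_nonneg hq hy.1
        rw [neg_mul, neg_mul, neg_le_neg_iff]
        refine mul_le_mul_of_nonneg_left ?_ hβ
        linarith
    rw [intervalIntegral.integral_const, smul_eq_mul, sub_zero] at this
    linarith
  linarith

lemma up_one (hm : Mdl F D1 D2 Dt C) {lam a b κ L : ℝ} (hC : 0 ≤ C) (hl : 0 < lam) (ha : 0 < a) (hab : a < b)
    (hL : ∀ q, 0 ≤ q → ∃ r, 0 ≤ r ∧ F 0 (lam * q) (lam * r) - lam / 2 * q * r ≤ L)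
    (hκ : ∫ h in a..b, |Dt lam h b - D1 lam h b * D2 lam h b| ≤ κ) :
    F lam 0 0 ≤ L + b * C + lam / 2 * (κ / (b - a)) := by
  have cV : Continuous fun z : ℝ × ℝ × ℝ => |Dt z.1 z.2.1 z.2.2 - D1 z.1 z.2.1 z.2.2 * D2 z.1 z.2.1 z.2.2| :=
    (hm.ct.sub (hm.c1.mul hm.c2)).abs
  obtain ⟨h, hh, hle⟩ := exists_le_mean
    (cont_mid (G := fun s h y => |Dt s h y - D1 s h y * D2 s h y|) cV lam b) hab hκ
  have h0 : 0 < h := by linarith [hh.1]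
  have hb : 0 < b := by linarith
  have q1 := hm.n2 lam h b
  have q2 := hm.n1 lam h b
  have l1 := hm.l2 lam h b hl.le h0.le hb.le
  have l2 := hm.l1 lam h b hl.le h0.le hb.le
  obtain ⟨r, hr, hrL⟩ := hL _ q1
  have hs := hm.supp lam h b 0 (lam * D2 lam h b) (lam * r) hl h0 hb le_rfl (by positivity) (by positivity)
  have hlp := (hm.lip lam 0 0 0 h b hl.le le_rfl le_rfl le_rfl h0.le hb.le).1
  simp only [add_zero, zero_add] at hlp
  have habs := (le_abs_self _).trans hle
  have h1 := mul_le_mul_of_nonneg_left habs (by linarith : 0 ≤ lam / 2)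
  have h2 : h * D1 lam h b ≤ b * C := mul_le_mul hh.2 l2 q2 hb.le
  have h3 : b * D2 lam h b ≤ b * C := mul_le_mul_of_nonneg_left l1 hb.le
  nlinarith

end low

section nmodel
variable {S : Type} [Fintype S] {e pu pv : S → ℝ} {B : ℝ}

theorem upper (hu : IsPr pu) (hv : IsPr pv) (hB : 1 ≤ B) (he : ∀ s, |e s| ≤ B) {lam L δ : ℝ} (hl : 0 < lam)
    (hδ : 0 < δ)
    (hL : ∀ n : ℕ, 0 < n → ∀ q, 0 ≤ q → ∃ r, 0 ≤ r ∧ MF n e pu pv 0 (lam * q) (lam * r) - lam / 2 * q * r ≤ L) :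
    ∀ᶠ n : ℕ in atTop, MF n e pu pv lam 0 0 ≤ L + δ := by
  have hB2 : 0 < B ^ 2 := by positivity
  set b := δ / (2 * B ^ 2) with hb
  have hb0 : 0 < b := by positivity
  have hbC : b * B ^ 2 = δ / 2 := by rw [hb]; field_simp
  filter_upwards [cov_thm (e := e) hu hv hB he (a := b / 2) (b := b) (T := lam) (Y := b) (ε := δ * (b / 2) / lam)
    (by positivity) (by linarith) hl.le hb0.le (by positivity), eventually_gt_atTop 0] with n hn hn0
  have := up_one (mdl hu hv he hn0) (a := b / 2) (b := b) (κ := δ * (b / 2) / lam) hB2.le hl (by positivity)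
    (by linarith) (hL n hn0) (hn lam b hl.le le_rfl hb0.le le_rfl)
  rw [hbC] at this
  have e1 : lam / 2 * (δ * (b / 2) / lam / (b - b / 2)) = δ / 2 := by
    rw [sub_half]; field_simp
  rw [e1] at this
  linarith

theorem lower (hu : IsPr pu) (hv : IsPr pv) (hB : 1 ≤ B) (he : ∀ s, |e s| ≤ B) {lam q m δ : ℝ} (hl : 0 < lam)
    (hq : 0 ≤ q) (hδ : 0 < δ)
    (h00 : ∀ n : ℕ, 0 < n → 0 ≤ MF n e pu pv 0 0 0)
    (hmin : ∀ n : ℕ, 0 < n → ∀ y, 0 ≤ y → m ≤ MF n e pu pv 0 (lam * q) y - q * y / 2) :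
    ∀ᶠ n : ℕ in atTop, m - δ ≤ MF n e pu pv lam 0 0 := by
  have hB2 : 0 < B ^ 2 := by positivity
  set C := B ^ 2 with hC
  set η := δ / (4 * C) with hη
  have hη0 : 0 < η := by positivity
  have hηC : (η + η) * C / 2 = δ / 4 := by rw [hη]; field_simp; norm_num
  set Y := C * lam + η with hY
  have hY0 : 0 < Y := by positivity
  -- choice of β
  obtain ⟨β, hβ0, hβ⟩ : ∃ β : ℝ, 0 < β ∧ Y ^ 3 ≤ (η / 2) ^ 3 / 2 * rexp (β * (δ / 2)) := by
    have ht : Tendsto (fun β : ℝ => (η / 2) ^ 3 / 2 * rexp (β * (δ / 2))) atTop atTop :=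
      (tendsto_exp_atTop.comp (tendsto_id.atTop_mul_const (by positivity))).const_mul_atTop (by positivity)
    exact ((eventually_gt_atTop 0).and (ht.eventually (eventually_ge_atTop (Y ^ 3)))).exists
  set R := (η / 2) ^ 3 / 2 * rexp (-β * (m - δ / 2)) with hR
  have hR0 : 0 < R := by positivity
  set K := β / 2 * Y ^ 2 * rexp (β * (q * Y / 2)) * (lam * Y / (η / 2)) with hK
  have hK0 : 0 < K := by positivity
  filter_upwards [cov_thm (e := e) hu hv hB he (a := η / 2) (b := η + lam * q) (T := lam) (Y := Y) (ε := R / K)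
    (by positivity) (by nlinarith) hl.le hY0.le (by positivity), eventually_gt_atTop 0] with n hn hn0
  have hm := mdl (n := n) hu hv he hn0
  have hF : ∀ t a b, 0 ≤ t → 0 ≤ a → 0 ≤ b → 0 ≤ MF n e pu pv t a b := by
    intro t a b ht ha hb
    have := (hm.lip 0 0 0 t a b le_rfl le_rfl le_rfl ht ha hb).1
    simp only [zero_add] at this
    exact (h00 n hn0).trans this
  have key := low_one hm (q := q) (β := β) (η := η) (a := η / 2) (b := η) (κ := R / K) hB2.le hF hl.le hq (by positivity)
    (by linarith) hβ0.le hη0 (hmin n hn0) (fun s y h1 h2 h3 h4 => hn s y h1 h2 h3 h4)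
  rw [hηC, ← hY] at key
  have e1 : β / 2 * Y ^ 2 * rexp (β * (q * Y / 2)) * (lam * (Y * (R / K)) / (η - η / 2)) = R := by
    rw [sub_half]
    have : β / 2 * Y ^ 2 * rexp (β * (q * Y / 2)) * (lam * (Y * (R / K)) / (η / 2)) = K * (R / K) := by
      rw [hK]; ring
    rw [this]; field_simp
  rw [e1] at key
  have e2 : Y ^ 3 * rexp (-β * m) ≤ R := by
    calc Y ^ 3 * rexp (-β * m) ≤ (η / 2) ^ 3 / 2 * rexp (β * (δ / 2)) * rexp (-β * m) := by gcongr
      _ = R := by rw [hR, mul_assoc, ← exp_add]; ring_nf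
  have e3 : R + R = (η / 2) ^ 3 * rexp (-β * (m - δ / 2)) := by rw [hR]; ring
  have e4 : (η / 2) ^ 3 * rexp (-β * (MF n e pu pv lam 0 0 + δ / 4)) ≤ (η / 2) ^ 3 * rexp (-β * (m - δ / 2)) := by
    linarith
  have e5 := exp_le_exp.1 (le_of_mul_le_mul_left e4 (by positivity))
  rw [neg_mul, neg_mul, neg_le_neg_iff] at e5
  have := le_of_mul_le_mul_left e5 hβ0
  linarith

end nmodel

set_option linter.unusedSectionVars false

lemma free_limit (K₀ : ℝ) (S : Finset ℝ) (hSK : ∀ x ∈ S, |x| ≤ K₀)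
    (PU PV : Measure ℝ) [IsProbabilityMeasure PU] [IsProbabilityMeasure PV]
    (hUS : PU ((↑S : Set ℝ)ᶜ) = 0) (hVS : PV ((↑S : Set ℝ)ᶜ) = 0) (lam : ℝ) (hlam : 0 < lam) :
    Tendsto (fun n => freeEnergy PU PV n lam) atTop
      (𝓝 (sSup ((fun q : ℝ × ℝ => rsF PU PV lam q.1 q.2) '' Gam PU PV lam))) := by
  set L := sSup ((fun q : ℝ × ℝ => rsF PU PV lam q.1 q.2) '' Gam PU PV lam) with hLd
  have sU := scal_of S PU hUS K₀ hSK
  have sV := scal_of S PV hVS K₀ hSK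
  have hu := pS_isPr S PU hUS
  have hv := pS_isPr S PV hVS
  set B := max K₀ 1 with hB
  have hB1 : 1 ≤ B := le_max_right _ _
  have he : ∀ s : {x // x ∈ S}, |(Subtype.val : {x // x ∈ S} → ℝ) s| ≤ B := fun s =>
    (hSK s.1 s.2).trans (le_max_left _ _)
  have hz : ∀ n : ℕ, 0 < n → ∀ a b : ℝ, 0 ≤ a → 0 ≤ b →
      MF n (Subtype.val : {x // x ∈ S} → ℝ) (pS S PU) (pS S PV) 0 a b = psiF PU a + psiF PV b := by
    intro n hn a b ha hb
    rw [MF_zero hu hv hn ha hb, psiF_eq S PU hUS ha, psiF_eq S PV hVS hb]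
    rfl
  have hne : ((fun q : ℝ × ℝ => rsF PU PV lam q.1 q.2) '' Gam PU PV lam).Nonempty := by
    obtain ⟨q, hq, -⟩ := exists_fix PU PV _ lam sU sV hlam 0 le_rfl
    exact ⟨_, q, hq, rfl⟩
  rw [Metric.tendsto_atTop']
  intro ε hε
  -- upper bound
  have hup := upper (L := L) (δ := ε / 2) hu hv hB1 he hlam (by positivity) (fun n hn q hq => by
    have h0 : 0 ≤ Fov PU (lam * q) := sU.F_nonneg _ (by positivity)
    refine ⟨Fov PU (lam * q), h0, ?_⟩
    rw [hz n hn _ _ (by positivity) (by positivity)]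
    exact rsF_le_L PU PV _ lam sU sV hlam q hq)
  obtain ⟨v, ⟨q, hqG, rfl⟩, hqv⟩ := exists_lt_of_lt_csSup hne (show L - ε / 2 < L by linarith)
  obtain ⟨hq1, hq2, -, hfix⟩ := hqG
  have hlo := lower (m := rsF PU PV lam q.1 q.2) (q := q.1) (δ := ε / 4) hu hv hB1 he hlam hq1 (by positivity)
    (fun n hn => by
      rw [hz n hn 0 0 le_rfl le_rfl]
      exact add_nonneg (sU.ψ_nonneg 0 le_rfl) (sV.ψ_nonneg 0 le_rfl))
    (fun n hn y hy => by
      rw [hz n hn _ _ (by positivity) hy]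
      have h1 := rsF_min_right PU PV _ lam sV hlam q.1 q.2 (y / lam) hq2 (by positivity) hfix
      refine h1.trans (le_of_eq ?_)
      unfold rsF
      rw [mul_div_cancel₀ y hlam.ne']
      field_simp)
  obtain ⟨N, hN⟩ := eventually_atTop.1 (hup.and hlo)
  refine ⟨N, fun n hn => ?_⟩
  have h := hN n hn.le
  rw [MF_eq S PU PV hUS hVS n hlam.le, Real.dist_eq, abs_lt]
  constructor <;> linarith [h.1, h.2]


/-- **Replica-Symmetric formula (rank one).**  The free energy `F_n(λ)` converges to
`sup_{(q₁,q₂) ∈ Γ(λ)} 𝓕(λ,q₁,q₂)`, which equals `sup_{q₁ ≥ 0} inf_{q₂ ≥ 0} 𝓕(λ,q₁,q₂)`;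
moreover both extrema are achieved over the same couples `(q₁,q₂) ∈ Γ(λ)`. -/
theorem rs_formula_rank_one
    (K₀ : ℝ) (S : Finset ℝ) (hSK : ∀ x ∈ S, |x| ≤ K₀)
    (PU PV : Measure ℝ) [IsProbabilityMeasure PU] [IsProbabilityMeasure PV]
    (hUS : PU ((↑S : Set ℝ)ᶜ) = 0) (hVS : PV ((↑S : Set ℝ)ᶜ) = 0)
    (hUvar : 0 < (∫ x, x ^ 2 ∂PU) - (∫ x, x ∂PU) ^ 2)
    (hVvar : 0 < (∫ x, x ^ 2 ∂PV) - (∫ x, x ∂PV) ^ 2)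
    (lam : ℝ) (hlam : 0 < lam) :
    Tendsto (fun n => freeEnergy PU PV n lam) atTop
      (𝓝 (sSup ((fun q : ℝ × ℝ => rsF PU PV lam q.1 q.2) '' Gam PU PV lam)))
    ∧ sSup ((fun q : ℝ × ℝ => rsF PU PV lam q.1 q.2) '' Gam PU PV lam)
        = ⨆ q₁ : {x : ℝ // 0 ≤ x}, ⨅ q₂ : {x : ℝ // 0 ≤ x}, rsF PU PV lam q₁.1 q₂.1
    ∧ ∀ q ∈ Gam PU PV lam,
        ((∀ q' ∈ Gam PU PV lam, rsF PU PV lam q'.1 q'.2 ≤ rsF PU PV lam q.1 q.2)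
          ↔ (rsF PU PV lam q.1 q.2 = ⨅ q₂ : {x : ℝ // 0 ≤ x}, rsF PU PV lam q.1 q₂.1
             ∧ (⨅ q₂ : {x : ℝ // 0 ≤ x}, rsF PU PV lam q.1 q₂.1)
               = ⨆ q₁ : {x : ℝ // 0 ≤ x}, ⨅ q₂ : {x : ℝ // 0 ≤ x},
                   rsF PU PV lam q₁.1 q₂.1)) := by
  exact ⟨free_limit K₀ S hSK PU PV hUS hVS lam hlam,
    opt_parts PU PV (K₀ ^ 2) lam (scal_of S PU hUS K₀ hSK) (scal_of S PV hVS K₀ hSK) hlam⟩
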